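/- arXiv:1305.0837 — 8 statements merged into one kernel-verified Lean document; each statement's English description precedes it below -/
import Mathlib

section
/- Let d ≥ 1, 0 < λ ≤ Λ and m > 0. Let a : ℤ^d × ℝ → ℝ^{d×d} be measurable with each a(y,s) a symmetric matrix satisfying λ I_d ≤ a(y,s) ≤ Λ I_d as quadratic forms. Let g ∈ L²(ℤ^d × ℝ) and let v : ℤ^d × ℝ → ℂ be such that v ∈ L²(ℤ^d × ℝ), the ℓ²(ℤ^d)-valued map s ↦ v(·,s) is continuously differentiable with derivative s ↦ ∂v/∂s(·,s), ‖v(·,s)‖_{ℓ²(ℤ^d)} → 0 as s → +∞ and as s → −∞, and v satisfies ∂v/∂s(y,s) − (m²/2) v(y,s) = (1/2) ∇*( a(·,s) ∇v(·,s) )(y) − g(y,s) for all y ∈ ℤ^d and s ∈ ℝ. Then ‖v‖₂ ≤ (2/m²) ‖g‖₂. -/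
open MeasureTheory Real Filter Matrix
open scoped ENNReal BigOperators

noncomputable section

namespace Stmt0

/-- The `j`-th standard basis vector of `ℤ^d`. -/
def e (d : ℕ) (j : Fin d) : Fin d → ℤ := fun k => if k = j then 1 else 0

/-- Discrete gradient `∇u(x) j = u(x+e_j) - u(x)`. -/
def dGrad {d : ℕ} (u : (Fin d → ℤ) → ℂ) (x : Fin d → ℤ) : Fin d → ℂ :=
  fun j => u (x + e d j) - u x

/-- Discrete divergence `∇*F(x) = Σ_j [F_j(x-e_j) - F_j(x)]`. -/
def dDiv {d : ℕ} (F : (Fin d → ℤ) → Fin d → ℂ) (x : Fin d → ℤ) : ℂ :=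
  ∑ j, (F (x - e d j) j - F x j)

/-- A real matrix acting on a complex vector. -/
def matMulC {d : ℕ} (M : Matrix (Fin d) (Fin d) ℝ) (w : Fin d → ℂ) : Fin d → ℂ :=
  fun j => ∑ k, (M j k : ℂ) * w k

/-- Squared `L²(ℤ^d × ℝ)` norm. -/
def sqNorm {d : ℕ} (v : (Fin d → ℤ) → ℝ → ℂ) : ℝ := ∑' y, ∫ s, ‖v y s‖ ^ 2

/-- `L²(ℤ^d × ℝ)` norm. -/
def l2Norm {d : ℕ} (v : (Fin d → ℤ) → ℝ → ℂ) : ℝ := Real.sqrt (sqNorm v)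

/-- Membership in `L²(ℤ^d × ℝ)`. -/
def MemL2 {d : ℕ} (v : (Fin d → ℤ) → ℝ → ℂ) : Prop :=
  (∀ y, Integrable fun s => ‖v y s‖ ^ 2) ∧ Summable fun y => ∫ s, ‖v y s‖ ^ 2

/-- `ℓ²(ℤ^d)`. -/
abbrev L2Z (d : ℕ) := lp (fun _ : Fin d → ℤ => ℂ) 2

/-- A pointwise sum of nonnegative integrable functions with summable integrals is integrable. -/
theorem integrable_of_hasSum_of_nonneg {ι : Type*} [Countable ι] {F : ι → ℝ → ℝ} {N : ℝ → ℝ}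
    (hF0 : ∀ i s, 0 ≤ F i s) (hF : ∀ i, Integrable (F i))
    (hsum : Summable fun i => ∫ s, F i s) (hN : ∀ s, HasSum (fun i => F i s) (N s)) :
    Integrable N := by
  have hN0 : ∀ s, 0 ≤ N s := fun s => (hN s).nonneg fun i => hF0 i s
  refine ⟨aestronglyMeasurable_of_tendsto_ae (u := (atTop : Filter (Finset ι)))
    (f := fun t s => ∑ i ∈ t, F i s)
    (fun t => (integrable_finsetSum t fun i _ => hF i).1) (ae_of_all _ hN), ?_⟩
  rw [hasFiniteIntegral_iff_ofReal (ae_of_all _ hN0)]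
  have h1 : ∀ s, ENNReal.ofReal (N s) = ∑' i, ENNReal.ofReal (F i s) := fun s => by
    rw [← (hN s).tsum_eq, ENNReal.ofReal_tsum_of_nonneg (fun i => hF0 i s) (hN s).summable]
  simp_rw [h1]
  rw [lintegral_tsum fun i => (hF i).1.aemeasurable.ennreal_ofReal]
  simp_rw [← fun i => ofReal_integral_eq_lintegral_ofReal (hF i) (ae_of_all _ (hF0 i))]
  rw [← ENNReal.ofReal_tsum_of_nonneg (fun i => integral_nonneg (hF0 i)) hsum]
  exact ENNReal.ofReal_lt_top

/-- The space-time norm as the time integral of the spatial norm. -/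
theorem MemL2.integrable_and_integral_eq {d : ℕ} {v : (Fin d → ℤ) → ℝ → ℂ} (hv : MemL2 v)
    {N : ℝ → ℝ} (hN : ∀ s, HasSum (fun y => ‖v y s‖ ^ 2) (N s)) :
    Integrable N ∧ ∫ s, N s = sqNorm v := by
  refine ⟨integrable_of_hasSum_of_nonneg (fun _ _ => by positivity) hv.1 hv.2 hN, ?_⟩
  have h := hasSum_integral_of_summable_integral_norm hv.1 (by simpa using hv.2)
  rw [sqNorm, h.tsum_eq]
  exact integral_congr_ae (ae_of_all _ fun s => (hN s).tsum_eq.symm)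

/-- Entries of a symmetric matrix with quadratic form between `0` and `Lam` are at most `Lam`. -/
theorem abs_entry_le {d : ℕ} {M : Matrix (Fin d) (Fin d) ℝ} {Lam : ℝ} (hs : M.IsSymm)
    (h0 : ∀ w : Fin d → ℝ, 0 ≤ w ⬝ᵥ M.mulVec w)
    (h1 : ∀ w : Fin d → ℝ, w ⬝ᵥ M.mulVec w ≤ Lam * ∑ j, w j ^ 2) (j k : Fin d) :
    |M j k| ≤ Lam := by
  have hq : ∀ i, 0 ≤ M i i ∧ M i i ≤ Lam := fun i => by
    have a0 := h0 (Pi.single i 1)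
    have a1 := h1 (Pi.single i 1)
    simp [Pi.single_apply] at a0 a1
    exact ⟨a0, a1⟩
  by_cases hjk : j = k
  · subst hjk
    rw [abs_of_nonneg (hq j).1]
    exact (hq j).2
  · have key : ∀ c : ℝ, c ^ 2 = 1 → M j j + M k k + 2 * c * M j k ≤ 2 * Lam := fun c hc => by
      have a1 := h1 (Pi.single j 1 + Pi.single k c)
      have e1 : ∑ i, (Pi.single j 1 + Pi.single k c : Fin d → ℝ) i ^ 2 = 2 := by
        have : ∀ i, (Pi.single j 1 + Pi.single k c : Fin d → ℝ) i ^ 2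
            = (Pi.single j 1 : Fin d → ℝ) i + (Pi.single k 1 : Fin d → ℝ) i := fun i => by
          by_cases hi : i = j
          · subst hi; simp [hjk]
          · by_cases hi' : i = k
            · subst hi'; simp [hi, hc]
            · simp [hi, hi']
        simp_rw [this, Finset.sum_add_distrib]
        simp
        norm_num
      rw [e1] at a1
      simp only [Matrix.mulVec_add, dotProduct_add, add_dotProduct, Matrix.mulVec_single,
        single_dotProduct, Pi.smul_apply, Matrix.col_apply, MulOpposite.smul_eq_mul_unop,
        MulOpposite.unop_op] at a1
      have := hs.apply j k
      rw [this] at a1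
      have e2 : c * (M k k * c) = M k k := by linear_combination M k k * hc
      linarith
    have k1 := key 1 (by norm_num)
    have k2 := key (-1) (by norm_num)
    rw [abs_le]
    constructor <;> linarith [(hq j).1, (hq k).1]

theorem re_sum_conj_mul_matMulC_nonneg {d : ℕ} {M : Matrix (Fin d) (Fin d) ℝ}
    (h0 : ∀ w : Fin d → ℝ, 0 ≤ w ⬝ᵥ M.mulVec w) (w : Fin d → ℂ) :
    0 ≤ (∑ j, (starRingEnd ℂ) (w j) * matMulC M w j).re := by
  have e1 : (∑ j, (starRingEnd ℂ) (w j) * matMulC M w j).re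
      = (fun j => (w j).re) ⬝ᵥ M.mulVec (fun j => (w j).re)
        + (fun j => (w j).im) ⬝ᵥ M.mulVec (fun j => (w j).im) := by
    simp only [dotProduct, Matrix.mulVec, matMulC, Complex.re_sum, ← Finset.sum_add_distrib]
    refine Finset.sum_congr rfl fun j _ => ?_
    simp [Complex.mul_re, Complex.re_sum, Complex.im_sum]
  rw [e1]
  exact add_nonneg (h0 _) (h0 _)

theorem _root_.Memℓp.comp_injective {α β : Type*} {f : α → ℂ} (hf : Memℓp f 2) {σ : β → α}
    (hσ : Function.Injective σ) : Memℓp (fun x => f (σ x)) 2 := by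
  have h2 : 0 < (2 : ℝ≥0∞).toReal := by norm_num
  rw [memℓp_gen_iff h2] at hf ⊢
  exact hf.comp_injective hσ

theorem _root_.Memℓp.bounded_mul {α : Type*} {f : α → ℂ} (hf : Memℓp f 2) {b : α → ℝ} {C : ℝ}
    (hb : ∀ x, |b x| ≤ C) : Memℓp (fun x => (b x : ℂ) * f x) 2 := by
  refine Memℓp.mono' (hf.const_mul (C : ℂ)) fun x => ?_
  rw [norm_mul, norm_mul, Complex.norm_real, Complex.norm_real]
  exact mul_le_mul_of_nonneg_right ((hb x).trans (le_abs_self C)) (norm_nonneg _)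

theorem _root_.Memℓp.summable_conj_mul {α : Type*} {f g : α → ℂ} (hf : Memℓp f 2) (hg : Memℓp g 2) :
    Summable fun x => (starRingEnd ℂ) (f x) * g x := by
  simpa [mul_comm] using lp.summable_inner (𝕜 := ℂ) (⟨f, hf⟩ : lp (fun _ : α => ℂ) 2) ⟨g, hg⟩

theorem _root_.Memℓp.summable_sq {α : Type*} {f : α → ℂ} (hf : Memℓp f 2) :
    Summable fun x => ‖f x‖ ^ 2 := by
  simpa using hf.summable (by norm_num)

theorem hasSum_norm_sq {d : ℕ} (u : L2Z d) : HasSum (fun y => ‖u y‖ ^ 2) (‖u‖ ^ 2) := by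
  simpa using lp.hasSum_norm (p := 2) (by norm_num) u

theorem memℓp_dDiv {d : ℕ} {F : (Fin d → ℤ) → Fin d → ℂ} (hF : ∀ j, Memℓp (fun x => F x j) 2) :
    Memℓp (dDiv F) 2 :=
  Memℓp.finsetSum Finset.univ fun j _ =>
    ((hF j).comp_injective (sub_left_injective (b := e d j))).sub (hF j)

/-- Summation by parts: `dDiv` is the adjoint of `dGrad`. -/
theorem exists_hasSum_dDiv_dGrad {d : ℕ} {u : (Fin d → ℤ) → ℂ} {F : (Fin d → ℤ) → Fin d → ℂ}
    (hu : Memℓp u 2) (hF : ∀ j, Memℓp (fun x => F x j) 2) :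
    ∃ S, HasSum (fun x => (starRingEnd ℂ) (u x) * dDiv F x) S ∧
      HasSum (fun x => ∑ j, (starRingEnd ℂ) (dGrad u x j) * F x j) S := by
  have hA : ∀ j, Summable fun x => (starRingEnd ℂ) (u (x + e d j)) * F x j := fun j =>
    (hu.comp_injective (add_left_injective (e d j))).summable_conj_mul (hF j)
  have hB : ∀ j, Summable fun x => (starRingEnd ℂ) (u x) * F x j := fun j =>
    hu.summable_conj_mul (hF j)
  have hA' : ∀ j, HasSum (fun x => (starRingEnd ℂ) (u x) * F (x - e d j) j)
      (∑' x, (starRingEnd ℂ) (u (x + e d j)) * F x j) := fun j => by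
    rw [← (Equiv.addRight (e d j)).hasSum_iff]
    simpa [Function.comp_def] using (hA j).hasSum
  refine ⟨∑ j, (∑' x, (starRingEnd ℂ) (u (x + e d j)) * F x j
    - ∑' x, (starRingEnd ℂ) (u x) * F x j), ?_, ?_⟩
  · simp only [dDiv, Finset.mul_sum, mul_sub]
    exact hasSum_sum fun j _ => (hA' j).sub (hB j).hasSum
  · simp only [dGrad, map_sub, sub_mul]
    exact hasSum_sum fun j _ => (hA j).hasSum.sub (hB j).hasSum

/-- The energy inequality at a fixed time, for `f = ½ ∇*(b∇u) + (m²/2) u - w`. -/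
theorem energy_inequality {d : ℕ} {m Lam : ℝ} (hm : 0 < m)
    {b : (Fin d → ℤ) → Matrix (Fin d) (Fin d) ℝ} (hs : ∀ y, (b y).IsSymm)
    (h0 : ∀ y (w : Fin d → ℝ), 0 ≤ w ⬝ᵥ (b y).mulVec w)
    (h1 : ∀ y (w : Fin d → ℝ), w ⬝ᵥ (b y).mulVec w ≤ Lam * ∑ j, w j ^ 2)
    (u w : L2Z d) (f : (Fin d → ℤ) → ℂ)
    (hf : ∀ y, w y - (m ^ 2 / 2 : ℝ) * u y
      = (1 / 2 : ℝ) * dDiv (fun x => matMulC (b x) (dGrad u x)) y - f y) :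
    Summable (fun y => ‖f y‖ ^ 2) ∧
      m ^ 2 / 4 * ‖u‖ ^ 2 - 1 / m ^ 2 * ∑' y, ‖f y‖ ^ 2 ≤ (inner ℂ u w).re := by
  have hu := lp.memℓp u
  have hw := lp.memℓp w
  have hF : ∀ j, Memℓp (fun x => matMulC (b x) (dGrad u x) j) 2 := fun j =>
    Memℓp.finsetSum Finset.univ fun k _ =>
      Memℓp.bounded_mul ((hu.comp_injective (add_left_injective (e d k))).sub hu)
        fun x => abs_entry_le (hs x) (h0 x) (h1 x) j k
  have hD := memℓp_dDiv hF
  have hfe : f = (fun y => ((1 / 2 : ℝ) : ℂ) * dDiv (fun x => matMulC (b x) (dGrad u x)) y)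
      + (fun y => ((m ^ 2 / 2 : ℝ) : ℂ) * u y) - w := by
    funext y
    simp only [Pi.sub_apply, Pi.add_apply]
    linear_combination hf y
  have hfm : Memℓp f 2 := by
    rw [hfe]
    exact ((hD.const_mul _).add (hu.const_mul _)).sub hw
  refine ⟨hfm.summable_sq, ?_⟩
  obtain ⟨S, hS1, hS2⟩ := exists_hasSum_dDiv_dGrad hu hF
  have hS0 : 0 ≤ S.re :=
    (Complex.hasSum_re hS2).nonneg fun x => re_sum_conj_mul_matMulC_nonneg (h0 x) _
  have hI : HasSum (fun y => ((starRingEnd ℂ) (u y) * w y).re) (inner ℂ u w).re := by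
    simpa [mul_comm] using Complex.hasSum_re (lp.hasSum_inner (𝕜 := ℂ) u w)
  have hL := (((hasSum_norm_sq u).mul_left (m ^ 2 / 4)).sub
    (hfm.summable_sq.hasSum.mul_left (1 / m ^ 2))).add ((Complex.hasSum_re hS1).mul_left (1 / 2))
  have := hasSum_le (fun y => ?_) hL hI
  · linarith
  · have hw' : w y = (m ^ 2 / 2 : ℝ) * u y
      + (1 / 2 : ℝ) * dDiv (fun x => matMulC (b x) (dGrad u x)) y - f y := by
      linear_combination hf y
    rw [hw']
    generalize dDiv (fun x => matMulC (b x) (dGrad u x)) y = D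
    simp only [← Complex.normSq_eq_norm_sq, Complex.normSq_apply, Complex.mul_re, Complex.mul_im,
      Complex.sub_re, Complex.add_re, Complex.sub_im, Complex.add_im, Complex.conj_re,
      Complex.conj_im, Complex.ofReal_re, Complex.ofReal_im]
    have p1 : ∀ p q : ℝ, p * q ≤ m ^ 2 / 4 * (p * p) + 1 / m ^ 2 * (q * q) := fun p q => by
      have e1 : m ^ 2 / 4 * (p * p) + 1 / m ^ 2 * (q * q) - p * q
          = (m / 2 * p - 1 / m * q) ^ 2 := by
        field_simp
        ring
      linarith [sq_nonneg (m / 2 * p - 1 / m * q)]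
    linarith [p1 (u y).re (f y).re, p1 (u y).im (f y).im]

/-- A differential inequality for a function vanishing at `±∞`, integrated over the line. -/
theorem integral_nonpos_of_le_deriv {h h' φ : ℝ → ℝ} (hd : ∀ s, HasDerivAt h (h' s) s)
    (hc : Continuous h') (hφ : Integrable φ) (hle : ∀ s, φ s ≤ h' s)
    (htop : Tendsto h atTop (nhds 0)) (hbot : Tendsto h atBot (nhds 0)) :
    ∫ s, φ s ≤ 0 := by
  have h1 := intervalIntegral_tendsto_integral hφ tendsto_neg_atTop_atBot tendsto_id
  have h2 : Tendsto (fun R : ℝ => h R - h (-R)) atTop (nhds 0) := by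
    simpa using htop.sub (hbot.comp tendsto_neg_atTop_atBot)
  refine le_of_tendsto_of_tendsto h1 h2 ?_
  filter_upwards [eventually_ge_atTop 0] with R hR
  rw [← intervalIntegral.integral_eq_sub_of_hasDerivAt (fun s _ => hd s)
    (hc.intervalIntegrable _ _)]
  exact intervalIntegral.integral_mono_on (by simp only [id]; linarith) hφ.intervalIntegrable
    (hc.intervalIntegrable _ _) fun s _ => hle s

theorem stmt0 (d : ℕ) (hd : 1 ≤ d) (lam Lam m : ℝ) (hlam : 0 < lam) (hll : lam ≤ Lam)
    (hm : 0 < m)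
    (a : (Fin d → ℤ) → ℝ → Matrix (Fin d) (Fin d) ℝ)
    (ha_meas : ∀ y j k, Measurable fun s => a y s j k)
    (ha_symm : ∀ y s, (a y s).IsSymm)
    (ha_lb : ∀ y s (w : Fin d → ℝ), lam * (∑ j, w j ^ 2) ≤ w ⬝ᵥ (a y s).mulVec w)
    (ha_ub : ∀ y s (w : Fin d → ℝ), w ⬝ᵥ (a y s).mulVec w ≤ Lam * (∑ j, w j ^ 2))
    (g v : (Fin d → ℤ) → ℝ → ℂ)
    (hg : MemL2 g) (hv : MemL2 v)
    -- the `ℓ²(ℤ^d)`-valued map `s ↦ v(·,s)` and its derivative `s ↦ ∂v/∂s(·,s)`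
    (V V' : ℝ → L2Z d)
    (hVv : ∀ s y, V s y = v y s)
    (hderiv : ∀ s, HasDerivAt V (V' s) s)
    (hV'cont : Continuous V')
    (hdecay_top : Tendsto (fun s => ‖V s‖) atTop (nhds 0))
    (hdecay_bot : Tendsto (fun s => ‖V s‖) atBot (nhds 0))
    -- the equation `∂v/∂s(y,s) − (m²/2) v(y,s) = (1/2) ∇*( a(·,s) ∇v(·,s) )(y) − g(y,s)`
    (hPDE : ∀ y s, V' s y - (m ^ 2 / 2 : ℝ) * v y s
      = (1 / 2 : ℝ) * dDiv (fun x => matMulC (a x s) (dGrad (fun z => v z s) x)) y - g y s) :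
    l2Norm v ≤ (2 / m ^ 2) * l2Norm g := by
  have hVfun : ∀ s, (fun z => v z s) = V s := fun s => funext fun y => (hVv s y).symm
  have henergy := fun s => energy_inequality hm (b := fun y => a y s) (fun y => ha_symm y s)
    (fun y w => le_trans (by positivity) (ha_lb y s w)) (fun y w => ha_ub y s w) (V s) (V' s)
    (fun y => g y s) (fun y => by rw [← hVfun]; exact hPDE y s)
  obtain ⟨hvi, hve⟩ := hv.integrable_and_integral_eq (N := fun s => ‖V s‖ ^ 2)
    fun s => by simpa only [hVv] using hasSum_norm_sq (V s)
  obtain ⟨hgi, hge⟩ := hg.integrable_and_integral_eq fun s => (henergy s).1.hasSum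
  have hderiv_sq : ∀ s, HasDerivAt (fun s => ‖V s‖ ^ 2) (2 * (inner ℂ (V s) (V' s)).re) s := by
    intro s
    have h1 := Complex.reCLM.hasFDerivAt.comp_hasDerivAt s ((hderiv s).inner ℂ (hderiv s))
    refine (h1.congr_of_eventuallyEq (.of_forall fun t =>
      (inner_self_eq_norm_sq (𝕜 := ℂ) (V t)).symm)).congr_deriv ?_
    · have := inner_re_symm (𝕜 := ℂ) (V' s) (V s)
      simp only [RCLike.re_to_complex] at this
      simp only [Complex.reCLM_apply, Complex.add_re, this]
      ring
  have hVcont : Continuous V := continuous_iff_continuousAt.2 fun s => (hderiv s).continuousAt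
  have hcont : Continuous fun s => 2 * (inner ℂ (V s) (V' s)).re :=
    continuous_const.mul (Complex.continuous_re.comp (hVcont.inner hV'cont))
  have key := integral_nonpos_of_le_deriv hderiv_sq hcont
    (((hvi.const_mul (m ^ 2 / 4)).sub (hgi.const_mul (1 / m ^ 2))).const_mul 2)
    (fun s => mul_le_mul_of_nonneg_left (henergy s).2 zero_le_two)
    (by simpa using hdecay_top.pow 2) (by simpa using hdecay_bot.pow 2)
  rw [integral_const_mul] at key
  simp only [Pi.sub_apply] at key
  rw [integral_sub (hvi.const_mul _) (hgi.const_mul _), integral_const_mul, integral_const_mul,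
    hve, hge] at key
  have hle : sqNorm v ≤ (2 / m ^ 2) ^ 2 * sqNorm g := by
    have e1 : sqNorm v - (2 / m ^ 2) ^ 2 * sqNorm g
        = 2 / m ^ 2 * (2 * (m ^ 2 / 4 * sqNorm v - 1 / m ^ 2 * sqNorm g)) := by
      field_simp
      ring
    have := mul_nonpos_of_nonneg_of_nonpos (show 0 ≤ 2 / m ^ 2 by positivity) key
    linarith
  calc l2Norm v ≤ Real.sqrt ((2 / m ^ 2) ^ 2 * sqNorm g) := Real.sqrt_le_sqrt hle
    _ = 2 / m ^ 2 * l2Norm g := by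
      rw [Real.sqrt_mul (by positivity), Real.sqrt_sq (by positivity), l2Norm]

end Stmt0
end
end

section
/- Let d ≥ 1, Λ > 0 and m > 0. Let g ∈ L²(ℤ^d × ℝ) and let v : ℤ^d × ℝ → ℂ be such that v ∈ L²(ℤ^d × ℝ), the ℓ²(ℤ^d)-valued map s ↦ v(·,s) is continuously differentiable with derivative s ↦ ∂v/∂s(·,s), ‖v(·,s)‖_{ℓ²(ℤ^d)} → 0 as s → ±∞, and v satisfies ∂v/∂s(y,s) − (m²/2) v(y,s) = (Λ/2) ∇*∇v(y,s) − g(y,s) for all y ∈ ℤ^d and s ∈ ℝ. Then (m²/4) ‖v‖₂² + (Λ/2) ‖∇v‖₂² ≤ m^{−2} ‖g‖₂², where ‖∇v‖₂² = Σ_{y∈ℤ^d} ∫_ℝ |∇v(y,s)|² ds. -/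
open MeasureTheory Real Filter
open scoped ENNReal BigOperators

noncomputable section

namespace Stmt1

/-- The `j`-th standard basis vector of `ℤ^d`. -/
def e (d : ℕ) (j : Fin d) : Fin d → ℤ := fun k => if k = j then 1 else 0

/-- Discrete gradient `∇u(x) j = u(x+e_j) - u(x)`. -/
def dGrad {d : ℕ} (u : (Fin d → ℤ) → ℂ) (x : Fin d → ℤ) : Fin d → ℂ :=
  fun j => u (x + e d j) - u x

/-- Discrete divergence `∇*F(x) = Σ_j [F_j(x-e_j) - F_j(x)]`. -/
def dDiv {d : ℕ} (F : (Fin d → ℤ) → Fin d → ℂ) (x : Fin d → ℤ) : ℂ :=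
  ∑ j, (F (x - e d j) j - F x j)

/-- Squared `L²(ℤ^d × ℝ)` norm `‖v‖₂²`. -/
def sqNorm {d : ℕ} (v : (Fin d → ℤ) → ℝ → ℂ) : ℝ := ∑' y, ∫ s, ‖v y s‖ ^ 2

/-- Squared `L²(ℤ^d × ℝ, ℂ^d)` norm of the discrete gradient,
`‖∇v‖₂² = Σ_{y∈ℤ^d} ∫_ℝ |∇v(y,s)|² ds`. -/
def gradSqNorm {d : ℕ} (v : (Fin d → ℤ) → ℝ → ℂ) : ℝ :=
  ∑' y, ∫ s, ∑ j, ‖dGrad (fun z => v z s) y j‖ ^ 2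

/-- Membership in `L²(ℤ^d × ℝ)`. -/
def MemL2 {d : ℕ} (v : (Fin d → ℤ) → ℝ → ℂ) : Prop :=
  (∀ y, Integrable fun s => ‖v y s‖ ^ 2) ∧ Summable fun y => ∫ s, ‖v y s‖ ^ 2

/-- `ℓ²(ℤ^d)`. -/
abbrev L2Z (d : ℕ) := lp (fun _ : Fin d → ℤ => ℂ) 2

/-- A series of nonnegative integrable functions whose integrals are summable is almost everywhere
summable, and its sum is integrable. -/
theorem ae_summable_and_integrable_tsum {ι α : Type*} [Countable ι] [MeasurableSpace α]
    {μ : Measure α} {F : ι → α → ℝ} (hF_nonneg : ∀ i a, 0 ≤ F i a)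
    (hF_int : ∀ i, Integrable (F i) μ) (hF_sum : Summable fun i => ∫ a, F i a ∂μ) :
    (∀ᵐ a ∂μ, Summable fun i => F i a) ∧ Integrable (fun a => ∑' i, F i a) μ := by
  have hmeas : ∀ i, AEMeasurable (fun a => ENNReal.ofReal (F i a)) μ :=
    fun i => (hF_int i).aemeasurable.ennreal_ofReal
  have hfin : ∫⁻ a, ∑' i, ENNReal.ofReal (F i a) ∂μ ≠ ∞ := by
    rw [lintegral_tsum hmeas]
    have h : ∀ i, ∫⁻ a, ENNReal.ofReal (F i a) ∂μ = ENNReal.ofReal (∫ a, F i a ∂μ) := fun i =>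
      (ofReal_integral_eq_lintegral_ofReal (hF_int i) (.of_forall (hF_nonneg i))).symm
    simp_rw [h]
    exact hF_sum.tsum_ofReal_ne_top
  have hreal : ∀ a, (∑' i, ENNReal.ofReal (F i a)).toReal = ∑' i, F i a := fun a => by
    rw [ENNReal.tsum_toReal_eq fun i => ENNReal.ofReal_ne_top]
    exact tsum_congr fun i => ENNReal.toReal_ofReal (hF_nonneg i a)
  constructor
  · filter_upwards [ae_lt_top' (AEMeasurable.tsum hmeas) hfin] with a ha
    refine (ENNReal.summable_toReal ha.ne).congr fun i => ?_
    exact ENNReal.toReal_ofReal (hF_nonneg i a)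
  · exact (integrable_toReal_of_lintegral_ne_top (AEMeasurable.tsum hmeas) hfin).congr
      (.of_forall hreal)

theorem norm_dGrad_sq_le {d : ℕ} (u : (Fin d → ℤ) → ℂ) (x : Fin d → ℤ) (j : Fin d) :
    ‖dGrad u x j‖ ^ 2 ≤ 2 * (‖u (x + e d j)‖ ^ 2 + ‖u x‖ ^ 2) := by
  have h : ‖dGrad u x j‖ ≤ ‖u (x + e d j)‖ + ‖u x‖ := norm_sub_le _ _
  nlinarith [norm_nonneg (dGrad u x j), sq_nonneg (‖u (x + e d j)‖ - ‖u x‖)]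

/-- Summation by parts: `⟨u, ∇*∇u⟩ = ‖∇u‖²` for `u ∈ ℓ²(ℤ^d)`. -/
theorem hasSum_re_inner_dDiv_dGrad {d : ℕ} {u : (Fin d → ℤ) → ℂ} (hu : Summable fun x => ‖u x‖ ^ 2) :
    HasSum (fun x => (inner ℂ (u x) (dDiv (dGrad u) x)).re) (∑' x, ∑ j, ‖dGrad u x j‖ ^ 2) := by
  have key : ∀ j : Fin d, ∃ D,
      HasSum (fun x => ‖dGrad u x j‖ ^ 2) D ∧
      HasSum (fun x => (inner ℂ (u x) (dGrad u (x - e d j) j - dGrad u x j)).re) D := by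
    intro j
    obtain ⟨A, hA⟩ := hu
    have hA' : HasSum (fun x => ‖u (x + e d j)‖ ^ 2) A :=
      (Equiv.addRight (e d j)).hasSum_iff (f := fun x => ‖u x‖ ^ 2) |>.2 hA
    have hB : Summable fun x => (inner ℂ (u x) (u (x + e d j))).re := by
      refine .of_norm_bounded (hA.summable.add hA'.summable) fun x => ?_
      have h₁ : ‖(inner ℂ (u x) (u (x + e d j))).re‖ ≤ ‖u x‖ * ‖u (x + e d j)‖ :=
        (Complex.abs_re_le_norm _).trans (norm_inner_le_norm _ _)
      nlinarith [sq_nonneg (‖u x‖ - ‖u (x + e d j)‖), sq_nonneg ‖u x‖, sq_nonneg ‖u (x + e d j)‖]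
    obtain ⟨B, hB⟩ := hB
    have hB' : HasSum (fun x => (inner ℂ (u (x - e d j)) (u x)).re) B := by
      have h := (Equiv.subRight (e d j)).hasSum_iff
        (f := fun x => (inner ℂ (u x) (u (x + e d j))).re) |>.2 hB
      simpa [Function.comp_def] using h
    refine ⟨A + A - 2 * B, ?_, ?_⟩
    · have h : (fun x => ‖dGrad u x j‖ ^ 2) = fun x => ‖u (x + e d j)‖ ^ 2 + ‖u x‖ ^ 2
          - 2 * (inner ℂ (u x) (u (x + e d j))).re := by
        ext x
        simp only [dGrad, ← Complex.normSq_eq_norm_sq, Complex.normSq_apply]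
        simp
        ring
      rw [h]
      exact (hA'.add hA).sub (hB.mul_left 2)
    · have h : (fun x => (inner ℂ (u x) (dGrad u (x - e d j) j - dGrad u x j)).re) =
          fun x => ‖u x‖ ^ 2 + ‖u x‖ ^ 2 - (inner ℂ (u (x - e d j)) (u x)).re
            - (inner ℂ (u x) (u (x + e d j))).re := by
        ext x
        simp only [dGrad, ← Complex.normSq_eq_norm_sq, Complex.normSq_apply, sub_add_cancel]
        simp
        ring
      rw [h, two_mul, ← sub_sub]
      exact ((hA.add hA).sub hB').sub hB
  choose D hD hD' using key
  have hsum : HasSum (fun x => ∑ j, ‖dGrad u x j‖ ^ 2) (∑ j, D j) := hasSum_sum fun j _ => hD j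
  rw [hsum.tsum_eq]
  convert hasSum_sum (s := Finset.univ) fun j _ => hD' j using 2 with x
  rw [dDiv, inner_sum, Complex.re_sum]

/-- The pointwise-in-time energy inequality, for one time slice `u` of the solution with time
derivative `w` and source `f`. -/
theorem energy_le {d : ℕ} {Lam m : ℝ} (hm : 0 < m) (u w : L2Z d) (f : (Fin d → ℤ) → ℂ)
    (hf : Summable fun x => ‖f x‖ ^ 2)
    (heq : ∀ x, w x - (m ^ 2 / 2 : ℝ) * u x = (Lam / 2 : ℝ) * dDiv (dGrad u) x - f x) :
    |2 * (inner ℂ u w).re - m ^ 2 * ∑' x, ‖u x‖ ^ 2 - Lam * ∑' x, ∑ j, ‖dGrad u x j‖ ^ 2| ≤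
      m ^ 2 / 2 * ∑' x, ‖u x‖ ^ 2 + 2 * (m ^ 2)⁻¹ * ∑' x, ‖f x‖ ^ 2 := by
  have hu : Summable fun x => ‖u x‖ ^ 2 := by
    simpa using (lp.memℓp u).summable (by simp)
  have hI : HasSum (fun x => (inner ℂ (u x) (w x)).re) (inner ℂ u w).re :=
    Complex.hasSum_re (lp.hasSum_inner u w)
  have hL := ((hI.mul_left 2).sub (hu.hasSum.mul_left (m ^ 2))).sub
    ((hasSum_re_inner_dDiv_dGrad hu).mul_left Lam)
  have hR := (hu.hasSum.mul_left (m ^ 2 / 2)).add (hf.hasSum.mul_left (2 * (m ^ 2)⁻¹))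
  have hpt : ∀ x, |2 * (inner ℂ (u x) (w x)).re - m ^ 2 * ‖u x‖ ^ 2
      - Lam * (inner ℂ (u x) (dDiv (dGrad u) x)).re| ≤
      m ^ 2 / 2 * ‖u x‖ ^ 2 + 2 * (m ^ 2)⁻¹ * ‖f x‖ ^ 2 := by
    intro x
    have hw : w x = (m ^ 2 / 2 : ℝ) * u x + (Lam / 2 : ℝ) * dDiv (dGrad u) x - f x := by
      linear_combination heq x
    have h₁ : 2 * (inner ℂ (u x) (w x)).re - m ^ 2 * ‖u x‖ ^ 2
        - Lam * (inner ℂ (u x) (dDiv (dGrad u) x)).re = -(2 * (inner ℂ (u x) (f x)).re) := by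
      rw [hw, ← Complex.normSq_eq_norm_sq, Complex.normSq_apply]
      simp [-Complex.ofReal_div, -Complex.ofReal_pow, Complex.mul_re, Complex.mul_im]
      ring
    rw [h₁, abs_neg, abs_mul, abs_two]
    have h₂ : |(inner ℂ (u x) (f x)).re| ≤ ‖u x‖ * ‖f x‖ :=
      (Complex.abs_re_le_norm _).trans (norm_inner_le_norm _ _)
    have h₃ : 2 * (‖u x‖ * ‖f x‖) ≤ m ^ 2 / 2 * ‖u x‖ ^ 2 + 2 * (m ^ 2)⁻¹ * ‖f x‖ ^ 2 := by
      have h : m ^ 2 / 2 * ‖u x‖ ^ 2 + 2 * (m ^ 2)⁻¹ * ‖f x‖ ^ 2 - 2 * (‖u x‖ * ‖f x‖)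
          = 1 / 2 * (m * ‖u x‖ - 2 * m⁻¹ * ‖f x‖) ^ 2 := by
        field_simp
        ring
      nlinarith [sq_nonneg (m * ‖u x‖ - 2 * m⁻¹ * ‖f x‖)]
    linarith
  rw [abs_le]
  refine ⟨?_, hasSum_le (fun x => (abs_le.1 (hpt x)).2) hL hR⟩
  exact hasSum_le (fun x => (abs_le.1 (hpt x)).1) hR.neg hL

theorem stmt1 (d : ℕ) (hd : 1 ≤ d) (Lam m : ℝ) (hLam : 0 < Lam) (hm : 0 < m)
    (g v : (Fin d → ℤ) → ℝ → ℂ)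
    (hg : MemL2 g) (hv : MemL2 v)
    -- the `ℓ²(ℤ^d)`-valued map `s ↦ v(·,s)` and its derivative `s ↦ ∂v/∂s(·,s)`
    (V V' : ℝ → L2Z d)
    (hVv : ∀ s y, V s y = v y s)
    (hderiv : ∀ s, HasDerivAt V (V' s) s)
    (hV'cont : Continuous V')
    (hdecay_top : Tendsto (fun s => ‖V s‖) atTop (nhds 0))
    (hdecay_bot : Tendsto (fun s => ‖V s‖) atBot (nhds 0))
    -- the equation `∂v/∂s(y,s) − (m²/2) v(y,s) = (Λ/2) ∇*∇v(y,s) − g(y,s)`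
    (hPDE : ∀ y s, V' s y - (m ^ 2 / 2 : ℝ) * v y s
      = (Lam / 2 : ℝ) * dDiv (fun x => dGrad (fun z => v z s) x) y - g y s) :
    (m ^ 2 / 4) * sqNorm v + (Lam / 2) * gradSqNorm v ≤ (m ^ 2)⁻¹ * sqNorm g := by
  have hcont : ∀ y, Continuous (v y) := fun y => by
    have h : Continuous fun s => V s y :=
      (lp.evalCLM ℂ (fun _ : Fin d → ℤ => ℂ) 2 y).continuous.comp
        (continuous_iff_continuousAt.2 fun s => (hderiv s).continuousAt)
    simpa only [hVv] using h
  have hgrad_int : ∀ y, Integrable fun s => ∑ j, ‖dGrad (fun z => v z s) y j‖ ^ 2 := fun y => by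
    refine integrable_finsetSum _ fun j _ => ?_
    refine (((hv.1 (y + e d j)).add (hv.1 y)).const_mul 2).mono' ?_ (.of_forall fun s => ?_)
    · exact (((hcont _).sub (hcont _)).norm.pow 2).aestronglyMeasurable
    · simpa using norm_dGrad_sq_le (fun z => v z s) y j
  have hgrad_sum : Summable fun y => ∫ s, ∑ j, ‖dGrad (fun z => v z s) y j‖ ^ 2 := by
    have hbound : Summable fun y => ∑ j, 2 * ((∫ s, ‖v (y + e d j) s‖ ^ 2) + ∫ s, ‖v y s‖ ^ 2) :=
      summable_sum fun j _ =>
        (((Equiv.addRight (e d j)).summable_iff.2 hv.2).add hv.2).mul_left 2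
    refine .of_nonneg_of_le (fun y => by positivity) (fun y => ?_) hbound
    simp_rw [← integral_add (hv.1 _) (hv.1 y), ← integral_const_mul]
    have hint : ∀ j, Integrable fun s => 2 * (‖v (y + e d j) s‖ ^ 2 + ‖v y s‖ ^ 2) :=
      fun j => ((hv.1 _).add (hv.1 y)).const_mul 2
    rw [← integral_finsetSum _ fun j _ => hint j]
    exact integral_mono (hgrad_int y) (integrable_finsetSum _ fun j _ => hint j)
      fun s => Finset.sum_le_sum fun j _ => norm_dGrad_sq_le (fun z => v z s) y j
  have interchange : ∀ F : (Fin d → ℤ) → ℝ → ℝ, (∀ y s, 0 ≤ F y s) → (∀ y, Integrable (F y)) →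
      (Summable fun y => ∫ s, F y s) → ∑' y, ∫ s, F y s = ∫ s, ∑' y, F y s := by
    intro F h0 h1 h2
    refine integral_tsum_of_summable_integral_norm h1 ?_
    simpa only [Real.norm_of_nonneg (h0 _ _)] using h2
  have hN := ae_summable_and_integrable_tsum (fun y s => by positivity) hv.1 hv.2
  have hG := ae_summable_and_integrable_tsum (fun y s => by positivity) hg.1 hg.2
  have hD := ae_summable_and_integrable_tsum (fun y s => by positivity) hgrad_int hgrad_sum
  have henergy : ∀ᵐ s, |2 * (inner ℂ (V s) (V' s)).re - m ^ 2 * (∑' y, ‖v y s‖ ^ 2)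
      - Lam * ∑' y, ∑ j, ‖dGrad (fun z => v z s) y j‖ ^ 2| ≤
      m ^ 2 / 2 * (∑' y, ‖v y s‖ ^ 2) + 2 * (m ^ 2)⁻¹ * ∑' y, ‖g y s‖ ^ 2 := by
    filter_upwards [hG.1] with s hs
    have hVs : (V s : (Fin d → ℤ) → ℂ) = fun z => v z s := funext (hVv s)
    have h := energy_le (Lam := Lam) hm (V s) (V' s) (fun y => g y s) hs fun y => by
      rw [hVs]; exact hPDE y s
    rwa [hVs] at h
  have hVcont : Continuous V := continuous_iff_continuousAt.2 fun s => (hderiv s).continuousAt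
  have hderivN : ∀ s, HasDerivAt (fun s => ‖V s‖ ^ 2) (2 * (inner ℂ (V s) (V' s)).re) s := by
    intro s
    have h := Complex.reCLM.hasFDerivAt.comp_hasDerivAt s ((hderiv s).inner ℂ (hderiv s))
    have hfun : (fun t => ‖V t‖ ^ 2) = Complex.reCLM ∘ fun t => inner ℂ (V t) (V t) :=
      funext fun t => norm_sq_eq_re_inner (𝕜 := ℂ) (V t)
    rw [hfun]
    refine h.congr_deriv ?_
    have hsymm : (inner ℂ (V s) (V' s)).re = (inner ℂ (V' s) (V s)).re :=
      inner_re_symm (𝕜 := ℂ) (V s) (V' s)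
    rw [Complex.reCLM_apply, Complex.add_re, ← hsymm, two_mul]
  have hN'int : Integrable fun s => 2 * (inner ℂ (V s) (V' s)).re := by
    have hbound := (((hN.2.const_mul (m ^ 2)).add (hD.2.const_mul Lam)).add
      ((hN.2.const_mul (m ^ 2 / 2)).add (hG.2.const_mul (2 * (m ^ 2)⁻¹))))
    refine hbound.mono' ?_ ?_
    · exact (continuous_const.mul
        (Complex.continuous_re.comp (hVcont.inner hV'cont))).aestronglyMeasurable
    · filter_upwards [henergy] with s hs
      have h₁ : 0 ≤ m ^ 2 * ∑' y, ‖v y s‖ ^ 2 := by positivity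
      have h₂ : 0 ≤ Lam * ∑' y, ∑ j, ‖dGrad (fun z => v z s) y j‖ ^ 2 := by positivity
      rw [abs_le] at hs
      simp only [Pi.add_apply, Real.norm_eq_abs]
      rw [abs_le]
      constructor <;> linarith [hs.1, hs.2]
  have hzero : ∫ s, 2 * (inner ℂ (V s) (V' s)).re = 0 := by
    simpa using integral_of_hasDerivAt_of_tendsto hderivN hN'int
      (hdecay_bot.pow 2) (hdecay_top.pow 2)
  have hmono : ∫ s, (m ^ 2 / 2 * (∑' y, ‖v y s‖ ^ 2)
      + Lam * ∑' y, ∑ j, ‖dGrad (fun z => v z s) y j‖ ^ 2) ≤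
      ∫ s, (2 * (inner ℂ (V s) (V' s)).re + 2 * (m ^ 2)⁻¹ * ∑' y, ‖g y s‖ ^ 2) := by
    refine integral_mono_ae ((hN.2.const_mul _).add (hD.2.const_mul _))
      (hN'int.add (hG.2.const_mul _)) ?_
    filter_upwards [henergy] with s hs
    linarith [(abs_le.1 hs).1]
  rw [integral_add (hN.2.const_mul _) (hD.2.const_mul _),
    integral_add hN'int (hG.2.const_mul _), hzero] at hmono
  simp only [integral_const_mul] at hmono
  rw [← interchange _ (fun y s => by positivity) hv.1 hv.2,
    ← interchange _ (fun y s => by positivity) hgrad_int hgrad_sum,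
    ← interchange _ (fun y s => by positivity) hg.1 hg.2] at hmono
  unfold sqNorm gradSqNorm
  linarith

end Stmt1
end
end

section
/- Let d ≥ 1, 0 < λ ≤ Λ and m > 0. Let b : ℤ^d × ℝ → ℝ^{d×d} be measurable with each b(y,s) a symmetric matrix satisfying 0 ≤ b(y,s) ≤ (1 − λ/Λ) I_d as quadratic forms. Let w, v : ℤ^d × ℝ → ℂ be in L²(ℤ^d × ℝ) with ∇w ∈ L²(ℤ^d × ℝ, ℂ^d), suppose the ℓ²(ℤ^d)-valued map s ↦ v(·,s) is continuously differentiable with derivative s ↦ ∂v/∂s(·,s), ‖v(·,s)‖_{ℓ²(ℤ^d)} → 0 as s → ±∞, and v satisfies ∂v/∂s(y,s) − (m²/2) v(y,s) = (Λ/2) [ ∇*∇v(y,s) − ∇*( b(·,s) ∇w(·,s) )(y) ] for all y ∈ ℤ^d and s ∈ ℝ. Then (m²/2) ‖v‖₂² + (Λ/4) ‖∇v‖₂² ≤ (Λ/4) (1 − λ/Λ)² ‖∇w‖₂². -/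
open MeasureTheory Real Filter Matrix
open scoped ENNReal BigOperators

noncomputable section

namespace Stmt2

/-- The `j`-th standard basis vector of `ℤ^d`. -/
def e (d : ℕ) (j : Fin d) : Fin d → ℤ := fun k => if k = j then 1 else 0

/-- Discrete gradient `∇u(x) j = u(x+e_j) - u(x)`. -/
def dGrad {d : ℕ} (u : (Fin d → ℤ) → ℂ) (x : Fin d → ℤ) : Fin d → ℂ :=
  fun j => u (x + e d j) - u x

/-- Discrete divergence `∇*F(x) = Σ_j [F_j(x-e_j) - F_j(x)]`. -/
def dDiv {d : ℕ} (F : (Fin d → ℤ) → Fin d → ℂ) (x : Fin d → ℤ) : ℂ :=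
  ∑ j, (F (x - e d j) j - F x j)

/-- A real matrix acting on a complex vector. -/
def matMulC {d : ℕ} (M : Matrix (Fin d) (Fin d) ℝ) (w : Fin d → ℂ) : Fin d → ℂ :=
  fun j => ∑ k, (M j k : ℂ) * w k

/-- Squared `L²(ℤ^d × ℝ)` norm `‖v‖₂²`. -/
def sqNorm {d : ℕ} (v : (Fin d → ℤ) → ℝ → ℂ) : ℝ := ∑' y, ∫ s, ‖v y s‖ ^ 2

/-- Squared `L²(ℤ^d × ℝ, ℂ^d)` norm of the discrete gradient. -/
def gradSqNorm {d : ℕ} (v : (Fin d → ℤ) → ℝ → ℂ) : ℝ :=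
  ∑' y, ∫ s, ∑ j, ‖dGrad (fun z => v z s) y j‖ ^ 2

/-- Membership in `L²(ℤ^d × ℝ)`. -/
def MemL2 {d : ℕ} (v : (Fin d → ℤ) → ℝ → ℂ) : Prop :=
  (∀ y, Integrable fun s => ‖v y s‖ ^ 2) ∧ Summable fun y => ∫ s, ‖v y s‖ ^ 2

/-- Membership of the discrete gradient in `L²(ℤ^d × ℝ, ℂ^d)`. -/
def GradMemL2 {d : ℕ} (v : (Fin d → ℤ) → ℝ → ℂ) : Prop :=
  (∀ y, Integrable fun s => ∑ j, ‖dGrad (fun z => v z s) y j‖ ^ 2) ∧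
    Summable fun y => ∫ s, ∑ j, ‖dGrad (fun z => v z s) y j‖ ^ 2

/-- `ℓ²(ℤ^d)`. -/
abbrev L2Z (d : ℕ) := lp (fun _ : Fin d → ℤ => ℂ) 2

theorem dDiv_sub {d : ℕ} (F G : (Fin d → ℤ) → Fin d → ℂ) (x : Fin d → ℤ) :
    dDiv F x - dDiv G x = dDiv (F - G) x := by
  simp only [dDiv, ← Finset.sum_sub_distrib, Pi.sub_apply]
  exact Finset.sum_congr rfl fun j _ => by ring

theorem summable_inner_of_summable_norm_sq {ι E : Type*} [NormedAddCommGroup E]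
    [InnerProductSpace ℝ E] {f g : ι → E} (hf : Summable fun i => ‖f i‖ ^ 2)
    (hg : Summable fun i => ‖g i‖ ^ 2) : Summable fun i => inner ℝ (f i) (g i) := by
  refine (hf.add hg).of_norm_bounded fun i => ?_
  have h := norm_inner_le_norm (𝕜 := ℝ) (f i) (g i)
  nlinarith [sq_nonneg (‖f i‖ - ‖g i‖), sq_nonneg (‖f i‖), sq_nonneg (‖g i‖)]

/-- Summation by parts: `∇*` is the adjoint of `∇` on square-summable functions. -/
theorem hasSum_inner_dDiv {d : ℕ} {u : (Fin d → ℤ) → ℂ} {F : (Fin d → ℤ) → Fin d → ℂ}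
    (hu : Summable fun y => ‖u y‖ ^ 2) (hF : ∀ j, Summable fun y => ‖F y j‖ ^ 2) :
    HasSum (fun y => inner ℝ (u y) (dDiv F y)) (∑' y, ∑ j, inner ℝ (dGrad u y j) (F y j)) := by
  have hadd : ∀ j, Summable fun y => inner ℝ (u (y + e d j)) (F y j) := fun j =>
    summable_inner_of_summable_norm_sq (f := fun y => u (y + e d j))
      ((Equiv.addRight (e d j)).summable_iff (f := fun y => ‖u y‖ ^ 2) |>.2 hu) (hF j)
  have hmul : ∀ j, Summable fun y => inner ℝ (u y) (F y j) := fun j =>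
    summable_inner_of_summable_norm_sq hu (hF j)
  have hright : HasSum (fun y => ∑ j, inner ℝ (dGrad u y j) (F y j))
      (∑ j, ((∑' y, inner ℝ (u (y + e d j)) (F y j)) - ∑' y, inner ℝ (u y) (F y j))) := by
    simp only [dGrad, inner_sub_left]
    exact hasSum_sum fun j _ => (hadd j).hasSum.sub (hmul j).hasSum
  rw [hright.tsum_eq]
  simp only [dDiv, inner_sum, inner_sub_right]
  refine hasSum_sum fun j _ => HasSum.sub ?_ (hmul j).hasSum
  rw [← (Equiv.addRight (e d j)).hasSum_iff]
  simpa [Function.comp_def] using (hadd j).hasSum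

theorem sum_mulVec_sq_le {n : Type*} [Fintype n] {B : Matrix n n ℝ} {κ : ℝ}
    (hsymm : B.IsSymm) (hlb : ∀ w : n → ℝ, 0 ≤ w ⬝ᵥ B.mulVec w)
    (hub : ∀ w : n → ℝ, w ⬝ᵥ B.mulVec w ≤ κ * ∑ j, w j ^ 2) (hκ : 0 ≤ κ) (h : n → ℝ) :
    ∑ j, B.mulVec h j ^ 2 ≤ κ ^ 2 * ∑ j, h j ^ 2 := by
  have hsq : B.mulVec h ⬝ᵥ B.mulVec h = ∑ j, B.mulVec h j ^ 2 := by
    simp [dotProduct, sq]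
  have hcross : h ⬝ᵥ B.mulVec (B.mulVec h) = ∑ j, B.mulVec h j ^ 2 := by
    rw [← hsq, dotProduct_mulVec, ← mulVec_transpose, hsymm.eq]
  have hexp : ∀ t : ℝ, 0 ≤ t ^ 2 * (h ⬝ᵥ B.mulVec h) - 2 * t * ∑ j, B.mulVec h j ^ 2
      + B.mulVec h ⬝ᵥ B.mulVec (B.mulVec h) := fun t => by
    have := hlb (t • h - B.mulVec h)
    simp only [mulVec_sub, mulVec_smul, dotProduct_sub, sub_dotProduct, dotProduct_smul,
      smul_dotProduct, smul_eq_mul, hcross, hsq] at this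
    linarith
  have h1 := hub h
  have h2 := hub (B.mulVec h)
  have h3 : 0 ≤ ∑ j, B.mulVec h j ^ 2 := Finset.sum_nonneg fun j _ => sq_nonneg _
  rcases hκ.eq_or_lt with rfl | hpos
  · have := hexp 1
    have := hlb h
    nlinarith
  · have h4 := hexp κ
    have h5 : κ * ∑ j, B.mulVec h j ^ 2 ≤ κ * (κ * (h ⬝ᵥ B.mulVec h)) := by nlinarith
    have h6 := le_of_mul_le_mul_left h5 hpos
    nlinarith

theorem sum_norm_sq_matMulC_le {d : ℕ} {B : Matrix (Fin d) (Fin d) ℝ} {κ : ℝ}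
    (hsymm : B.IsSymm) (hlb : ∀ w : Fin d → ℝ, 0 ≤ w ⬝ᵥ B.mulVec w)
    (hub : ∀ w : Fin d → ℝ, w ⬝ᵥ B.mulVec w ≤ κ * ∑ j, w j ^ 2) (hκ : 0 ≤ κ)
    (h : Fin d → ℂ) :
    ∑ j, ‖matMulC B h j‖ ^ 2 ≤ κ ^ 2 * ∑ j, ‖h j‖ ^ 2 := by
  have hre : ∀ j, (matMulC B h j).re = B.mulVec (fun k => (h k).re) j := fun j => by
    simp [matMulC, mulVec, dotProduct]
  have him : ∀ j, (matMulC B h j).im = B.mulVec (fun k => (h k).im) j := fun j => by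
    simp [matMulC, mulVec, dotProduct]
  have hn : ∀ z : ℂ, ‖z‖ ^ 2 = z.re ^ 2 + z.im ^ 2 := fun z => by
    rw [Complex.sq_norm, Complex.normSq_apply]; ring
  simp only [hn, hre, him, Finset.sum_add_distrib, mul_add]
  exact add_le_add (sum_mulVec_sq_le hsymm hlb hub hκ _) (sum_mulVec_sq_le hsymm hlb hub hκ _)

/-- Young's inequality in the form used for the energy estimate. -/
theorem half_norm_sq_sub_le_inner {E : Type*} [NormedAddCommGroup E] [InnerProductSpace ℝ E]
    (x y : E) : ‖x‖ ^ 2 / 2 - ‖y‖ ^ 2 / 2 ≤ inner ℝ x (x - y) := by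
  have h := norm_sub_sq_real x y
  rw [inner_sub_right, real_inner_self_eq_norm_sq]
  nlinarith [sq_nonneg ‖x - y‖]

/-- A series of nonnegative functions with summable integrals converges almost everywhere to an
integrable function and can be integrated term by term. -/
theorem ae_summable_and_integrable_tsum_and_tsum_integral {α ι : Type*} [MeasurableSpace α] {μ : Measure α}
    [Countable ι] {F : ι → α → ℝ} (hnn : ∀ i a, 0 ≤ F i a) (hF : ∀ i, Integrable (F i) μ)
    (hsum : Summable fun i => ∫ a, F i a ∂μ) :
    (∀ᵐ a ∂μ, Summable fun i => F i a) ∧ Integrable (fun a => ∑' i, F i a) μ ∧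
      ∑' i, ∫ a, F i a ∂μ = ∫ a, ∑' i, F i a ∂μ := by
  have hmeas : ∀ i, AEMeasurable (fun a => ENNReal.ofReal (F i a)) μ := fun i =>
    (hF i).1.aemeasurable.ennreal_ofReal
  have hfin : ∫⁻ a, ∑' i, ENNReal.ofReal (F i a) ∂μ ≠ ∞ := by
    rw [lintegral_tsum hmeas]
    simp_rw [← ofReal_integral_eq_lintegral_ofReal (hF _) (.of_forall (hnn _))]
    exact hsum.tsum_ofReal_ne_top
  have htm : AEMeasurable (fun a => ∑' i, ENNReal.ofReal (F i a)) μ := AEMeasurable.tsum hmeas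
  refine ⟨?_, ?_, integral_tsum_of_summable_integral_norm hF
    (by simpa only [Real.norm_of_nonneg (hnn _ _)] using hsum)⟩
  · filter_upwards [ae_lt_top' htm hfin] with a ha
    simpa [ENNReal.toReal_ofReal (hnn _ a)] using ENNReal.summable_toReal ha.ne
  · refine (integrable_toReal_of_lintegral_ne_top htm hfin).congr (.of_forall fun a => ?_)
    simp [ENNReal.tsum_toReal_eq, ENNReal.toReal_ofReal (hnn _ a)]

theorem norm_dGrad_sq_le {d : ℕ} (u : (Fin d → ℤ) → ℂ) (y : Fin d → ℤ) (j : Fin d) :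
    ‖dGrad u y j‖ ^ 2 ≤ 2 * (‖u (y + e d j)‖ ^ 2 + ‖u y‖ ^ 2) := by
  have h := norm_sub_le (u (y + e d j)) (u y)
  have h0 := norm_nonneg (u (y + e d j) - u y)
  simp only [dGrad]
  nlinarith [sq_nonneg (‖u (y + e d j)‖ - ‖u y‖)]

theorem summable_norm_dGrad_sq {d : ℕ} {u : (Fin d → ℤ) → ℂ}
    (hu : Summable fun y => ‖u y‖ ^ 2) (j : Fin d) :
    Summable fun y => ‖dGrad u y j‖ ^ 2 :=
  .of_nonneg_of_le (fun _ => by positivity) (fun y => norm_dGrad_sq_le u y j)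
    ((((Equiv.addRight (e d j)).summable_iff (f := fun y => ‖u y‖ ^ 2) |>.2 hu).add hu).mul_left 2)

theorem hasSum_norm_sq_l2 {d : ℕ} (u : L2Z d) : HasSum (fun y => ‖u y‖ ^ 2) (‖u‖ ^ 2) := by
  simpa using lp.hasSum_norm (p := 2) (by norm_num) u

/-- The energy inequality on a single time slice. -/
theorem slice_energy_le {d : ℕ} {c Lam κ : ℝ} (hLam : 0 ≤ Lam) (hκ : 0 ≤ κ)
    {B : (Fin d → ℤ) → Matrix (Fin d) (Fin d) ℝ} (hsymm : ∀ y, (B y).IsSymm)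
    (hlb : ∀ y (z : Fin d → ℝ), 0 ≤ z ⬝ᵥ (B y).mulVec z)
    (hub : ∀ y (z : Fin d → ℝ), z ⬝ᵥ (B y).mulVec z ≤ κ * ∑ j, z j ^ 2)
    {h : (Fin d → ℤ) → Fin d → ℂ} (hh : Summable fun y => ∑ j, ‖h y j‖ ^ 2) (u u' : L2Z d)
    (hu : ∀ y, u' y - (c : ℂ) * u y
      = (Lam / 2 : ℝ) * (dDiv (dGrad u) y - dDiv (fun x => matMulC (B x) (h x)) y)) :
    c * ‖u‖ ^ 2 + Lam / 4 * ∑' y, ∑ j, ‖dGrad u y j‖ ^ 2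
      - Lam / 4 * κ ^ 2 * ∑' y, ∑ j, ‖h y j‖ ^ 2 ≤ inner ℝ u u' := by
  have hus := (hasSum_norm_sq_l2 u).summable
  have hgs := summable_norm_dGrad_sq hus
  have hgs' : Summable fun y => ∑ j, ‖dGrad u y j‖ ^ 2 := summable_sum fun j _ => hgs j
  have hB : ∀ y, ∑ j, ‖matMulC (B y) (h y) j‖ ^ 2 ≤ κ ^ 2 * ∑ j, ‖h y j‖ ^ 2 := fun y =>
    sum_norm_sq_matMulC_le (hsymm y) (hlb y) (hub y) hκ (h y)
  set G : (Fin d → ℤ) → Fin d → ℂ := fun x => matMulC (B x) (h x)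
  have hG : ∀ j, Summable fun y => ‖G y j‖ ^ 2 := fun j =>
    .of_nonneg_of_le (fun _ => by positivity)
      (fun y => (Finset.single_le_sum (f := fun j => ‖G y j‖ ^ 2)
        (fun _ _ => by positivity) (Finset.mem_univ j)).trans (hB y)) (hh.mul_left _)
  have hF : ∀ j, Summable fun y => ‖(dGrad u - G) y j‖ ^ 2 := fun j => by
    refine .of_nonneg_of_le (fun _ => by positivity) (fun y => ?_) (((hgs j).add (hG j)).mul_left 2)
    have h1 := norm_sub_le (dGrad u y j) (G y j)
    have h0 := norm_nonneg (dGrad u y j - G y j)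
    simp only [Pi.sub_apply]
    nlinarith [sq_nonneg (‖dGrad u y j‖ - ‖G y j‖)]
  have hinner : inner ℝ u u' = c * ‖u‖ ^ 2
      + Lam / 2 * ∑' y, ∑ j, inner ℝ (dGrad u y j) ((dGrad u - G) y j) := by
    refine (lp.hasSum_inner (𝕜 := ℝ) u u').unique ?_
    have hy : ∀ y, inner ℝ (u y) (u' y)
        = c * ‖u y‖ ^ 2 + Lam / 2 * inner ℝ (u y) (dDiv (dGrad u - G) y) := fun y => by
      have hu' : u' y = c • u y + (Lam / 2) • dDiv (dGrad u - G) y := by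
        rw [← dDiv_sub, Complex.real_smul, Complex.real_smul, ← hu y]; ring
      rw [hu', inner_add_right, real_inner_smul_right, real_inner_smul_right,
        real_inner_self_eq_norm_sq]
    simp only [hy]
    exact ((hasSum_norm_sq_l2 u).mul_left c).add ((hasSum_inner_dDiv hus hF).mul_left (Lam / 2))
  have hlow : (∑' y, ∑ j, ‖dGrad u y j‖ ^ 2) / 2 - κ ^ 2 / 2 * ∑' y, ∑ j, ‖h y j‖ ^ 2
      ≤ ∑' y, ∑ j, inner ℝ (dGrad u y j) ((dGrad u - G) y j) := by
    rw [← tsum_div_const, ← tsum_mul_left, ← (hgs'.div_const 2).tsum_sub (hh.mul_left _)]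
    refine ((hgs'.div_const 2).sub (hh.mul_left _)).tsum_le_tsum (fun y => ?_)
      (summable_sum fun j _ => summable_inner_of_summable_norm_sq (hgs j) (hF j))
    have := Finset.sum_le_sum fun j (_ : j ∈ Finset.univ) =>
      half_norm_sq_sub_le_inner (dGrad u y j) (G y j)
    rw [Finset.sum_sub_distrib, ← Finset.sum_div, ← Finset.sum_div] at this
    simp only [Pi.sub_apply]
    linarith [hB y]
  rw [hinner]
  nlinarith [mul_le_mul_of_nonneg_left hlow (by linarith : 0 ≤ Lam / 2)]

/-- An integrable lower bound for the derivative of a function vanishing at `±∞` has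
nonpositive integral. -/
theorem integral_nonpos_of_le_deriv {E E' R : ℝ → ℝ} (hE : ∀ s, HasDerivAt E (E' s) s)
    (hE' : Continuous E') (htop : Tendsto E atTop (nhds 0)) (hbot : Tendsto E atBot (nhds 0))
    (hR : Integrable R) (hle : ∀ᵐ s, R s ≤ E' s) : ∫ s, R s ≤ 0 := by
  have hlim := intervalIntegral_tendsto_integral hR tendsto_neg_atTop_atBot tendsto_id
  have hlim' : Tendsto (fun t => E t - E (-t)) atTop (nhds 0) := by
    simpa using htop.sub (hbot.comp tendsto_neg_atTop_atBot)
  refine le_of_tendsto_of_tendsto hlim hlim' ?_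
  filter_upwards [eventually_ge_atTop 0] with t ht
  rw [← intervalIntegral.integral_eq_sub_of_hasDerivAt (fun s _ => hE s)
    (hE'.intervalIntegrable _ _)]
  exact intervalIntegral.integral_mono_ae (by simp only [id]; linarith) hR.intervalIntegrable
    (hE'.intervalIntegrable _ _) hle

theorem gradMemL2_of_memL2 {d : ℕ} {v : (Fin d → ℤ) → ℝ → ℂ} (hv : MemL2 v)
    (hcont : ∀ y, Continuous (v y)) : GradMemL2 v := by
  have hg : ∀ y j, Integrable fun s => ‖dGrad (fun z => v z s) y j‖ ^ 2 := fun y j => by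
    refine (((hv.1 (y + e d j)).add (hv.1 y)).const_mul 2).mono'
      (((hcont _).sub (hcont _)).norm.pow 2).aestronglyMeasurable (.of_forall fun s => ?_)
    rw [Real.norm_of_nonneg (by positivity)]
    exact norm_dGrad_sq_le (fun z => v z s) y j
  refine ⟨fun y => integrable_finsetSum _ fun j _ => hg y j, ?_⟩
  simp_rw [integral_finsetSum _ fun j _ => hg _ j]
  refine summable_sum fun j _ => ?_
  refine .of_nonneg_of_le (fun _ => integral_nonneg fun _ => by positivity) (fun y => ?_)
    ((((Equiv.addRight (e d j)).summable_iff (f := fun y => ∫ s, ‖v y s‖ ^ 2) |>.2 hv.2).add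
      hv.2).mul_left 2)
  simp only [Function.comp, Equiv.coe_addRight]
  rw [← integral_add (hv.1 _) (hv.1 _), ← integral_const_mul]
  exact integral_mono (hg y j) (((hv.1 _).add (hv.1 _)).const_mul 2) fun s =>
    norm_dGrad_sq_le (fun z => v z s) y j

theorem stmt2 (d : ℕ) (hd : 1 ≤ d) (lam Lam m : ℝ) (hlam : 0 < lam) (hll : lam ≤ Lam)
    (hm : 0 < m)
    (b : (Fin d → ℤ) → ℝ → Matrix (Fin d) (Fin d) ℝ)
    (hb_meas : ∀ y j k, Measurable fun s => b y s j k)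
    (hb_symm : ∀ y s, (b y s).IsSymm)
    (hb_lb : ∀ y s (w : Fin d → ℝ), 0 ≤ w ⬝ᵥ (b y s).mulVec w)
    (hb_ub : ∀ y s (w : Fin d → ℝ), w ⬝ᵥ (b y s).mulVec w ≤ (1 - lam / Lam) * (∑ j, w j ^ 2))
    (w v : (Fin d → ℤ) → ℝ → ℂ)
    (hw : MemL2 w) (hv : MemL2 v) (hgradw : GradMemL2 w)
    -- the `ℓ²(ℤ^d)`-valued map `s ↦ v(·,s)` and its derivative `s ↦ ∂v/∂s(·,s)`
    (V V' : ℝ → L2Z d)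
    (hVv : ∀ s y, V s y = v y s)
    (hderiv : ∀ s, HasDerivAt V (V' s) s)
    (hV'cont : Continuous V')
    (hdecay_top : Tendsto (fun s => ‖V s‖) atTop (nhds 0))
    (hdecay_bot : Tendsto (fun s => ‖V s‖) atBot (nhds 0))
    -- `∂v/∂s(y,s) − (m²/2) v(y,s) = (Λ/2)[ ∇*∇v(y,s) − ∇*( b(·,s) ∇w(·,s) )(y) ]`
    (hPDE : ∀ y s, V' s y - (m ^ 2 / 2 : ℝ) * v y s
      = (Lam / 2 : ℝ) * (dDiv (fun x => dGrad (fun z => v z s) x) y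
          - dDiv (fun x => matMulC (b x s) (dGrad (fun z => w z s) x)) y)) :
    (m ^ 2 / 2) * sqNorm v + (Lam / 4) * gradSqNorm v
      ≤ (Lam / 4) * (1 - lam / Lam) ^ 2 * gradSqNorm w := by
  have hLam : 0 < Lam := hlam.trans_le hll
  have hκ : 0 ≤ 1 - lam / Lam := sub_nonneg.2 ((div_le_one hLam).2 hll)
  have hVc : Continuous V := continuous_iff_continuousAt.2 fun s => (hderiv s).continuousAt
  have hvc : ∀ y, Continuous (v y) := fun y => by
    have : v y = fun s => V s y := funext fun s => (hVv s y).symm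
    rw [this]
    exact (lp.evalCLM ℝ (fun _ : Fin d → ℤ => ℂ) 2 y).continuous.comp hVc
  have hgradv := gradMemL2_of_memL2 hv hvc
  have hVs : ∀ s, (V s : (Fin d → ℤ) → ℂ) = fun z => v z s := fun s => funext (hVv s)
  obtain ⟨-, hvint, hveq⟩ := ae_summable_and_integrable_tsum_and_tsum_integral
    (fun _ _ => by positivity) hv.1 hv.2
  obtain ⟨-, hgvint, hgveq⟩ := ae_summable_and_integrable_tsum_and_tsum_integral
    (fun _ _ => by positivity) hgradv.1 hgradv.2
  obtain ⟨hwsum, hgwint, hgweq⟩ := ae_summable_and_integrable_tsum_and_tsum_integral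
    (fun _ _ => by positivity) hgradw.1 hgradw.2
  have hsumint : Integrable fun s => m ^ 2 / 2 * (∑' y, ‖v y s‖ ^ 2)
      + Lam / 4 * (∑' y, ∑ j, ‖dGrad (fun z => v z s) y j‖ ^ 2) :=
    (hvint.const_mul _).add (hgvint.const_mul _)
  have hnonpos := integral_nonpos_of_le_deriv (E := fun s => ‖V s‖ ^ 2 / 2)
    (E' := fun s => inner ℝ (V s) (V' s))
    (R := fun s => m ^ 2 / 2 * (∑' y, ‖v y s‖ ^ 2)
      + Lam / 4 * (∑' y, ∑ j, ‖dGrad (fun z => v z s) y j‖ ^ 2)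
      - Lam / 4 * (1 - lam / Lam) ^ 2 * ∑' y, ∑ j, ‖dGrad (fun z => w z s) y j‖ ^ 2)
    (fun s => by simpa using (hderiv s).norm_sq.div_const 2)
    (hVc.inner hV'cont)
    (by simpa using (hdecay_top.pow 2).div_const 2)
    (by simpa using (hdecay_bot.pow 2).div_const 2)
    (hsumint.sub (hgwint.const_mul _))
    (by
      filter_upwards [hwsum] with s hs
      have := slice_energy_le (c := m ^ 2 / 2) hLam.le hκ (hb_symm · s) (hb_lb · s) (hb_ub · s) hs
        (V s) (V' s) (fun y => by rw [hVs]; exact hPDE y s)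
      rw [← (hasSum_norm_sq_l2 (V s)).tsum_eq] at this
      simpa only [hVs] using this)
  rw [integral_sub hsumint (hgwint.const_mul _),
    integral_add (hvint.const_mul _) (hgvint.const_mul _), integral_const_mul,
    integral_const_mul, integral_const_mul,
    ← hveq, ← hgveq, ← hgweq] at hnonpos
  simp only [sqNorm, gradSqNorm]
  linarith

end Stmt2
end
end

section
/- Let d ≥ 1, 0 < λ ≤ Λ, m > 0, and g ∈ L²(ℤ^d × ℝ). Let b : ℤ^d × ℝ → ℝ^{d×d} be measurable with each b(y,s) symmetric and 0 ≤ b(y,s) ≤ (1 − λ/Λ) I_d as quadratic forms. Let v_n : ℤ^d × ℝ → ℂ, n = 0, 1, 2, …, be functions in L²(ℤ^d × ℝ) such that for each n the ℓ²(ℤ^d)-valued map s ↦ v_n(·,s) is continuously differentiable with derivative s ↦ ∂v_n/∂s(·,s) and ‖v_n(·,s)‖_{ℓ²(ℤ^d)} → 0 as s → ±∞, and such that ∂v_0/∂s(y,s) − (m²/2) v_0(y,s) = (Λ/2) ∇*∇v_0(y,s) − g(y,s) for all (y,s), and for every n ≥ 1, ∂v_n/∂s(y,s) − (m²/2) v_n(y,s)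 = (Λ/2) [ ∇*∇v_n(y,s) − ∇*( b(·,s) ∇v_{n−1}(·,s) )(y) ] for all (y,s). Then ‖v_0‖₂ ≤ (2/m²) ‖g‖₂, and for every n ≥ 1, ‖v_n‖₂ ≤ m^{−2} (1 − λ/Λ)^n ‖g‖₂. -/
open MeasureTheory Real Filter Matrix
open scoped ENNReal BigOperators

noncomputable section

namespace Stmt3

/-- The `j`-th standard basis vector of `ℤ^d`. -/
def e (d : ℕ) (j : Fin d) : Fin d → ℤ := fun k => if k = j then 1 else 0

/-- Discrete gradient `∇u(x) j = u(x+e_j) - u(x)`. -/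
def dGrad {d : ℕ} (u : (Fin d → ℤ) → ℂ) (x : Fin d → ℤ) : Fin d → ℂ :=
  fun j => u (x + e d j) - u x

/-- Discrete divergence `∇*F(x) = Σ_j [F_j(x-e_j) - F_j(x)]`. -/
def dDiv {d : ℕ} (F : (Fin d → ℤ) → Fin d → ℂ) (x : Fin d → ℤ) : ℂ :=
  ∑ j, (F (x - e d j) j - F x j)

/-- A real matrix acting on a complex vector. -/
def matMulC {d : ℕ} (M : Matrix (Fin d) (Fin d) ℝ) (w : Fin d → ℂ) : Fin d → ℂ :=
  fun j => ∑ k, (M j k : ℂ) * w k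

/-- Squared `L²(ℤ^d × ℝ)` norm `‖v‖₂²`. -/
def sqNorm {d : ℕ} (v : (Fin d → ℤ) → ℝ → ℂ) : ℝ := ∑' y, ∫ s, ‖v y s‖ ^ 2

/-- `L²(ℤ^d × ℝ)` norm `‖v‖₂`. -/
def l2Norm {d : ℕ} (v : (Fin d → ℤ) → ℝ → ℂ) : ℝ := Real.sqrt (sqNorm v)

/-- Membership in `L²(ℤ^d × ℝ)`. -/
def MemL2 {d : ℕ} (v : (Fin d → ℤ) → ℝ → ℂ) : Prop :=
  (∀ y, Integrable fun s => ‖v y s‖ ^ 2) ∧ Summable fun y => ∫ s, ‖v y s‖ ^ 2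

/-- `ℓ²(ℤ^d)`. -/
abbrev L2Z (d : ℕ) := lp (fun _ : Fin d → ℤ => ℂ) 2

lemma integral_linear_combination {f₁ f₂ f₃ : ℝ → ℝ} (h₁ : Integrable f₁) (h₂ : Integrable f₂)
    (h₃ : Integrable f₃) (c₁ c₂ c₃ : ℝ) :
    ∫ s, (c₁ * f₁ s + c₂ * f₂ s - c₃ * f₃ s)
      = c₁ * (∫ s, f₁ s) + c₂ * (∫ s, f₂ s) - c₃ * ∫ s, f₃ s := by
  have h₁₂ : Integrable fun s => c₁ * f₁ s + c₂ * f₂ s := (h₁.const_mul c₁).add (h₂.const_mul c₂)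
  rw [integral_sub h₁₂ (h₃.const_mul c₃), integral_add (h₁.const_mul c₁) (h₂.const_mul c₂),
    integral_const_mul, integral_const_mul, integral_const_mul]

/-- A series of nonnegative integrable functions with summable integrals has integrable sum. -/
lemma integrable_tsum_of_nonneg {ι : Type*} [Countable ι] {F : ι → ℝ → ℝ}
    (hF : ∀ i s, 0 ≤ F i s) (hint : ∀ i, Integrable (F i))
    (hsum : Summable fun i => ∫ s, F i s) : Integrable fun s => ∑' i, F i s := by
  have hm : ∀ i, AEMeasurable (fun s => ENNReal.ofReal (F i s)) :=
    fun i => (hint i).aemeasurable.ennreal_ofReal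
  have h : (fun s => ∑' i, F i s) = fun s => (∑' i, ENNReal.ofReal (F i s)).toReal := by
    funext s
    rw [ENNReal.tsum_toReal_eq fun i => ENNReal.ofReal_ne_top]
    exact tsum_congr fun i => (ENNReal.toReal_ofReal (hF i s)).symm
  rw [h]
  refine integrable_toReal_of_lintegral_ne_top (AEMeasurable.tsum hm) ?_
  rw [lintegral_tsum hm]
  have h2 : ∀ i, ∫⁻ s, ENNReal.ofReal (F i s) = ENNReal.ofReal (∫ s, F i s) := fun i =>
    (ofReal_integral_eq_lintegral_ofReal (hint i) (Eventually.of_forall (hF i))).symm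
  simp_rw [h2]
  exact hsum.tsum_ofReal_ne_top

lemma integral_tsum_of_nonneg {ι : Type*} [Countable ι] {F : ι → ℝ → ℝ}
    (hF : ∀ i s, 0 ≤ F i s) (hint : ∀ i, Integrable (F i))
    (hsum : Summable fun i => ∫ s, F i s) : ∫ s, ∑' i, F i s = ∑' i, ∫ s, F i s := by
  refine (integral_tsum_of_summable_integral_norm hint ?_).symm
  simpa only [Real.norm_of_nonneg (hF _ _)] using hsum

/-- An integrable lower bound for the derivative of a function vanishing at `±∞` has nonpositive
integral. -/
lemma integral_nonpos_of_le_deriv {f f' h : ℝ → ℝ} (hf : ∀ s, HasDerivAt f (f' s) s)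
    (hh : Integrable h) (hle : ∀ s, h s ≤ f' s) (htop : Tendsto f atTop (nhds 0))
    (hbot : Tendsto f atBot (nhds 0)) : ∫ s, h s ≤ 0 := by
  have h1 : Tendsto (fun R : ℝ => ∫ s in (-R)..R, h s) atTop (nhds (∫ s, h s)) :=
    intervalIntegral_tendsto_integral hh tendsto_neg_atTop_atBot tendsto_id
  have h2 : Tendsto (fun R : ℝ => f R - f (-R)) atTop (nhds (0 - 0)) :=
    htop.sub (hbot.comp tendsto_neg_atTop_atBot)
  rw [sub_zero] at h2
  refine le_of_tendsto_of_tendsto h1 h2 ?_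
  filter_upwards [eventually_ge_atTop 0] with R hR
  exact intervalIntegral.integral_le_sub_of_hasDeriv_right_of_le (by linarith)
    (fun s _ => (hf s).continuousAt.continuousWithinAt) (fun s _ => (hf s).hasDerivWithinAt)
    hh.integrableOn fun s _ => hle s

/-- Square summability on `ℤ^d`. -/
def SqSummable {d : ℕ} (u : (Fin d → ℤ) → ℂ) : Prop := Summable fun y => ‖u y‖ ^ 2

lemma SqSummable.sub {d : ℕ} {u w : (Fin d → ℤ) → ℂ} (hu : SqSummable u) (hw : SqSummable w) :
    SqSummable fun y => u y - w y := by
  refine Summable.of_nonneg_of_le (fun y => by positivity) (fun y => ?_)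
    ((hu.mul_left 2).add (hw.mul_left 2))
  have := norm_sub_le (u y) (w y)
  nlinarith [norm_nonneg (u y - w y), sq_nonneg (‖u y‖ - ‖w y‖)]

lemma SqSummable.comp_add {d : ℕ} {u : (Fin d → ℤ) → ℂ} (hu : SqSummable u) (c : Fin d → ℤ) :
    SqSummable fun y => u (y + c) :=
  (Equiv.addRight c).summable_iff (f := fun y => ‖u y‖ ^ 2) |>.mpr hu

lemma sqSummable_iff_memℓp {d : ℕ} {u : (Fin d → ℤ) → ℂ} : SqSummable u ↔ Memℓp u 2 := by
  rw [memℓp_gen_iff (by norm_num)]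
  simp [SqSummable]

lemma SqSummable.add {d : ℕ} {u w : (Fin d → ℤ) → ℂ} (hu : SqSummable u) (hw : SqSummable w) :
    SqSummable fun y => u y + w y :=
  sqSummable_iff_memℓp.mpr ((sqSummable_iff_memℓp.mp hu).add (sqSummable_iff_memℓp.mp hw))

lemma SqSummable.const_smul {d : ℕ} {u : (Fin d → ℤ) → ℂ} (hu : SqSummable u) (c : ℝ) :
    SqSummable fun y => c • u y :=
  sqSummable_iff_memℓp.mpr ((sqSummable_iff_memℓp.mp hu).const_smul c)

lemma SqSummable.dDiv {d : ℕ} {F : (Fin d → ℤ) → Fin d → ℂ}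
    (hF : ∀ j, SqSummable fun y => F y j) : SqSummable (dDiv F) :=
  sqSummable_iff_memℓp.mpr <| Memℓp.finsetSum Finset.univ fun j _ =>
    sqSummable_iff_memℓp.mp (((hF j).comp_add (-e d j)).sub (hF j))

lemma SqSummable.dGrad {d : ℕ} {u : (Fin d → ℤ) → ℂ} (hu : SqSummable u) (j : Fin d) :
    SqSummable fun y => dGrad u y j :=
  (hu.comp_add (e d j)).sub hu

lemma SqSummable.summable_inner {d : ℕ} {u w : (Fin d → ℤ) → ℂ} (hu : SqSummable u)
    (hw : SqSummable w) : Summable fun y => inner ℝ (u y) (w y) := by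
  refine Summable.of_norm_bounded (Summable.add hu hw) fun y => ?_
  refine (norm_inner_le_norm _ _).trans ?_
  nlinarith [sq_nonneg (‖u y‖ - ‖w y‖), sq_nonneg (‖u y‖ + ‖w y‖)]

/-- Summation by parts on `ℤ^d`. -/
lemma hasSum_inner_dDiv {d : ℕ} {u : (Fin d → ℤ) → ℂ} {F : (Fin d → ℤ) → Fin d → ℂ}
    (hu : SqSummable u) (hF : ∀ j, SqSummable fun y => F y j) :
    HasSum (fun y => inner ℝ (u y) (dDiv F y)) (∑' y, ∑ j, inner ℝ (dGrad u y j) (F y j)) := by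
  have h1 : ∀ j, Summable fun y => inner ℝ (u (y + e d j)) (F y j) :=
    fun j => (hu.comp_add (e d j)).summable_inner (hF j)
  have h2 : ∀ j, Summable fun y => inner ℝ (u y) (F y j) := fun j => hu.summable_inner (hF j)
  have h3 : ∀ j, HasSum (fun y => inner ℝ (u y) (F (y - e d j) j))
      (∑' y, inner ℝ (u (y + e d j)) (F y j)) := fun j => by
    rw [← (Equiv.addRight (e d j)).hasSum_iff]
    simpa [Function.comp_def] using (h1 j).hasSum
  have h4 := hasSum_sum (s := Finset.univ) fun j _ => (h3 j).sub (h2 j).hasSum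
  have h5 := hasSum_sum (s := Finset.univ) fun j _ => (h1 j).hasSum.sub (h2 j).hasSum
  have h6 : (∑' y, ∑ j, inner ℝ (dGrad u y j) (F y j))
      = ∑ j, ((∑' y, inner ℝ (u (y + e d j)) (F y j)) - ∑' y, inner ℝ (u y) (F y j)) := by
    rw [← h5.tsum_eq]
    exact tsum_congr fun y => Finset.sum_congr rfl fun j _ => by rw [dGrad, inner_sub_left]
  rw [h6]
  convert! h4 using 2 with y
  simp only [dDiv, inner_sum, inner_sub_right]

/-- Young's inequality for a symmetric form bounded by `0` and `a`. -/
lemma dotProduct_mulVec_le {d : ℕ} {M : Matrix (Fin d) (Fin d) ℝ} {a : ℝ} (ha : 0 ≤ a)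
    (hM : M.IsSymm) (hlb : ∀ w, 0 ≤ w ⬝ᵥ M.mulVec w)
    (hub : ∀ w, w ⬝ᵥ M.mulVec w ≤ a * ∑ j, w j ^ 2) (p q : Fin d → ℝ) :
    p ⬝ᵥ M.mulVec q ≤ (1 / 2) * ∑ j, p j ^ 2 + (a ^ 2 / 2) * ∑ j, q j ^ 2 := by
  have key : ∀ p q : Fin d → ℝ,
      4 * (p ⬝ᵥ M.mulVec q) ≤ a * (2 * ∑ j, p j ^ 2 + 2 * ∑ j, q j ^ 2) := fun p q => by
    have hs : q ⬝ᵥ M.mulVec p = p ⬝ᵥ M.mulVec q := by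
      rw [dotProduct_mulVec, ← mulVec_transpose, hM.eq, dotProduct_comm]
    have h1 := hub (p + q)
    have h2 := hlb (p - q)
    have h3 : ∑ j, (p + q) j ^ 2 ≤ 2 * ∑ j, p j ^ 2 + 2 * ∑ j, q j ^ 2 := by
      rw [Finset.mul_sum, Finset.mul_sum, ← Finset.sum_add_distrib]
      refine Finset.sum_le_sum fun j _ => ?_
      simp only [Pi.add_apply]
      nlinarith [sq_nonneg (p j - q j)]
    have h4 := mul_le_mul_of_nonneg_left h3 ha
    simp only [mulVec_add, mulVec_sub, add_dotProduct, sub_dotProduct, dotProduct_add,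
      dotProduct_sub, hs] at h1 h2
    linarith
  have hp : 0 ≤ ∑ j, p j ^ 2 := Finset.sum_nonneg fun j _ => sq_nonneg _
  rcases ha.eq_or_lt with rfl | ha
  · have := key p q
    linarith
  · have h := key p (a • q)
    simp only [mulVec_smul, dotProduct_smul, smul_eq_mul, Pi.smul_apply, mul_pow,
      ← Finset.mul_sum] at h
    refine le_of_mul_le_mul_left ?_ (by positivity : 0 < 4 * a)
    linarith

lemma sum_inner_matMulC_le {d : ℕ} {M : Matrix (Fin d) (Fin d) ℝ} {a : ℝ} (ha : 0 ≤ a)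
    (hM : M.IsSymm) (hlb : ∀ w, 0 ≤ w ⬝ᵥ M.mulVec w)
    (hub : ∀ w, w ⬝ᵥ M.mulVec w ≤ a * ∑ j, w j ^ 2) (p q : Fin d → ℂ) :
    ∑ j, inner ℝ (p j) (matMulC M q j)
      ≤ (1 / 2) * ∑ j, ‖p j‖ ^ 2 + (a ^ 2 / 2) * ∑ j, ‖q j‖ ^ 2 := by
  have hre := dotProduct_mulVec_le ha hM hlb hub (fun j => (p j).re) (fun j => (q j).re)
  have him := dotProduct_mulVec_le ha hM hlb hub (fun j => (p j).im) (fun j => (q j).im)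
  have hn : ∀ r : Fin d → ℂ, ∑ j, ‖r j‖ ^ 2 = ∑ j, (r j).re ^ 2 + ∑ j, (r j).im ^ 2 := fun r => by
    rw [← Finset.sum_add_distrib]
    exact Finset.sum_congr rfl fun j _ => by rw [Complex.sq_norm, Complex.normSq_apply]; ring
  have hi : ∑ j, inner ℝ (p j) (matMulC M q j) = (fun j => (p j).re) ⬝ᵥ M.mulVec (fun j => (q j).re)
      + (fun j => (p j).im) ⬝ᵥ M.mulVec (fun j => (q j).im) := by
    simp only [dotProduct, mulVec, ← Finset.sum_add_distrib]
    refine Finset.sum_congr rfl fun j _ => ?_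
    simp [Complex.inner, matMulC, mul_comm]
  rw [hi, hn, hn]
  linarith

lemma sum_norm_sq_matMulC_le {d : ℕ} {M : Matrix (Fin d) (Fin d) ℝ} {a : ℝ} (ha : 0 ≤ a)
    (hM : M.IsSymm) (hlb : ∀ w, 0 ≤ w ⬝ᵥ M.mulVec w)
    (hub : ∀ w, w ⬝ᵥ M.mulVec w ≤ a * ∑ j, w j ^ 2) (q : Fin d → ℂ) :
    ∑ j, ‖matMulC M q j‖ ^ 2 ≤ a ^ 2 * ∑ j, ‖q j‖ ^ 2 := by
  have h := sum_inner_matMulC_le ha hM hlb hub (matMulC M q) q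
  simp only [real_inner_self_eq_norm_sq] at h
  linarith

/-- The Dirichlet energy `‖∇u‖²` on `ℤ^d`. -/
def gradSq {d : ℕ} (u : (Fin d → ℤ) → ℂ) : ℝ := ∑' y, ∑ j, ‖dGrad u y j‖ ^ 2

lemma SqSummable.summable_gradSq {d : ℕ} {u : (Fin d → ℤ) → ℂ} (hu : SqSummable u) :
    Summable fun y => ∑ j, ‖Stmt3.dGrad u y j‖ ^ 2 :=
  summable_sum fun j _ => hu.dGrad j

lemma L2Z.sqSummable {d : ℕ} (U : L2Z d) : SqSummable U := by
  have := lp.summable_inner (𝕜 := ℝ) U U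
  simpa only [SqSummable, real_inner_self_eq_norm_sq] using this

lemma L2Z.norm_sq_eq {d : ℕ} (U : L2Z d) : ‖U‖ ^ 2 = ∑' y, ‖U y‖ ^ 2 := by
  rw [← real_inner_self_eq_norm_sq, lp.inner_eq_tsum]
  simp only [real_inner_self_eq_norm_sq]

lemma hasSum_inner_dDiv_dGrad {d : ℕ} {u : (Fin d → ℤ) → ℂ} (hu : SqSummable u) :
    HasSum (fun y => inner ℝ (u y) (dDiv (fun x => dGrad u x) y)) (gradSq u) := by
  have h := hasSum_inner_dDiv hu (F := fun x => dGrad u x) hu.dGrad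
  simp only [real_inner_self_eq_norm_sq] at h
  exact h

lemma tsum_inner_dGrad_matMulC_le {d : ℕ} {b : (Fin d → ℤ) → Matrix (Fin d) (Fin d) ℝ} {a : ℝ}
    (ha : 0 ≤ a) (hb : ∀ y, (b y).IsSymm) (hlb : ∀ y w, 0 ≤ w ⬝ᵥ (b y).mulVec w)
    (hub : ∀ y w, w ⬝ᵥ (b y).mulVec w ≤ a * ∑ j, w j ^ 2) {u w : (Fin d → ℤ) → ℂ}
    (hu : SqSummable u) (hw : SqSummable w) :
    ∃ I, HasSum (fun y => inner ℝ (u y) (dDiv (fun x => matMulC (b x) (dGrad w x)) y)) I ∧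
      I ≤ (1 / 2) * gradSq u + (a ^ 2 / 2) * gradSq w := by
  have hF : ∀ j, SqSummable fun y => matMulC (b y) (dGrad w y) j := fun j => by
    refine Summable.of_nonneg_of_le (fun y => by positivity) (fun y => ?_)
      (hw.summable_gradSq.mul_left (a ^ 2))
    exact (Finset.single_le_sum (f := fun j => ‖matMulC (b y) (dGrad w y) j‖ ^ 2)
      (fun i _ => by positivity) (Finset.mem_univ j)).trans
      (sum_norm_sq_matMulC_le ha (hb y) (hlb y) (hub y) _)
  refine ⟨_, hasSum_inner_dDiv hu hF, ?_⟩
  rw [gradSq, gradSq, ← tsum_mul_left, ← tsum_mul_left, ← Summable.tsum_add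
    (hu.summable_gradSq.mul_left _) (hw.summable_gradSq.mul_left _)]
  exact Summable.tsum_le_tsum (fun y => sum_inner_matMulC_le ha (hb y) (hlb y) (hub y) _ _)
    (summable_sum fun j _ => (hu.dGrad j).summable_inner (hF j))
    ((hu.summable_gradSq.mul_left _).add (hw.summable_gradSq.mul_left _))

lemma MemL2.integrable_tsum {d : ℕ} {v : (Fin d → ℤ) → ℝ → ℂ} (hv : MemL2 v) :
    Integrable fun s => ∑' y, ‖v y s‖ ^ 2 :=
  integrable_tsum_of_nonneg (fun _ _ => by positivity) hv.1 hv.2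

lemma MemL2.integral_tsum {d : ℕ} {v : (Fin d → ℤ) → ℝ → ℂ} (hv : MemL2 v) :
    ∫ s, ∑' y, ‖v y s‖ ^ 2 = sqNorm v :=
  integral_tsum_of_nonneg (fun _ _ => by positivity) hv.1 hv.2

lemma MemL2.integrable_gradSq {d : ℕ} {v : (Fin d → ℤ) → ℝ → ℂ} (hv : MemL2 v)
    (hc : ∀ y, Continuous (v y)) : Integrable fun s => gradSq fun y => v y s := by
  have hi : ∀ y j, Integrable fun s => 2 * ‖v (y + e d j) s‖ ^ 2 + 2 * ‖v y s‖ ^ 2 :=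
    fun y j => ((hv.1 _).const_mul 2).add ((hv.1 y).const_mul 2)
  have hle : ∀ y j s, ‖dGrad (fun z => v z s) y j‖ ^ 2
      ≤ 2 * ‖v (y + e d j) s‖ ^ 2 + 2 * ‖v y s‖ ^ 2 := fun y j s => by
    have := norm_sub_le (v (y + e d j) s) (v y s)
    simp only [dGrad]
    nlinarith [norm_nonneg (v (y + e d j) s - v y s), sq_nonneg (‖v (y + e d j) s‖ - ‖v y s‖)]
  have hg : ∀ y j, Integrable fun s => ‖dGrad (fun z => v z s) y j‖ ^ 2 := fun y j => by
    refine (hi y j).mono' ?_ (Eventually.of_forall fun s => ?_)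
    · have h1 := hc (y + e d j)
      have h2 := hc y
      exact Continuous.aestronglyMeasurable (by unfold dGrad; fun_prop)
    · rw [Real.norm_of_nonneg (by positivity)]
      exact hle y j s
  refine integrable_tsum_of_nonneg (F := fun y s => ∑ j, ‖dGrad (fun z => v z s) y j‖ ^ 2)
    (fun y s => by positivity) (fun y => integrable_finsetSum _ fun j _ => hg y j) ?_
  simp_rw [fun y => integral_finsetSum Finset.univ fun j _ => hg y j]
  refine summable_sum fun j _ => Summable.of_nonneg_of_le
    (fun y => integral_nonneg fun s => by positivity)
    (fun y => integral_mono (hg y j) (hi y j) (hle y j)) ?_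
  simp_rw [fun y => integral_add ((hv.1 (y + e d j)).const_mul 2) ((hv.1 y).const_mul 2),
    integral_const_mul]
  exact (((Equiv.addRight (e d j)).summable_iff.mpr hv.2).mul_left 2).add (hv.2.mul_left 2)

/-- The energy inequality for `∂u - (m²/2) u = (Λ/2) ∇*∇u - g` at a fixed time. -/
lemma energy_le_of_source {d : ℕ} {Lam m : ℝ} {U U' : L2Z d} {g : (Fin d → ℤ) → ℂ}
    (h : ∀ y, U' y - (m ^ 2 / 2 : ℝ) * U y
      = (Lam / 2 : ℝ) * dDiv (fun x => dGrad U x) y - g y) {c : ℝ} (hc : 0 < c) :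
    (m ^ 2 - c) * ‖U‖ ^ 2 + Lam * gradSq U - c⁻¹ * ∑' y, ‖g y‖ ^ 2 ≤ 2 * inner ℝ U U' := by
  have hU := L2Z.sqSummable U
  have hg : SqSummable g := by
    have h1 : g = fun y => ((Lam / 2 : ℝ) • dDiv (fun x => dGrad U x) y + (m ^ 2 / 2 : ℝ) • U y)
        - U' y := by
      funext y
      simp only [Complex.real_smul]
      linear_combination h y
    rw [h1]
    exact (((SqSummable.dDiv hU.dGrad).const_smul _).add (hU.const_smul _)).sub
      (L2Z.sqSummable U')
  have h1 := ((L2Z.norm_sq_eq U ▸ hU.hasSum).mul_left (m ^ 2)).add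
    ((hasSum_inner_dDiv_dGrad hU).mul_left Lam)
  have h2 := (h1.sub ((L2Z.norm_sq_eq U ▸ hU.hasSum).mul_left c)).sub (hg.hasSum.mul_left c⁻¹)
  have h3 := (lp.hasSum_inner (𝕜 := ℝ) U U').mul_left 2
  refine le_trans (le_of_eq (by ring)) (hasSum_le (fun y => ?_) h2 h3)
  have h4 : U' y = (m ^ 2 / 2 : ℝ) • U y + (Lam / 2 : ℝ) • dDiv (fun x => dGrad U x) y - g y := by
    simp only [Complex.real_smul]
    linear_combination h y
  rw [h4, inner_sub_right, inner_add_right, inner_smul_right, inner_smul_right,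
    real_inner_self_eq_norm_sq]
  have h5 := real_inner_le_norm (U y) (g y)
  have h6 : 2 * (‖U y‖ * ‖g y‖) ≤ c * ‖U y‖ ^ 2 + c⁻¹ * ‖g y‖ ^ 2 := by
    have : 0 ≤ c⁻¹ * (c * ‖U y‖ - ‖g y‖) ^ 2 := by positivity
    have h7 : c⁻¹ * (c * ‖U y‖ - ‖g y‖) ^ 2
        = c * ‖U y‖ ^ 2 - 2 * (‖U y‖ * ‖g y‖) + c⁻¹ * ‖g y‖ ^ 2 := by
      field_simp
      ring
    linarith
  linarith

/-- The energy inequality for `∂u - (m²/2) u = (Λ/2) (∇*∇u - ∇*(b∇w))` at a fixed time. -/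
lemma energy_le_of_perturbation {d : ℕ} {Lam m : ℝ} (hLam : 0 ≤ Lam)
    {b : (Fin d → ℤ) → Matrix (Fin d) (Fin d) ℝ} {a : ℝ}
    (ha : 0 ≤ a) (hb : ∀ y, (b y).IsSymm) (hlb : ∀ y w, 0 ≤ w ⬝ᵥ (b y).mulVec w)
    (hub : ∀ y w, w ⬝ᵥ (b y).mulVec w ≤ a * ∑ j, w j ^ 2) {U U' W : L2Z d}
    (h : ∀ y, U' y - (m ^ 2 / 2 : ℝ) * U y = (Lam / 2 : ℝ) * (dDiv (fun x => dGrad U x) y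
      - dDiv (fun x => matMulC (b x) (dGrad W x)) y)) :
    m ^ 2 * ‖U‖ ^ 2 + Lam / 2 * gradSq U - Lam * a ^ 2 / 2 * gradSq W ≤ 2 * inner ℝ U U' := by
  have hU := L2Z.sqSummable U
  obtain ⟨I, hI, hIle⟩ := tsum_inner_dGrad_matMulC_le ha hb hlb hub hU (L2Z.sqSummable W)
  have h1 := (((L2Z.norm_sq_eq U ▸ hU.hasSum).mul_left (m ^ 2)).add
    ((hasSum_inner_dDiv_dGrad hU).mul_left Lam)).sub (hI.mul_left Lam)
  have h3 := (lp.hasSum_inner (𝕜 := ℝ) U U').mul_left 2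
  have h2 := hasSum_le (fun y => le_of_eq ?_) h1 h3
  · have := mul_le_mul_of_nonneg_left hIle hLam
    linarith
  have h4 : U' y = (m ^ 2 / 2 : ℝ) • U y + (Lam / 2 : ℝ) • (dDiv (fun x => dGrad U x) y
      - dDiv (fun x => matMulC (b x) (dGrad W x)) y) := by
    simp only [Complex.real_smul]
    linear_combination h y
  rw [h4, inner_add_right, inner_smul_right, inner_smul_right, inner_sub_right,
    real_inner_self_eq_norm_sq]
  ring

theorem stmt3 (d : ℕ) (hd : 1 ≤ d) (lam Lam m : ℝ) (hlam : 0 < lam) (hll : lam ≤ Lam)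
    (hm : 0 < m)
    (g : (Fin d → ℤ) → ℝ → ℂ) (hg : MemL2 g)
    (b : (Fin d → ℤ) → ℝ → Matrix (Fin d) (Fin d) ℝ)
    (hb_meas : ∀ y j k, Measurable fun s => b y s j k)
    (hb_symm : ∀ y s, (b y s).IsSymm)
    (hb_lb : ∀ y s (w : Fin d → ℝ), 0 ≤ w ⬝ᵥ (b y s).mulVec w)
    (hb_ub : ∀ y s (w : Fin d → ℝ), w ⬝ᵥ (b y s).mulVec w ≤ (1 - lam / Lam) * (∑ j, w j ^ 2))
    (v : ℕ → (Fin d → ℤ) → ℝ → ℂ)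
    (hv : ∀ n, MemL2 (v n))
    -- the `ℓ²(ℤ^d)`-valued maps `s ↦ v_n(·,s)` and their derivatives `s ↦ ∂v_n/∂s(·,s)`
    (V V' : ℕ → ℝ → L2Z d)
    (hVv : ∀ n s y, V n s y = v n y s)
    (hderiv : ∀ n s, HasDerivAt (V n) (V' n s) s)
    (hV'cont : ∀ n, Continuous (V' n))
    (hdecay_top : ∀ n, Tendsto (fun s => ‖V n s‖) atTop (nhds 0))
    (hdecay_bot : ∀ n, Tendsto (fun s => ‖V n s‖) atBot (nhds 0))
    -- `∂v_0/∂s(y,s) − (m²/2) v_0(y,s) = (Λ/2) ∇*∇v_0(y,s) − g(y,s)`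
    (hPDE0 : ∀ y s, V' 0 s y - (m ^ 2 / 2 : ℝ) * v 0 y s
      = (Lam / 2 : ℝ) * dDiv (fun x => dGrad (fun z => v 0 z s) x) y - g y s)
    -- `∂v_n/∂s(y,s) − (m²/2) v_n(y,s)
    --    = (Λ/2)[ ∇*∇v_n(y,s) − ∇*( b(·,s) ∇v_{n−1}(·,s) )(y) ]` for `n ≥ 1`
    (hPDE : ∀ n, 1 ≤ n → ∀ y s, V' n s y - (m ^ 2 / 2 : ℝ) * v n y s
      = (Lam / 2 : ℝ) * (dDiv (fun x => dGrad (fun z => v n z s) x) y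
          - dDiv (fun x => matMulC (b x s) (dGrad (fun z => v (n - 1) z s) x)) y)) :
    l2Norm (v 0) ≤ (2 / m ^ 2) * l2Norm g ∧
      ∀ n, 1 ≤ n → l2Norm (v n) ≤ (m ^ 2)⁻¹ * (1 - lam / Lam) ^ n * l2Norm g := by
  have hLam : 0 < Lam := hlam.trans_le hll
  have ha : 0 ≤ 1 - lam / Lam := sub_nonneg.mpr ((div_le_one hLam).mpr hll)
  set a := 1 - lam / Lam
  have hfun : ∀ n s, (V n s : (Fin d → ℤ) → ℂ) = fun y => v n y s := fun n s => funext (hVv n s)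
  have hcont : ∀ n y, Continuous (v n y) := fun n y => by
    have h1 : Continuous (V n) :=
      continuous_iff_continuousAt.mpr fun s => (hderiv n s).continuousAt
    have h2 := (continuous_apply y).comp (lp.uniformContinuous_coe.continuous.comp h1)
    exact h2.congr fun s => hVv n s y
  have hN : ∀ n, (fun s => ‖V n s‖ ^ 2) = fun s => ∑' y, ‖v n y s‖ ^ 2 := fun n => by
    funext s
    rw [L2Z.norm_sq_eq, hfun]
  have hNint : ∀ n, Integrable fun s => ‖V n s‖ ^ 2 := fun n => hN n ▸ (hv n).integrable_tsum
  have hNeq : ∀ n, ∫ s, ‖V n s‖ ^ 2 = sqNorm (v n) := fun n => hN n ▸ (hv n).integral_tsum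
  have hDint : ∀ n, Integrable fun s => gradSq (V n s) := fun n => by
    simp_rw [hfun]
    exact (hv n).integrable_gradSq (hcont n)
  have hDnonneg : ∀ n, 0 ≤ ∫ s, gradSq (V n s) := fun n =>
    integral_nonneg fun s => tsum_nonneg fun y => by positivity
  have hNnonneg : ∀ n, 0 ≤ sqNorm (v n) := fun n =>
    hNeq n ▸ integral_nonneg fun s => by positivity
  have hmain : ∀ n (h : ℝ → ℝ), Integrable h → (∀ s, h s ≤ 2 * inner ℝ (V n s) (V' n s)) →
      ∫ s, h s ≤ 0 := fun n h hint hle =>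
    integral_nonpos_of_le_deriv (fun s => (hderiv n s).norm_sq) hint hle
      (by simpa using (hdecay_top n).pow 2) (by simpa using (hdecay_bot n).pow 2)
  have hzero : ∀ c, 0 < c → (m ^ 2 - c) * sqNorm (v 0) + Lam * (∫ s, gradSq (V 0 s))
      - c⁻¹ * sqNorm g ≤ 0 := fun c hc => by
    have h := hmain 0 _ ((((hNint 0).const_mul (m ^ 2 - c)).add ((hDint 0).const_mul Lam)).sub
      (hg.integrable_tsum.const_mul c⁻¹)) fun s => energy_le_of_source (fun y => by
        simpa only [hfun] using hPDE0 y s) hc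
    rw [← hNeq, ← hg.integral_tsum]
    exact (integral_linear_combination (hNint 0) (hDint 0) hg.integrable_tsum _ _ _).symm.trans_le h
  have hstep : ∀ n, m ^ 2 * sqNorm (v (n + 1)) + Lam / 2 * (∫ s, gradSq (V (n + 1) s))
      - Lam * a ^ 2 / 2 * (∫ s, gradSq (V n s)) ≤ 0 := fun n => by
    have h := hmain (n + 1) _ ((((hNint (n + 1)).const_mul (m ^ 2)).add
      ((hDint (n + 1)).const_mul (Lam / 2))).sub ((hDint n).const_mul (Lam * a ^ 2 / 2)))
      fun s => energy_le_of_perturbation hLam.le ha (fun y => hb_symm y s)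
        (fun y => hb_lb y s) (fun y => hb_ub y s) (fun y => by
        simpa only [hfun, Nat.add_sub_cancel] using hPDE (n + 1) (Nat.le_add_left 1 n) y s)
    rw [← hNeq]
    exact (integral_linear_combination (hNint (n + 1)) (hDint (n + 1)) (hDint n)
      _ _ _).symm.trans_le h
  have hm2 : 0 < m ^ 2 := by positivity
  have hgn : 0 ≤ sqNorm g := tsum_nonneg fun y => integral_nonneg fun s => by positivity
  have hgrad : ∀ n, Lam * (∫ s, gradSq (V n s)) ≤ (a ^ n) ^ 2 * ((m ^ 2)⁻¹ * sqNorm g) := by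
    intro n
    induction n with
    | zero =>
      have := hzero (m ^ 2) hm2
      simp only [pow_zero, one_pow]
      linarith
    | succ n ih =>
      have h1 := hstep n
      have h2 := mul_le_mul_of_nonneg_left ih (sq_nonneg a)
      have h3 := mul_nonneg hm2.le (hNnonneg (n + 1))
      have h4 : (a ^ (n + 1)) ^ 2 = a ^ 2 * (a ^ n) ^ 2 := by ring
      rw [h4, mul_assoc]
      linarith
  refine ⟨?_, fun n hn => ?_⟩
  · refine Real.sqrt_le_iff.mpr ⟨by unfold l2Norm; positivity, ?_⟩
    rw [l2Norm, mul_pow, Real.sq_sqrt hgn]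
    have h1 := hzero (m ^ 2 / 2) (by positivity)
    have h2 := mul_nonneg hLam.le (hDnonneg 0)
    have h3 : (m ^ 2 / 2) * sqNorm (v 0) ≤ (m ^ 2 / 2)⁻¹ * sqNorm g := by linarith
    refine le_of_mul_le_mul_left (h3.trans_eq ?_) (by positivity : 0 < m ^ 2 / 2)
    field_simp
  · obtain ⟨n, rfl⟩ := Nat.exists_eq_add_of_le' hn
    refine Real.sqrt_le_iff.mpr ⟨by unfold l2Norm; positivity, ?_⟩
    rw [l2Norm, mul_pow, mul_pow, Real.sq_sqrt hgn]
    have h1 := hstep n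
    have h2 := mul_nonneg hLam.le (hDnonneg (n + 1))
    have h3 := mul_le_mul_of_nonneg_left (hgrad n) (sq_nonneg a)
    have h4 : 0 ≤ (a ^ (n + 1)) ^ 2 * ((m ^ 2)⁻¹ * sqNorm g) := by positivity
    have h5 : (a ^ (n + 1)) ^ 2 = a ^ 2 * (a ^ n) ^ 2 := by ring
    refine le_of_mul_le_mul_left ?_ hm2
    calc m ^ 2 * sqNorm (v (n + 1)) ≤ (a ^ (n + 1)) ^ 2 * ((m ^ 2)⁻¹ * sqNorm g) := by
          rw [h5, mul_assoc] at h4 ⊢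
          linarith
      _ = m ^ 2 * (((m ^ 2)⁻¹) ^ 2 * (a ^ (n + 1)) ^ 2 * sqNorm g) := by
          field_simp

end Stmt3
end
end

section
/- Let d ≥ 1, Λ > 0, ξ ∈ ℝ^d and η ∈ ℂ with Re η > 0. Let f ∈ L²(ℤ^d × ℝ, ℂ^d) and let u : ℤ^d × ℝ → ℂ be such that u ∈ L²(ℤ^d × ℝ), the ℓ²(ℤ^d)-valued map r ↦ u(·,r) is continuously differentiable with derivative r ↦ ∂u/∂r(·,r), ‖u(·,r)‖_{ℓ²(ℤ^d)} → 0 as r → ±∞, and u satisfies (1/Λ)[ η u(z,r) − ∂u/∂r(z,r) ] + ∇*_ξ ∇_ξ u(z,r) = ∇*_ξ f(z,r) for all z ∈ ℤ^d and r ∈ ℝ. Then (Re η / Λ) ‖u‖₂² + ‖∇_ξ u‖₂² ≤ ‖f‖₂². -/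
open MeasureTheory Real Filter
open scoped ENNReal BigOperators

noncomputable section

namespace Stmt4

/-- The `j`-th standard basis vector of `ℤ^d`. -/
def e (d : ℕ) (j : Fin d) : Fin d → ℤ := fun k => if k = j then 1 else 0

/-- Twisted gradient `∇_{j,ξ}u(z) = e^{−i e_j·ξ} u(z+e_j) − u(z)` for real `ξ`. -/
def tGrad {d : ℕ} (ξ : Fin d → ℝ) (u : (Fin d → ℤ) → ℂ) (z : Fin d → ℤ) : Fin d → ℂ :=
  fun j => Complex.exp (-(Complex.I * (ξ j : ℂ))) * u (z + e d j) - u z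

/-- Twisted divergence `∇*_ξ F(z) = Σ_j [e^{i e_j·ξ} F_j(z−e_j) − F_j(z)]` for real `ξ`. -/
def tDiv {d : ℕ} (ξ : Fin d → ℝ) (F : (Fin d → ℤ) → Fin d → ℂ) (z : Fin d → ℤ) : ℂ :=
  ∑ j, (Complex.exp (Complex.I * (ξ j : ℂ)) * F (z - e d j) j - F z j)

/-- Squared `L²(ℤ^d × ℝ)` norm `‖u‖₂²`. -/
def sqNorm {d : ℕ} (u : (Fin d → ℤ) → ℝ → ℂ) : ℝ := ∑' z, ∫ r, ‖u z r‖ ^ 2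

/-- Squared `L²(ℤ^d × ℝ, ℂ^d)` norm `‖f‖₂²` of a vector-valued function. -/
def vSqNorm {d : ℕ} (f : (Fin d → ℤ) → ℝ → Fin d → ℂ) : ℝ :=
  ∑' z, ∫ r, ∑ j, ‖f z r j‖ ^ 2

/-- Squared `L²` norm of the twisted gradient `‖∇_ξ u‖₂²`. -/
def tGradSqNorm {d : ℕ} (ξ : Fin d → ℝ) (u : (Fin d → ℤ) → ℝ → ℂ) : ℝ :=
  ∑' z, ∫ r, ∑ j, ‖tGrad ξ (fun z' => u z' r) z j‖ ^ 2

/-- Membership in `L²(ℤ^d × ℝ)`. -/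
def MemL2 {d : ℕ} (u : (Fin d → ℤ) → ℝ → ℂ) : Prop :=
  (∀ z, Integrable fun r => ‖u z r‖ ^ 2) ∧ Summable fun z => ∫ r, ‖u z r‖ ^ 2

/-- Membership in `L²(ℤ^d × ℝ, ℂ^d)`. -/
def VMemL2 {d : ℕ} (f : (Fin d → ℤ) → ℝ → Fin d → ℂ) : Prop :=
  (∀ z, Integrable fun r => ∑ j, ‖f z r j‖ ^ 2) ∧
    Summable fun z => ∫ r, ∑ j, ‖f z r j‖ ^ 2

/-- `ℓ²(ℤ^d)`. -/
abbrev L2Z (d : ℕ) := lp (fun _ : Fin d → ℤ => ℂ) 2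

lemma summable_mul_conj {ι : Type*} {v w : ι → ℂ} (hv : Summable fun z => ‖v z‖ ^ 2)
    (hw : Summable fun z => ‖w z‖ ^ 2) : Summable fun z => v z * (starRingEnd ℂ) (w z) := by
  refine Summable.of_norm_bounded (hv.add hw) fun z => ?_
  rw [norm_mul, RCLike.norm_conj]
  nlinarith [sq_nonneg (‖v z‖ - ‖w z‖), sq_nonneg (‖v z‖), sq_nonneg (‖w z‖)]

lemma norm_exp_neg_I_mul (x : ℝ) : ‖Complex.exp (-(Complex.I * (x : ℂ)))‖ = 1 := by
  rw [show -(Complex.I * (x : ℂ)) = ((-x : ℝ) : ℂ) * Complex.I by push_cast; ring]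
  exact Complex.norm_exp_ofReal_mul_I _

lemma conj_exp_neg_I_mul (x : ℝ) :
    (starRingEnd ℂ) (Complex.exp (-(Complex.I * (x : ℂ)))) = Complex.exp (Complex.I * (x : ℂ)) := by
  rw [← Complex.exp_conj]
  simp

lemma norm_tGrad_sq_le {d : ℕ} (ξ : Fin d → ℝ) (v : (Fin d → ℤ) → ℂ) (z : Fin d → ℤ)
    (j : Fin d) : ‖tGrad ξ v z j‖ ^ 2 ≤ 2 * (‖v (z + e d j)‖ ^ 2 + ‖v z‖ ^ 2) := by
  have h : ‖tGrad ξ v z j‖ ≤ ‖v (z + e d j)‖ + ‖v z‖ := by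
    refine (norm_sub_le _ _).trans_eq ?_
    rw [norm_mul, norm_exp_neg_I_mul, one_mul]
  calc ‖tGrad ξ v z j‖ ^ 2 ≤ (‖v (z + e d j)‖ + ‖v z‖) ^ 2 := by gcongr
    _ ≤ _ := by nlinarith [sq_nonneg (‖v (z + e d j)‖ - ‖v z‖)]

lemma summable_shift {d : ℕ} (a : Fin d → ℤ) {g : (Fin d → ℤ) → ℝ} (hg : Summable g) :
    Summable fun z => g (z + a) :=
  hg.comp_injective (add_left_injective a)

lemma summable_norm_tGrad_sq {d : ℕ} (ξ : Fin d → ℝ) {v : (Fin d → ℤ) → ℂ}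
    (hv : Summable fun z => ‖v z‖ ^ 2) (j : Fin d) :
    Summable fun z => ‖tGrad ξ v z j‖ ^ 2 := by
  have hs := summable_shift (e d j) hv
  exact Summable.of_nonneg_of_le (fun _ => by positivity)
    (fun z => norm_tGrad_sq_le ξ v z j) ((hs.add hv).mul_left 2)

/-- Summation by parts: `∇*_ξ` is the `ℓ²` adjoint of `∇_ξ`. -/
lemma hasSum_tDiv_mul_conj {d : ℕ} (ξ : Fin d → ℝ) {F : (Fin d → ℤ) → Fin d → ℂ}
    {v : (Fin d → ℤ) → ℂ} (hF : ∀ j, Summable fun z => ‖F z j‖ ^ 2)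
    (hv : Summable fun z => ‖v z‖ ^ 2) :
    HasSum (fun z => tDiv ξ F z * (starRingEnd ℂ) (v z))
      (∑' z, ∑ j, F z j * (starRingEnd ℂ) (tGrad ξ v z j)) := by
  have hFG : ∀ j, Summable fun z => F z j * (starRingEnd ℂ) (tGrad ξ v z j) :=
    fun j => summable_mul_conj (hF j) (summable_norm_tGrad_sq ξ hv j)
  rw [Summable.tsum_finsetSum fun j _ => hFG j]
  simp only [tDiv, Finset.sum_mul]
  refine hasSum_sum fun j _ => ?_
  have hs := summable_shift (e d j) hv
  have h1 := (summable_mul_conj (hF j) hs).hasSum.mul_left (Complex.exp (Complex.I * (ξ j : ℂ)))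
  have h2 := (summable_mul_conj (hF j) hv).hasSum
  have h3 := h1.sub h2
  have h4 : (∑' z, F z j * (starRingEnd ℂ) (tGrad ξ v z j)) =
      Complex.exp (Complex.I * (ξ j : ℂ)) * (∑' z, F z j * (starRingEnd ℂ) (v (z + e d j))) -
        ∑' z, F z j * (starRingEnd ℂ) (v z) := by
    rw [← h3.tsum_eq]
    refine tsum_congr fun z => ?_
    simp only [tGrad, map_sub, map_mul, conj_exp_neg_I_mul]
    ring
  rw [h4]
  have h5 := (Equiv.subRight (e d j)).hasSum_iff.mpr h1
  have h6 := h5.sub h2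
  have h7 : (fun z => (Complex.exp (Complex.I * (ξ j : ℂ)) * F (z - e d j) j - F z j) *
      (starRingEnd ℂ) (v z)) = fun z =>
      ((fun z => Complex.exp (Complex.I * (ξ j : ℂ)) *
        (F z j * (starRingEnd ℂ) (v (z + e d j)))) ∘ Equiv.subRight (e d j)) z -
        F z j * (starRingEnd ℂ) (v z) := by
    funext z
    simp only [Function.comp_apply, Equiv.subRight_apply, sub_add_cancel]
    ring
  rw [h7]
  exact h6

lemma L2Z.summable_norm_sq {d : ℕ} (V : L2Z d) : Summable fun z => ‖V z‖ ^ 2 := by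
  have h := (lp.memℓp V).summable (by norm_num)
  simpa using h

lemma L2Z.norm_sq_eq_tsum {d : ℕ} (V : L2Z d) : ‖V‖ ^ 2 = ∑' z, ‖V z‖ ^ 2 := by
  have h := lp.norm_rpow_eq_tsum (p := 2) (by norm_num) V
  simpa using h

/-- The energy inequality on a time slice. -/
lemma slice_energy_le {d : ℕ} {Lam : ℝ} (ξ : Fin d → ℝ) (η : ℂ)
    {F : (Fin d → ℤ) → Fin d → ℂ} (hF : Summable fun z => ∑ j, ‖F z j‖ ^ 2) (V W : L2Z d)
    (h : ∀ z, (1 / (Lam : ℂ)) * (η * V z - W z) + tDiv ξ (tGrad ξ V) z = tDiv ξ F z) :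
    2 * η.re / Lam * ‖V‖ ^ 2 + ∑' z, ∑ j, ‖tGrad ξ V z j‖ ^ 2 ≤
      ∑' z, ∑ j, ‖F z j‖ ^ 2 + 1 / Lam * (2 * (inner ℂ V W).re) := by
  have hV := L2Z.summable_norm_sq V
  have hFj : ∀ j, Summable fun z => ‖F z j‖ ^ 2 := fun j =>
    Summable.of_nonneg_of_le (fun _ => by positivity)
      (fun z => Finset.single_le_sum (f := fun j => ‖F z j‖ ^ 2)
        (fun _ _ => by positivity) (Finset.mem_univ j)) hF
  have hGj := summable_norm_tGrad_sq ξ hV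
  have hG : Summable fun z => ∑ j, ‖tGrad ξ V z j‖ ^ 2 := summable_sum fun j _ => hGj j
  have hS := hasSum_tDiv_mul_conj ξ hFj hV
  have hT := hasSum_tDiv_mul_conj ξ hGj hV
  have hVV : HasSum (fun z => V z * (starRingEnd ℂ) (V z)) (inner ℂ V V) := by
    exact lp.hasSum_inner (𝕜 := ℂ) V V
  have hVW : HasSum (fun z => W z * (starRingEnd ℂ) (V z)) (inner ℂ V W) := by
    exact lp.hasSum_inner (𝕜 := ℂ) V W
  have hL := (((hVV.mul_left η).sub hVW).mul_left (1 / (Lam : ℂ))).add hT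
  have hEq := hL.unique (hS.congr_fun fun z => by rw [← h z]; ring)
  have hSre : (∑' z, ∑ j, F z j * (starRingEnd ℂ) (tGrad ξ V z j)).re ≤
      (∑' z, ∑ j, ‖F z j‖ ^ 2 + ∑' z, ∑ j, ‖tGrad ξ V z j‖ ^ 2) / 2 := by
    have hs : Summable fun z => ∑ j, F z j * (starRingEnd ℂ) (tGrad ξ V z j) :=
      summable_sum fun j _ => summable_mul_conj (hFj j) (hGj j)
    refine hasSum_le (fun z => ?_) (Complex.hasSum_re hs.hasSum)
      ((hF.hasSum.add hG.hasSum).div_const 2)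
    rw [Complex.re_sum, ← Finset.sum_add_distrib, Finset.sum_div]
    refine Finset.sum_le_sum fun j _ => ?_
    have h1 := Complex.re_le_norm (F z j * (starRingEnd ℂ) (tGrad ξ V z j))
    rw [norm_mul, RCLike.norm_conj] at h1
    nlinarith [sq_nonneg (‖F z j‖ - ‖tGrad ξ V z j‖)]
  have hTre : (∑' z, ∑ j, tGrad ξ V z j * (starRingEnd ℂ) (tGrad ξ V z j)) =
      ((∑' z, ∑ j, ‖tGrad ξ V z j‖ ^ 2 : ℝ) : ℂ) := by
    rw [Complex.ofReal_tsum]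
    simp [Complex.mul_conj']
  rw [hTre, inner_self_eq_norm_sq_to_K] at hEq
  have hre := congrArg Complex.re hEq
  have hcast : 1 / (Lam : ℂ) * (η * ((‖V‖ : ℝ) : ℂ) ^ 2 - inner ℂ V W) =
      ((1 / Lam : ℝ) : ℂ) * (η * ((‖V‖ ^ 2 : ℝ) : ℂ) - inner ℂ V W) := by
    push_cast; rfl
  rw [Complex.add_re, Complex.ofReal_re] at hre
  erw [hcast] at hre
  rw [ Complex.re_ofReal_mul, Complex.sub_re,
    Complex.re_mul_ofReal] at hre
  rw [← hre] at hSre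
  have : 2 * η.re / Lam * ‖V‖ ^ 2 = 2 * (1 / Lam * (η.re * ‖V‖ ^ 2)) := by ring
  rw [this]
  linarith

lemma hasDerivAt_norm_sq {d : ℕ} {U : ℝ → L2Z d} {W : L2Z d} {r : ℝ} (h : HasDerivAt U W r) :
    HasDerivAt (fun r => ‖U r‖ ^ 2) (2 * (inner ℂ (U r) W).re) r := by
  have h1 : HasDerivAt (fun r => (inner ℂ (U r) (U r)).re)
      (inner ℂ (U r) W + inner ℂ W (U r)).re r :=
    Complex.reCLM.hasFDerivAt.comp_hasDerivAt r (h.inner ℂ h)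
  have h2 : (inner ℂ W (U r)).re = (inner ℂ (U r) W).re := inner_re_symm (𝕜 := ℂ) _ _
  have h3 : ∀ r, (inner ℂ (U r) (U r)).re = ‖U r‖ ^ 2 :=
    fun r => inner_self_eq_norm_sq (𝕜 := ℂ) _
  simpa only [Complex.add_re, h2, h3, ← two_mul] using h1

/-- A nonnegative family that is `L¹` on the product of a countable set and `ℝ` can be summed
before integrating. -/
lemma integral_tsum_of_nonneg {ι : Type*} [Countable ι] {g : ι → ℝ → ℝ}
    (h0 : ∀ z r, 0 ≤ g z r) (hi : ∀ z, Integrable (g z)) (hs : Summable fun z => ∫ r, g z r) :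
    (∀ᵐ r, Summable fun z => g z r) ∧ Integrable (fun r => ∑' z, g z r) ∧
      ∑' z, ∫ r, g z r = ∫ r, ∑' z, g z r := by
  have hn : ∀ z r, ‖g z r‖ = g z r := fun z r => Real.norm_of_nonneg (h0 z r)
  have hs' : Summable fun z => ∫ r, ‖g z r‖ := by simpa only [hn] using hs
  have hm : ∀ z, AEMeasurable fun r => ENNReal.ofReal (g z r) :=
    fun z => (hi z).aestronglyMeasurable.aemeasurable.ennreal_ofReal
  have hfin : ∫⁻ r, ∑' z, ENNReal.ofReal (g z r) ≠ ⊤ := by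
    rw [lintegral_tsum hm]
    simp only [← ofReal_integral_eq_lintegral_ofReal (hi _) (.of_forall (h0 _))]
    rw [← ENNReal.ofReal_tsum_of_nonneg (fun z => integral_nonneg (h0 z)) hs]
    exact ENNReal.ofReal_ne_top
  have hmt : AEMeasurable fun r => ∑' z, ENNReal.ofReal (g z r) := AEMeasurable.tsum hm
  refine ⟨?_, ?_, (hasSum_integral_of_summable_integral_norm hi hs').tsum_eq⟩
  · filter_upwards [ae_lt_top' hmt hfin] with r hr
    simpa only [ENNReal.toReal_ofReal (h0 _ _)] using ENNReal.summable_toReal hr.ne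
  · refine (integrable_toReal_of_lintegral_ne_top hmt hfin).congr (.of_forall fun r => ?_)
    simp only [ENNReal.tsum_toReal_eq fun _ => ENNReal.ofReal_ne_top,
      ENNReal.toReal_ofReal (h0 _ _)]

theorem stmt4 (d : ℕ) (hd : 1 ≤ d) (Lam : ℝ) (hLam : 0 < Lam)
    (ξ : Fin d → ℝ) (η : ℂ) (hη : 0 < η.re)
    (f : (Fin d → ℤ) → ℝ → Fin d → ℂ) (hf : VMemL2 f)
    (u : (Fin d → ℤ) → ℝ → ℂ) (hu : MemL2 u)
    -- the `ℓ²(ℤ^d)`-valued map `r ↦ u(·,r)` and its derivative `r ↦ ∂u/∂r(·,r)`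
    (U U' : ℝ → L2Z d)
    (hUu : ∀ r z, U r z = u z r)
    (hderiv : ∀ r, HasDerivAt U (U' r) r)
    (hU'cont : Continuous U')
    (hdecay_top : Tendsto (fun r => ‖U r‖) atTop (nhds 0))
    (hdecay_bot : Tendsto (fun r => ‖U r‖) atBot (nhds 0))
    -- `(1/Λ)[ η u(z,r) − ∂u/∂r(z,r) ] + ∇*_ξ ∇_ξ u(z,r) = ∇*_ξ f(z,r)`
    (hPDE : ∀ z r, (1 / (Lam : ℂ)) * (η * u z r - U' r z)
        + tDiv ξ (fun x => tGrad ξ (fun z' => u z' r) x) z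
      = tDiv ξ (fun x => f x r) z) :
    (η.re / Lam) * sqNorm u + tGradSqNorm ξ u ≤ vSqNorm f := by
  have hUu' : ∀ r, (U r : (Fin d → ℤ) → ℂ) = fun z => u z r := fun r => funext (hUu r)
  have hcontU : Continuous U := continuous_iff_continuousAt.mpr fun r => (hderiv r).continuousAt
  have hcontu : ∀ z, Continuous (u z) := fun z => by
    have h1 : Continuous fun r => (U r : (Fin d → ℤ) → ℂ) z :=
      (continuous_apply z).comp ((lp.uniformContinuous_coe (p := 2)).continuous.comp hcontU)
    simpa only [hUu] using h1
  have hgi : ∀ j z, Integrable fun r => ‖tGrad ξ (fun z' => u z' r) z j‖ ^ 2 := fun j z => by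
    refine (((hu.1 (z + e d j)).add (hu.1 z)).const_mul 2).mono' ?_ (.of_forall fun r => ?_)
    · refine Continuous.aestronglyMeasurable ?_
      exact (((continuous_const.mul (hcontu _)).sub (hcontu _)).norm).pow 2
    · rw [Real.norm_of_nonneg (by positivity)]
      exact norm_tGrad_sq_le ξ _ z j
  have hgs : ∀ j, Summable fun z => ∫ r, ‖tGrad ξ (fun z' => u z' r) z j‖ ^ 2 := fun j => by
    have hs := summable_shift (e d j) hu.2
    refine Summable.of_nonneg_of_le (fun _ => by positivity) (fun z => ?_)
      ((hs.add hu.2).mul_left 2)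
    rw [← integral_add (hu.1 _) (hu.1 _), ← integral_const_mul]
    exact integral_mono (hgi j z) (((hu.1 (z + e d j)).add (hu.1 z)).const_mul 2)
      fun r => norm_tGrad_sq_le ξ _ z j
  obtain ⟨-, hNi, hN⟩ := integral_tsum_of_nonneg (fun z r => by positivity) hu.1 hu.2
  obtain ⟨hFs, hFi, hF⟩ := integral_tsum_of_nonneg (fun z r => by positivity) hf.1 hf.2
  obtain ⟨-, hGi, hG⟩ := integral_tsum_of_nonneg
    (g := fun z r => ∑ j, ‖tGrad ξ (fun z' => u z' r) z j‖ ^ 2) (fun z r => by positivity)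
    (fun z => integrable_finsetSum _ fun j _ => hgi j z)
    (by
      simp only [integral_finsetSum _ fun j _ => hgi j _]
      exact summable_sum fun j _ => hgs j)
  have hnorm : ∀ r, ∑' z, ‖u z r‖ ^ 2 = ‖U r‖ ^ 2 := fun r => by
    rw [L2Z.norm_sq_eq_tsum, hUu']
  simp only [hnorm] at hNi hN
  set A : ℝ → ℝ := fun r => 2 * (inner ℂ (U r) (U' r)).re with hA
  have hAc : Continuous A := by fun_prop
  set L : ℝ → ℝ := fun r =>
    2 * η.re / Lam * ‖U r‖ ^ 2 + ∑' z, ∑ j, ‖tGrad ξ (fun z' => u z' r) z j‖ ^ 2 with hL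
  have hLi : Integrable L := (hNi.const_mul _).add hGi
  have hpt : ∀ᵐ r, L r ≤ ∑' z, ∑ j, ‖f z r j‖ ^ 2 + 1 / Lam * A r := by
    filter_upwards [hFs] with r hr
    have := slice_energy_le (Lam := Lam) ξ η hr (U r) (U' r) (fun z => by
      rw [hUu']; exact hPDE z r)
    rwa [hUu'] at this
  have hle : ∀ R : ℝ, 0 ≤ R → ∫ r in (-R)..R, L r ≤
      (∫ r in (-R)..R, ∑' z, ∑ j, ‖f z r j‖ ^ 2) + 1 / Lam * (‖U R‖ ^ 2 - ‖U (-R)‖ ^ 2) := by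
    intro R hR
    rw [← intervalIntegral.integral_eq_sub_of_hasDerivAt (f' := A)
      (fun r _ => hasDerivAt_norm_sq (hderiv r)) (hAc.intervalIntegrable _ _),
      ← intervalIntegral.integral_const_mul, ← intervalIntegral.integral_add
        hFi.intervalIntegrable ((hAc.intervalIntegrable _ _).const_mul _)]
    exact intervalIntegral.integral_mono_ae (by linarith) hLi.intervalIntegrable
      (hFi.intervalIntegrable.add ((hAc.intervalIntegrable _ _).const_mul _)) hpt
  have hlimL := intervalIntegral_tendsto_integral hLi tendsto_neg_atTop_atBot tendsto_id
  have hlimF := intervalIntegral_tendsto_integral hFi tendsto_neg_atTop_atBot tendsto_id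
  have hlimU : Tendsto (fun R => 1 / Lam * (‖U R‖ ^ 2 - ‖U (-R)‖ ^ 2)) atTop (nhds 0) := by
    simpa using ((hdecay_top.pow 2).sub
      ((hdecay_bot.comp tendsto_neg_atTop_atBot).pow 2)).const_mul (1 / Lam)
  have hfin := le_of_tendsto_of_tendsto hlimL (hlimF.add hlimU)
    ((eventually_ge_atTop 0).mono hle)
  rw [integral_add (hNi.const_mul _) hGi, integral_const_mul, ← hN, ← hG, add_zero, ← hF] at hfin
  have hpos : 0 ≤ η.re / Lam * sqNorm u :=
    mul_nonneg (by positivity) (tsum_nonneg fun z => integral_nonneg fun r => by positivity)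
  have hfin' : 2 * η.re / Lam * sqNorm u + tGradSqNorm ξ u ≤ vSqNorm f := hfin
  have : 2 * η.re / Lam * sqNorm u = 2 * (η.re / Lam * sqNorm u) := by ring
  linarith

end Stmt4
end
end

section
/- Let d ≥ 1 and Λ > 0. There exist constants C₁ > 0 and C₂ > 0 depending only on d with the following property: let η ∈ ℂ with 0 < Re η ≤ Λ and ξ ∈ ℂ^d with |Im ξ| ≤ C₁ √(Re η / Λ); let f ∈ L²(ℤ^d × ℝ, ℂ^d) and let u : ℤ^d × ℝ → ℂ be such that u ∈ L²(ℤ^d × ℝ), the ℓ²(ℤ^d)-valued map r ↦ u(·,r) is continuously differentiable with derivative r ↦ ∂u/∂r(·,r), ‖u(·,r)‖_{ℓ²(ℤ^d)} → 0 as r → ±∞, and u satisfies (1/Λ)[ η u(z,r) − ∂u/∂r(z,r) ] + ∇*_ξ ∇_ξ u(z,r) = ∇*_ξ f(z,r) for all z ∈ ℤ^d and r ∈ ℝ. Then (Re η / 2Λ) ‖u‖₂² + ‖∇_ξ u‖₂² ≤ [ 1 + C₂ |Im ξ|² / (Re η / Λ) ] ‖f‖₂². -/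
open MeasureTheory Real Filter
open scoped ENNReal BigOperators

noncomputable section

namespace Stmt6

/-- The `j`-th standard basis vector of `ℤ^d`. -/
def e (d : ℕ) (j : Fin d) : Fin d → ℤ := fun k => if k = j then 1 else 0

/-- Twisted gradient `∇_{j,ξ}u(z) = e^{−i e_j·ξ} u(z+e_j) − u(z)` for complex `ξ`. -/
def tGrad {d : ℕ} (ξ : Fin d → ℂ) (u : (Fin d → ℤ) → ℂ) (z : Fin d → ℤ) : Fin d → ℂ :=
  fun j => Complex.exp (-(Complex.I * ξ j)) * u (z + e d j) - u z

/-- Twisted divergence `∇*_ξ F(z) = Σ_j [e^{i e_j·ξ} F_j(z−e_j) − F_j(z)]` for complex `ξ`. -/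
def tDiv {d : ℕ} (ξ : Fin d → ℂ) (F : (Fin d → ℤ) → Fin d → ℂ) (z : Fin d → ℤ) : ℂ :=
  ∑ j, (Complex.exp (Complex.I * ξ j) * F (z - e d j) j - F z j)

/-- Euclidean norm of the imaginary part of `ξ ∈ ℂ^d`. -/
def imNorm {d : ℕ} (ξ : Fin d → ℂ) : ℝ := Real.sqrt (∑ j, (ξ j).im ^ 2)

/-- Squared `L²(ℤ^d × ℝ)` norm `‖u‖₂²`. -/
def sqNorm {d : ℕ} (u : (Fin d → ℤ) → ℝ → ℂ) : ℝ := ∑' z, ∫ r, ‖u z r‖ ^ 2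

/-- Squared `L²(ℤ^d × ℝ, ℂ^d)` norm `‖f‖₂²` of a vector-valued function. -/
def vSqNorm {d : ℕ} (f : (Fin d → ℤ) → ℝ → Fin d → ℂ) : ℝ :=
  ∑' z, ∫ r, ∑ j, ‖f z r j‖ ^ 2

/-- Squared `L²` norm of the twisted gradient `‖∇_ξ u‖₂²`. -/
def tGradSqNorm {d : ℕ} (ξ : Fin d → ℂ) (u : (Fin d → ℤ) → ℝ → ℂ) : ℝ :=
  ∑' z, ∫ r, ∑ j, ‖tGrad ξ (fun z' => u z' r) z j‖ ^ 2

/-- Membership in `L²(ℤ^d × ℝ)`. -/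
def MemL2 {d : ℕ} (u : (Fin d → ℤ) → ℝ → ℂ) : Prop :=
  (∀ z, Integrable fun r => ‖u z r‖ ^ 2) ∧ Summable fun z => ∫ r, ‖u z r‖ ^ 2

/-- Membership in `L²(ℤ^d × ℝ, ℂ^d)`. -/
def VMemL2 {d : ℕ} (f : (Fin d → ℤ) → ℝ → Fin d → ℂ) : Prop :=
  (∀ z, Integrable fun r => ∑ j, ‖f z r j‖ ^ 2) ∧
    Summable fun z => ∫ r, ∑ j, ‖f z r j‖ ^ 2

/-- `ℓ²(ℤ^d)`. -/
abbrev L2Z (d : ℕ) := lp (fun _ : Fin d → ℤ => ℂ) 2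

/-- A nonnegative series with summable integrals converges almost everywhere. -/
theorem ae_summable_and_integrable_tsum {ι : Type*} [Countable ι] {F : ι → ℝ → ℝ}
    (h0 : ∀ i r, 0 ≤ F i r) (hi : ∀ i, Integrable (F i)) (hs : Summable fun i => ∫ r, F i r) :
    (∀ᵐ r, Summable fun i => F i r) ∧ Integrable fun r => ∑' i, F i r := by
  have hm : ∀ i, AEMeasurable fun r => ENNReal.ofReal (F i r) :=
    fun i => (hi i).aemeasurable.ennreal_ofReal
  have hfin : ∫⁻ r, ∑' i, ENNReal.ofReal (F i r) ≠ ∞ := by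
    rw [lintegral_tsum hm]
    simp_rw [← ofReal_integral_eq_lintegral_ofReal (hi _) (ae_of_all _ (h0 _))]
    exact hs.tsum_ofReal_ne_top
  refine ⟨?_, ?_⟩
  · filter_upwards [ae_lt_top' (AEMeasurable.tsum hm) hfin] with r hr
    simpa [ENNReal.toReal_ofReal (h0 _ r)] using ENNReal.summable_toReal hr.ne
  · refine (integrable_toReal_of_lintegral_ne_top (AEMeasurable.tsum hm) hfin).congr
      (ae_of_all _ fun r => ?_)
    simp [ENNReal.tsum_toReal_eq, ENNReal.toReal_ofReal (h0 _ r)]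

theorem tsum_integral_eq_integral_tsum {ι : Type*} [Countable ι] {F : ι → ℝ → ℝ}
    (h0 : ∀ i r, 0 ≤ F i r) (hi : ∀ i, Integrable (F i)) (hs : Summable fun i => ∫ r, F i r) :
    ∑' i, ∫ r, F i r = ∫ r, ∑' i, F i r := by
  refine integral_tsum_of_summable_integral_norm hi ?_
  simpa only [Real.norm_of_nonneg (h0 _ _)] using hs

theorem L2Z.hasSum_norm_sq {d : ℕ} (a : L2Z d) : HasSum (fun z => ‖a z‖ ^ 2) (‖a‖ ^ 2) := by
  simpa using lp.hasSum_norm (p := 2) (by simp) a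

theorem memℓp_two_iff {d : ℕ} {a : (Fin d → ℤ) → ℂ} :
    Memℓp a 2 ↔ Summable fun z => ‖a z‖ ^ 2 := by
  simpa using memℓp_gen_iff (p := 2) (f := a) (by simp)

/-- Translation of an element of `ℓ²(ℤ^d)` by `k`. -/
def shift {d : ℕ} (k : Fin d → ℤ) (a : L2Z d) : L2Z d :=
  ⟨fun z => a (z + k), memℓp_two_iff.2 <|
    (L2Z.hasSum_norm_sq a).summable.comp_injective (add_left_injective k)⟩

@[simp]
theorem shift_apply {d : ℕ} (k : Fin d → ℤ) (a : L2Z d) (z : Fin d → ℤ) :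
    shift k a z = a (z + k) := rfl

theorem norm_shift {d : ℕ} (k : Fin d → ℤ) (a : L2Z d) : ‖shift k a‖ = ‖a‖ := by
  have h : HasSum (fun z => ‖shift k a z‖ ^ 2) (‖a‖ ^ 2) :=
    (Equiv.addRight k).hasSum_iff (f := fun z => ‖a z‖ ^ 2) |>.2 (L2Z.hasSum_norm_sq a)
  have h' := (L2Z.hasSum_norm_sq (shift k a)).unique h
  exact (pow_left_inj₀ (norm_nonneg _) (norm_nonneg _) two_ne_zero).1 h'

theorem inner_shift_neg {d : ℕ} (k : Fin d → ℤ) (a b : L2Z d) :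
    inner ℂ a (shift (-k) b) = inner ℂ (shift k a) b := by
  rw [lp.inner_eq_tsum, lp.inner_eq_tsum, ← (Equiv.addRight k).tsum_eq]
  simp

/-- The `j`-th component of the twisted gradient as a map on `ℓ²(ℤ^d)`. -/
def gradL2 {d : ℕ} (ξ : Fin d → ℂ) (a : L2Z d) (j : Fin d) : L2Z d :=
  Complex.exp (-(Complex.I * ξ j)) • shift (e d j) a - a

theorem gradL2_apply {d : ℕ} (ξ : Fin d → ℂ) (a : L2Z d) (j : Fin d) (z : Fin d → ℤ) :
    gradL2 ξ a j z = tGrad ξ a z j := rfl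

/-- The twisted divergence on `ℓ²(ℤ^d)`. -/
def divL2 {d : ℕ} (ξ : Fin d → ℂ) (F : Fin d → L2Z d) : L2Z d :=
  ∑ j, (Complex.exp (Complex.I * ξ j) • shift (-e d j) (F j) - F j)

theorem divL2_apply {d : ℕ} (ξ : Fin d → ℂ) (F : Fin d → L2Z d) (z : Fin d → ℤ) :
    divL2 ξ F z = tDiv ξ (fun x j => F j x) z := by
  rw [divL2, lp.coeFn_sum, Finset.sum_apply]
  simp only [tDiv, sub_eq_add_neg z]
  rfl

/-- The adjoint of `∇*_ξ` is `∇_{ξ̄}`. -/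
theorem inner_divL2 {d : ℕ} (ξ : Fin d → ℂ) (a : L2Z d) (F : Fin d → L2Z d) :
    inner ℂ a (divL2 ξ F) =
      ∑ j, inner ℂ (gradL2 (fun j => (starRingEnd ℂ) (ξ j)) a j) (F j) := by
  simp only [divL2, inner_sum, inner_sub_right, inner_smul_right, gradL2, inner_sub_left,
    inner_smul_left, inner_shift_neg, ← Complex.exp_conj]
  simp

theorem norm_exp_sub_exp_conj_le {w : ℂ} (hw : |w.im| ≤ 1) :
    ‖Complex.exp (-(Complex.I * (starRingEnd ℂ) w)) - Complex.exp (-(Complex.I * w))‖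
      ≤ 4 * |w.im| := by
  have h1 : -(Complex.I * (starRingEnd ℂ) w) = ((-w.im : ℝ) : ℂ) + ((-w.re : ℝ) : ℂ) * Complex.I := by
    apply Complex.ext <;> simp
  have h2 : -(Complex.I * w) = ((w.im : ℝ) : ℂ) + ((-w.re : ℝ) : ℂ) * Complex.I := by
    apply Complex.ext <;> simp
  rw [h1, h2, Complex.exp_add, Complex.exp_add, ← sub_mul, norm_mul, Complex.norm_exp_ofReal_mul_I,
    mul_one, ← Complex.ofReal_exp, ← Complex.ofReal_exp, ← Complex.ofReal_sub, Complex.norm_real,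
    Real.norm_eq_abs]
  have ha := Real.abs_exp_sub_one_le hw
  have hb := Real.abs_exp_sub_one_le (x := -w.im) (by rwa [abs_neg])
  rw [abs_neg] at hb
  rw [abs_le] at *
  constructor <;> linarith

theorem norm_gradL2_conj_sub_le {d : ℕ} {ξ : Fin d → ℂ} {j : Fin d} (hξ : |(ξ j).im| ≤ 1)
    (a : L2Z d) :
    ‖gradL2 (fun j => (starRingEnd ℂ) (ξ j)) a j - gradL2 ξ a j‖ ≤ 4 * |(ξ j).im| * ‖a‖ := by
  rw [gradL2, gradL2, sub_sub_sub_cancel_right, ← sub_smul, norm_smul, norm_shift]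
  gcongr
  exact norm_exp_sub_exp_conj_le hξ

theorem two_mul_re_inner_add_sub_le {E : Type*} [NormedAddCommGroup E] [InnerProductSpace ℂ E]
    (g h φ : E) {t : ℝ} (ht : ‖h‖ ≤ t) :
    2 * (inner ℂ (g + h) (φ - g)).re ≤ -‖g‖ ^ 2 + ‖φ‖ ^ 2 + 4 * (t * ‖φ‖) + t ^ 2 := by
  have h1 : (inner ℂ g φ).re ≤ ‖g‖ * ‖φ‖ := re_inner_le_norm (𝕜 := ℂ) g φ
  have h2 : (inner ℂ h φ).re ≤ ‖h‖ * ‖φ‖ := re_inner_le_norm (𝕜 := ℂ) h φ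
  have h3 : -(inner ℂ h g).re ≤ ‖h‖ * ‖g‖ := by
    simpa using re_inner_le_norm (𝕜 := ℂ) (-h) g
  have h4 : (inner ℂ g g).re = ‖g‖ ^ 2 := (norm_sq_eq_re_inner (𝕜 := ℂ) g).symm
  have h5 := mul_le_mul_of_nonneg_right ht (norm_nonneg φ)
  have h6 := mul_le_mul_of_nonneg_right ht (norm_nonneg g)
  simp only [inner_add_left, inner_sub_right, Complex.add_re, Complex.sub_re]
  nlinarith [sq_nonneg (‖g‖ - t - ‖φ‖)]

/-- The energy estimate for `∇*_ξ (φ - ∇_ξ v)` tested against `v`. -/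
theorem two_mul_re_inner_divL2_le {d : ℕ} {ξ : Fin d → ℂ} {m : ℝ} (hm : 0 < m) (hm1 : m ≤ 1)
    (hξ : imNorm ξ ≤ 1 / 8 * Real.sqrt m) (v : L2Z d) (φ : Fin d → L2Z d) :
    2 * (inner ℂ v (divL2 ξ fun j => φ j - gradL2 ξ v j)).re
      ≤ -∑ j, ‖gradL2 ξ v j‖ ^ 2 + (1 + 64 * imNorm ξ ^ 2 / m) * ∑ j, ‖φ j‖ ^ 2
        + 3 / 2 * m * ‖v‖ ^ 2 := by
  have hb : imNorm ξ ^ 2 = ∑ j, (ξ j).im ^ 2 :=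
    Real.sq_sqrt (Finset.sum_nonneg fun _ _ => sq_nonneg _)
  have hbm : imNorm ξ ^ 2 ≤ m / 64 := by
    calc imNorm ξ ^ 2 ≤ (1 / 8 * Real.sqrt m) ^ 2 := by
          gcongr
          exact Real.sqrt_nonneg _
      _ = m / 64 := by rw [mul_pow, Real.sq_sqrt hm.le]; ring
  have hj : ∀ j, |(ξ j).im| ≤ 1 := fun j => by
    have : (ξ j).im ^ 2 ≤ ∑ j, (ξ j).im ^ 2 :=
      Finset.single_le_sum (f := fun j => (ξ j).im ^ 2) (fun _ _ => sq_nonneg _)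
        (Finset.mem_univ j)
    exact (sq_le_one_iff_abs_le_one _).1 (by linarith)
  set T := ∑ j, |(ξ j).im| * ‖φ j‖ with hT
  have hTsq : T ^ 2 ≤ imNorm ξ ^ 2 * ∑ j, ‖φ j‖ ^ 2 := by
    simpa [hb] using
      Finset.sum_mul_sq_le_sq_mul_sq Finset.univ (fun j => |(ξ j).im|) (fun j => ‖φ j‖)
  have hsum : 2 * (inner ℂ v (divL2 ξ fun j => φ j - gradL2 ξ v j)).re
      ≤ -∑ j, ‖gradL2 ξ v j‖ ^ 2 + ∑ j, ‖φ j‖ ^ 2 + 16 * ‖v‖ * T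
        + 16 * imNorm ξ ^ 2 * ‖v‖ ^ 2 := by
    rw [inner_divL2, Complex.re_sum, hb, hT]
    simp only [Finset.mul_sum, Finset.sum_mul, ← Finset.sum_neg_distrib, ← Finset.sum_add_distrib]
    refine Finset.sum_le_sum fun j _ => ?_
    have := two_mul_re_inner_add_sub_le (gradL2 ξ v j) _ (φ j) (norm_gradL2_conj_sub_le (hj j) v)
    rw [add_sub_cancel] at this
    refine this.trans_eq ?_
    rw [mul_pow, mul_pow, sq_abs]
    ring
  have hTm : 16 * ‖v‖ * T ≤ m * ‖v‖ ^ 2 + 64 * T ^ 2 / m := by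
    have : m * ‖v‖ ^ 2 + 64 * T ^ 2 / m - 16 * ‖v‖ * T = (m * ‖v‖ - 8 * T) ^ 2 / m := by
      field_simp; ring
    have h0 : 0 ≤ (m * ‖v‖ - 8 * T) ^ 2 / m := by positivity
    linarith
  have hTm' : 64 * T ^ 2 / m ≤ 64 * imNorm ξ ^ 2 / m * ∑ j, ‖φ j‖ ^ 2 := by
    rw [div_mul_eq_mul_div, mul_assoc]
    gcongr
  nlinarith [mul_le_mul_of_nonneg_right hbm (sq_nonneg ‖v‖)]

/-- The energy estimate at a fixed time `r`, with `v = u(·,r)` and `w = ∂u/∂r(·,r)`. -/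
theorem energy_estimate {d : ℕ} {Lam : ℝ} (hL : 0 < Lam) {η : ℂ} (hη : 0 < η.re)
    (hηL : η.re ≤ Lam) {ξ : Fin d → ℂ} (hξ : imNorm ξ ≤ 1 / 8 * Real.sqrt (η.re / Lam))
    {φ : (Fin d → ℤ) → Fin d → ℂ} (hφ : Summable fun z => ∑ j, ‖φ z j‖ ^ 2) (v w : L2Z d)
    (h : ∀ z, (1 / (Lam : ℂ)) * (η * v z - w z) + tDiv ξ (fun x => tGrad ξ v x) z = tDiv ξ φ z) :
    η.re / (2 * Lam) * ‖v‖ ^ 2 + ∑' z, ∑ j, ‖tGrad ξ v z j‖ ^ 2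
      ≤ (1 + 64 * imNorm ξ ^ 2 / (η.re / Lam)) * ∑' z, ∑ j, ‖φ z j‖ ^ 2
        + 2 * (inner ℂ v w).re / Lam := by
  have hφj : ∀ j, Summable fun z => ‖φ z j‖ ^ 2 := fun j =>
    hφ.of_nonneg_of_le (fun _ => sq_nonneg _) fun z =>
      Finset.single_le_sum (f := fun j => ‖φ z j‖ ^ 2) (fun _ _ => sq_nonneg _)
        (Finset.mem_univ j)
  let Φ : Fin d → L2Z d := fun j => ⟨fun z => φ z j, memℓp_two_iff.2 (hφj j)⟩
  have hΦ : ∑' z, ∑ j, ‖φ z j‖ ^ 2 = ∑ j, ‖Φ j‖ ^ 2 :=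
    (hasSum_sum fun j _ => L2Z.hasSum_norm_sq (Φ j)).tsum_eq
  have hG : ∑' z, ∑ j, ‖tGrad ξ v z j‖ ^ 2 = ∑ j, ‖gradL2 ξ v j‖ ^ 2 :=
    (hasSum_sum fun j _ => L2Z.hasSum_norm_sq (gradL2 ξ v j)).tsum_eq
  have heq : divL2 ξ (fun j => Φ j - gradL2 ξ v j) = (1 / (Lam : ℂ)) • (η • v - w) := by
    ext z
    rw [divL2_apply]
    have hz : (1 / (Lam : ℂ)) * (η * v z - w z) = _ := eq_sub_of_add_eq (h z)
    change _ = (1 / (Lam : ℂ)) * (η * v z - w z)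
    rw [hz, tDiv, tDiv, tDiv, ← Finset.sum_sub_distrib]
    refine Finset.sum_congr rfl fun j _ => ?_
    simp only [lp.coeFn_sub, Pi.sub_apply, gradL2_apply, Φ]
    ring
  have hre : (inner ℂ v (divL2 ξ fun j => Φ j - gradL2 ξ v j)).re
      = η.re / Lam * ‖v‖ ^ 2 - (inner ℂ v w).re / Lam := by
    rw [heq, inner_smul_right, inner_sub_right, inner_smul_right, inner_self_eq_norm_sq_to_K,
      show (1 / (Lam : ℂ)) = ((1 / Lam : ℝ) : ℂ) by push_cast; rfl, Complex.re_ofReal_mul,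
      Complex.sub_re]
    have : (η * (((‖v‖ : ℝ) : ℂ)) ^ 2).re = η.re * ‖v‖ ^ 2 := by
      rw [← Complex.ofReal_pow, Complex.re_mul_ofReal]
    erw [this]
    ring
  have hmain := two_mul_re_inner_divL2_le (div_pos hη hL) ((div_le_one hL).2 hηL) hξ v Φ
  rw [hre] at hmain
  rw [hΦ, hG]
  have : η.re / (2 * Lam) = η.re / Lam / 2 := by field_simp
  rw [this, mul_div_assoc 2]
  linarith

theorem L2Z.hasDerivAt_norm_sq {d : ℕ} {U : ℝ → L2Z d} {U' : L2Z d} {r : ℝ}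
    (h : HasDerivAt U U' r) :
    HasDerivAt (fun s => ‖U s‖ ^ 2) (2 * (inner ℂ (U r) U').re) r := by
  have h1 := Complex.reCLM.hasFDerivAt.comp_hasDerivAt r (h.inner ℂ h)
  have hfun : (fun s => ‖U s‖ ^ 2) = Complex.reCLM ∘ fun s => inner ℂ (U s) (U s) :=
    funext fun s => norm_sq_eq_re_inner (𝕜 := ℂ) (U s)
  have hsymm : (inner ℂ U' (U r)).re = (inner ℂ (U r) U').re := inner_re_symm (𝕜 := ℂ) _ _
  rw [hfun]
  refine h1.congr_deriv ?_
  rw [Complex.reCLM_apply, Complex.add_re, hsymm, two_mul]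

theorem norm_mul_sub_sq_le (c a b : ℂ) :
    ‖c * a - b‖ ^ 2 ≤ 2 * ‖c‖ ^ 2 * ‖a‖ ^ 2 + 2 * ‖b‖ ^ 2 := by
  have h := norm_sub_le (c * a) b
  rw [norm_mul] at h
  have h0 := norm_nonneg (c * a - b)
  nlinarith [sq_nonneg (‖c‖ * ‖a‖ - ‖b‖), pow_le_pow_left₀ h0 h 2]

/-- The twisted gradient preserves square integrability. -/
theorem MemL2.tGrad {d : ℕ} {u : (Fin d → ℤ) → ℝ → ℂ} (hu : MemL2 u)
    (hc : ∀ z, Continuous (u z)) (ξ : Fin d → ℂ) :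
    VMemL2 fun z r => Stmt6.tGrad ξ (fun z' => u z' r) z := by
  have hb : ∀ j z r, ‖Stmt6.tGrad ξ (fun z' => u z' r) z j‖ ^ 2 ≤
      2 * ‖Complex.exp (-(Complex.I * ξ j))‖ ^ 2 * ‖u (z + e d j) r‖ ^ 2 + 2 * ‖u z r‖ ^ 2 :=
    fun j z r => norm_mul_sub_sq_le _ _ _
  have hi : ∀ j z, Integrable fun r =>
      2 * ‖Complex.exp (-(Complex.I * ξ j))‖ ^ 2 * ‖u (z + e d j) r‖ ^ 2 + 2 * ‖u z r‖ ^ 2 :=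
    fun j z => ((hu.1 _).const_mul _).add ((hu.1 z).const_mul 2)
  have hint : ∀ j z, Integrable fun r => ‖Stmt6.tGrad ξ (fun z' => u z' r) z j‖ ^ 2 := by
    intro j z
    refine (hi j z).mono' ?_ (ae_of_all _ fun r => ?_)
    · refine Continuous.aestronglyMeasurable ?_
      have h1 := hc z
      have h2 := hc (z + e d j)
      unfold Stmt6.tGrad
      fun_prop
    · rw [Real.norm_of_nonneg (sq_nonneg _)]
      exact hb j z r
  refine ⟨fun z => integrable_finsetSum _ fun j _ => hint j z, ?_⟩
  simp_rw [integral_finsetSum _ fun j _ => hint j _]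
  refine summable_sum fun j _ => ?_
  have hs : Summable fun z => 2 * ‖Complex.exp (-(Complex.I * ξ j))‖ ^ 2 *
      (∫ r, ‖u (z + e d j) r‖ ^ 2) + 2 * ∫ r, ‖u z r‖ ^ 2 :=
    (((Equiv.addRight (e d j)).summable_iff.2 hu.2).mul_left _).add (hu.2.mul_left 2)
  refine hs.of_nonneg_of_le (fun z => integral_nonneg fun r => sq_nonneg _) fun z => ?_
  rw [← integral_const_mul, ← integral_const_mul,
    ← integral_add ((hu.1 _).const_mul _) ((hu.1 z).const_mul 2)]
  exact integral_mono (hint j z) (hi j z) (hb j z)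

/-- If `Φ` is integrable, `N` vanishes at `±∞` and `N' ≤ Φ` almost everywhere, then `0 ≤ ∫ Φ`. -/
theorem integral_nonneg_of_deriv_le {Φ N N' : ℝ → ℝ} (hΦ : Integrable Φ)
    (hN : ∀ r, HasDerivAt N (N' r) r) (hc : Continuous N') (hle : ∀ᵐ r, N' r ≤ Φ r)
    (htop : Tendsto N atTop (nhds 0)) (hbot : Tendsto N atBot (nhds 0)) :
    0 ≤ ∫ r, Φ r := by
  have h1 : Tendsto (fun R : ℝ => ∫ r in (-R)..R, Φ r) atTop (nhds (∫ r, Φ r)) :=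
    intervalIntegral_tendsto_integral hΦ tendsto_neg_atTop_atBot tendsto_id
  have h2 : Tendsto (fun R : ℝ => N R - N (-R)) atTop (nhds 0) := by
    simpa using htop.sub (hbot.comp tendsto_neg_atTop_atBot)
  refine le_of_tendsto_of_tendsto h2 h1 ?_
  filter_upwards [eventually_ge_atTop 0] with R hR
  have hI := hc.intervalIntegrable (μ := volume) (-R) R
  rw [← intervalIntegral.integral_eq_sub_of_hasDerivAt (fun r _ => hN r) hI]
  exact intervalIntegral.integral_mono_ae (by linarith) hI hΦ.intervalIntegrable hle

theorem stmt6 (d : ℕ) (hd : 1 ≤ d) :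
    ∃ C₁ > (0 : ℝ), ∃ C₂ > (0 : ℝ),
      ∀ (Lam : ℝ), 0 < Lam →
      ∀ (η : ℂ), 0 < η.re → η.re ≤ Lam →
      ∀ (ξ : Fin d → ℂ), imNorm ξ ≤ C₁ * Real.sqrt (η.re / Lam) →
      ∀ (f : (Fin d → ℤ) → ℝ → Fin d → ℂ), VMemL2 f →
      ∀ (u : (Fin d → ℤ) → ℝ → ℂ), MemL2 u →
      ∀ (U U' : ℝ → L2Z d),
        (∀ r z, U r z = u z r) →
        (∀ r, HasDerivAt U (U' r) r) →
        Continuous U' →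
        Tendsto (fun r => ‖U r‖) atTop (nhds 0) →
        Tendsto (fun r => ‖U r‖) atBot (nhds 0) →
        -- `(1/Λ)[ η u(z,r) − ∂u/∂r(z,r) ] + ∇*_ξ ∇_ξ u(z,r) = ∇*_ξ f(z,r)`
        (∀ z r, (1 / (Lam : ℂ)) * (η * u z r - U' r z)
            + tDiv ξ (fun x => tGrad ξ (fun z' => u z' r) x) z
          = tDiv ξ (fun x => f x r) z) →
        (η.re / (2 * Lam)) * sqNorm u + tGradSqNorm ξ u
          ≤ (1 + C₂ * imNorm ξ ^ 2 / (η.re / Lam)) * vSqNorm f := by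
  refine ⟨1 / 8, by norm_num, 64, by norm_num, ?_⟩
  intro Lam hL η hη hηL ξ hξ f hf u hu U U' hUu hU hU' htop hbot heq
  have hUcont : Continuous U := continuous_iff_continuousAt.2 fun r => (hU r).continuousAt
  have huc : ∀ z, Continuous (u z) := fun z => by
    have : LipschitzWith 1 fun a : L2Z d => a z := LipschitzWith.of_dist_le_mul fun a b => by
      simpa [dist_eq_norm] using lp.norm_apply_le_norm (p := 2) two_ne_zero (a - b) z
    simpa only [Function.comp_def, hUu] using this.continuous.comp hUcont
  have hg := hu.tGrad huc ξ
  have h0 : ∀ (F : (Fin d → ℤ) → ℝ → Fin d → ℂ) z r, 0 ≤ ∑ j, ‖F z r j‖ ^ 2 :=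
    fun F z r => Finset.sum_nonneg fun _ _ => sq_nonneg _
  have hnorm : ∀ r, ∑' z, ‖u z r‖ ^ 2 = ‖U r‖ ^ 2 := fun r => by
    simpa only [hUu] using (L2Z.hasSum_norm_sq (U r)).tsum_eq
  have hfi := ae_summable_and_integrable_tsum (h0 f) hf.1 hf.2
  have hgi := (ae_summable_and_integrable_tsum (h0 _) hg.1 hg.2).2
  have hui := (ae_summable_and_integrable_tsum (fun _ _ => sq_nonneg _) hu.1 hu.2).2
  have hfe : vSqNorm f = _ := tsum_integral_eq_integral_tsum (h0 f) hf.1 hf.2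
  have hge : tGradSqNorm ξ u = _ := tsum_integral_eq_integral_tsum (h0 _) hg.1 hg.2
  have hue : sqNorm u = _ := tsum_integral_eq_integral_tsum (fun _ _ => sq_nonneg _) hu.1 hu.2
  have hΦ := ((hui.const_mul (η.re / (2 * Lam))).add hgi).sub
    (hfi.2.const_mul (1 + 64 * imNorm ξ ^ 2 / (η.re / Lam)))
  have hsq : ∀ l, Tendsto (fun r => ‖U r‖) l (nhds 0) →
      Tendsto (fun r => -(‖U r‖ ^ 2 / Lam)) l (nhds 0) := fun l hl => by
    simpa using ((hl.pow 2).div_const Lam).neg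
  have key := integral_nonneg_of_deriv_le hΦ.neg
    (fun r => ((L2Z.hasDerivAt_norm_sq (hU r)).div_const Lam).neg) ?_ ?_ (hsq _ htop) (hsq _ hbot)
  · rw [integral_neg', integral_sub' ((hui.const_mul _).add hgi) (hfi.2.const_mul _),
      integral_add' (hui.const_mul _) hgi, integral_const_mul, integral_const_mul,
      ← hfe, ← hge, ← hue] at key
    linarith
  · have : Continuous fun r => (inner ℂ (U r) (U' r)).re :=
      Complex.continuous_re.comp (hUcont.inner hU')
    fun_prop
  · filter_upwards [hfi.1] with r hr
    have hUr : (fun z => u z r) = U r := funext fun z => (hUu r z).symm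
    have := energy_estimate hL hη hηL hξ hr (U r) (U' r) (fun z => by
      rw [← heq z r, hUr, hUu])
    simp only [Pi.neg_apply, Pi.sub_apply, Pi.add_apply]
    rw [hnorm, hUr]
    linarith

end Stmt6
end
end

section
/- Let d ≥ 1, 0 < λ ≤ Λ and η > 0. Let a : ℤ^d × ℝ → ℝ^{d×d} be measurable with each a(z,s) a symmetric matrix satisfying λ I_d ≤ a(z,s) ≤ Λ I_d as quadratic forms. Let f ∈ L²(ℤ^d × ℝ, ℂ^d) and let u : ℤ^d × ℝ → ℂ be such that u ∈ L²(ℤ^d × ℝ), the ℓ²(ℤ^d)-valued map s ↦ u(·,s) is continuously differentiable with derivative s ↦ ∂u/∂s(·,s), ‖u(·,s)‖_{ℓ²(ℤ^d)} → 0 as s → ±∞, and u satisfies η u(z,s) − ∂u/∂s(z,s) + ∇*( a(·,s) ∇u(·,s) )(z) = −∇*f(z,s) for all z ∈ ℤ^d and s ∈ ℝ. Then η ‖u‖₂² + λ ‖∇u‖₂² ≤ ‖∇u‖₂ ‖f‖₂; in particular ‖∇u‖₂ ≤ ‖f‖₂ / λ. -/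
open MeasureTheory Real Filter Matrix
open scoped ENNReal BigOperators

noncomputable section

namespace Stmt7

/-- The `j`-th standard basis vector of `ℤ^d`. -/
def e (d : ℕ) (j : Fin d) : Fin d → ℤ := fun k => if k = j then 1 else 0

/-- Discrete gradient `∇u(x) j = u(x+e_j) - u(x)`. -/
def dGrad {d : ℕ} (u : (Fin d → ℤ) → ℂ) (x : Fin d → ℤ) : Fin d → ℂ :=
  fun j => u (x + e d j) - u x

/-- Discrete divergence `∇*F(x) = Σ_j [F_j(x-e_j) - F_j(x)]`. -/
def dDiv {d : ℕ} (F : (Fin d → ℤ) → Fin d → ℂ) (x : Fin d → ℤ) : ℂ :=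
  ∑ j, (F (x - e d j) j - F x j)

/-- A real matrix acting on a complex vector. -/
def matMulC {d : ℕ} (M : Matrix (Fin d) (Fin d) ℝ) (w : Fin d → ℂ) : Fin d → ℂ :=
  fun j => ∑ k, (M j k : ℂ) * w k

/-- Squared `L²(ℤ^d × ℝ)` norm `‖u‖₂²`. -/
def sqNorm {d : ℕ} (u : (Fin d → ℤ) → ℝ → ℂ) : ℝ := ∑' z, ∫ s, ‖u z s‖ ^ 2

/-- Squared `L²(ℤ^d × ℝ, ℂ^d)` norm `‖f‖₂²` of a vector-valued function. -/
def vSqNorm {d : ℕ} (f : (Fin d → ℤ) → ℝ → Fin d → ℂ) : ℝ :=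
  ∑' z, ∫ s, ∑ j, ‖f z s j‖ ^ 2

/-- Squared `L²` norm of the discrete gradient `‖∇u‖₂²`. -/
def gradSqNorm {d : ℕ} (u : (Fin d → ℤ) → ℝ → ℂ) : ℝ :=
  ∑' z, ∫ s, ∑ j, ‖dGrad (fun z' => u z' s) z j‖ ^ 2

/-- Membership in `L²(ℤ^d × ℝ)`. -/
def MemL2 {d : ℕ} (u : (Fin d → ℤ) → ℝ → ℂ) : Prop :=
  (∀ z, Integrable fun s => ‖u z s‖ ^ 2) ∧ Summable fun z => ∫ s, ‖u z s‖ ^ 2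

/-- Membership in `L²(ℤ^d × ℝ, ℂ^d)`. -/
def VMemL2 {d : ℕ} (f : (Fin d → ℤ) → ℝ → Fin d → ℂ) : Prop :=
  (∀ z, Integrable fun s => ∑ j, ‖f z s j‖ ^ 2) ∧
    Summable fun z => ∫ s, ∑ j, ‖f z s j‖ ^ 2

/-- `ℓ²(ℤ^d)`. -/
abbrev L2Z (d : ℕ) := lp (fun _ : Fin d → ℤ => ℂ) 2

lemma lintegral_tsum_ofReal_ne_top {α ι : Type*} [MeasurableSpace α] {μ : Measure α}
    [Countable ι] {F : ι → α → ℝ} (hF0 : ∀ i x, 0 ≤ F i x) (hF : ∀ i, Integrable (F i) μ)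
    (hs : Summable fun i => ∫ x, F i x ∂μ) : ∫⁻ x, ∑' i, ENNReal.ofReal (F i x) ∂μ ≠ ⊤ := by
  rw [lintegral_tsum fun i => (hF i).1.aemeasurable.ennreal_ofReal]
  simp_rw [← ofReal_integral_eq_lintegral_ofReal (hF _) (ae_of_all _ (hF0 _))]
  exact hs.tsum_ofReal_ne_top

/-- A series of nonnegative integrable functions with summable integrals is almost everywhere
summable. -/
lemma ae_summable_of_summable_integral {α ι : Type*} [MeasurableSpace α] {μ : Measure α}
    [Countable ι] {F : ι → α → ℝ} (hF0 : ∀ i x, 0 ≤ F i x) (hF : ∀ i, Integrable (F i) μ)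
    (hs : Summable fun i => ∫ x, F i x ∂μ) : ∀ᵐ x ∂μ, Summable fun i => F i x := by
  filter_upwards [ae_lt_top' (.tsum fun i => (hF i).1.aemeasurable.ennreal_ofReal)
    (lintegral_tsum_ofReal_ne_top hF0 hF hs)] with x hx
  simpa [ENNReal.toReal_ofReal (hF0 _ x)] using ENNReal.summable_toReal hx.ne

/-- A series of nonnegative integrable functions with summable integrals has integrable sum. -/
lemma integrable_tsum_of_summable_integral {α ι : Type*} [MeasurableSpace α] {μ : Measure α}
    [Countable ι] {F : ι → α → ℝ} (hF0 : ∀ i x, 0 ≤ F i x) (hF : ∀ i, Integrable (F i) μ)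
    (hs : Summable fun i => ∫ x, F i x ∂μ) : Integrable (fun x => ∑' i, F i x) μ := by
  refine (integrable_toReal_of_lintegral_ne_top
    (.tsum fun i => (hF i).1.aemeasurable.ennreal_ofReal)
    (lintegral_tsum_ofReal_ne_top hF0 hF hs)).congr (ae_of_all _ fun x => ?_)
  simp only
  rw [ENNReal.tsum_toReal_eq (fun _ => ENNReal.ofReal_ne_top)]
  simp [ENNReal.toReal_ofReal (hF0 _ x)]

lemma integral_tsum_of_nonneg {α ι : Type*} [MeasurableSpace α] {μ : Measure α}
    [Countable ι] {F : ι → α → ℝ} (hF0 : ∀ i x, 0 ≤ F i x) (hF : ∀ i, Integrable (F i) μ)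
    (hs : Summable fun i => ∫ x, F i x ∂μ) :
    ∑' i, ∫ x, F i x ∂μ = ∫ x, ∑' i, F i x ∂μ :=
  integral_tsum_of_summable_integral_norm hF
    (by simpa only [Real.norm_of_nonneg (hF0 _ _)] using hs)

lemma norm_sub_sq_le_two_mul (a b : ℂ) : ‖a - b‖ ^ 2 ≤ 2 * ‖a‖ ^ 2 + 2 * ‖b‖ ^ 2 := by
  nlinarith [parallelogram_law_with_norm ℝ a b, sq_nonneg ‖a + b‖]

lemma summable_inner_of_summable_sq {ι : Type*} {v w : ι → ℂ}
    (hv : Summable fun x => ‖v x‖ ^ 2) (hw : Summable fun x => ‖w x‖ ^ 2) :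
    Summable fun x => inner ℝ (v x) (w x) := by
  refine Summable.of_norm_bounded (hv.add hw) fun x => ?_
  have := norm_inner_le_norm (𝕜 := ℝ) (v x) (w x)
  nlinarith [sq_nonneg (‖v x‖ - ‖w x‖), sq_nonneg ‖v x‖, sq_nonneg ‖w x‖]

lemma norm_dGrad_sq_le {d : ℕ} (v : (Fin d → ℤ) → ℂ) (x : Fin d → ℤ) (j : Fin d) :
    ‖dGrad v x j‖ ^ 2 ≤ 2 * ‖v (x + e d j)‖ ^ 2 + 2 * ‖v x‖ ^ 2 :=
  norm_sub_sq_le_two_mul _ _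

lemma summable_shift {d : ℕ} {g : (Fin d → ℤ) → ℝ} (hg : Summable g) (y : Fin d → ℤ) :
    Summable fun x => g (x + y) :=
  (Equiv.addRight y).summable_iff.mpr hg

lemma summable_dGrad_sq {d : ℕ} {v : (Fin d → ℤ) → ℂ} (hv : Summable fun x => ‖v x‖ ^ 2)
    (j : Fin d) : Summable fun x => ‖dGrad v x j‖ ^ 2 :=
  Summable.of_nonneg_of_le (fun _ => sq_nonneg _) (fun x => norm_dGrad_sq_le v x j)
    (((summable_shift hv (e d j)).mul_left 2).add (hv.mul_left 2))

/-- Summation by parts: the discrete divergence is adjoint to the discrete gradient. -/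
lemma tsum_inner_dDiv {d : ℕ} {v : (Fin d → ℤ) → ℂ} {F : (Fin d → ℤ) → Fin d → ℂ}
    (hv : Summable fun x => ‖v x‖ ^ 2) (hF : ∀ j, Summable fun x => ‖F x j‖ ^ 2) :
    ∑' x, inner ℝ (v x) (dDiv F x) = ∑' x, ∑ j, inner ℝ (dGrad v x j) (F x j) := by
  have h1 : ∀ j, Summable fun x => inner ℝ (v (x + e d j)) (F x j) := fun j =>
    summable_inner_of_summable_sq (summable_shift hv (e d j)) (hF j)
  have h2 : ∀ j, Summable fun x => inner ℝ (v x) (F x j) := fun j =>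
    summable_inner_of_summable_sq hv (hF j)
  have h3 : ∀ j, Summable fun x => inner ℝ (v x) (F (x - e d j) j) := fun j => by
    have := (Equiv.subRight (e d j)).summable_iff.mpr (h1 j)
    simpa [Function.comp_def] using this
  have h4 : ∀ j, ∑' x, inner ℝ (v x) (F (x - e d j) j)
      = ∑' x, inner ℝ (v (x + e d j)) (F x j) := fun j => by
    rw [← (Equiv.subRight (e d j)).tsum_eq fun x => inner ℝ (v (x + e d j)) (F x j)]
    simp
  simp only [dDiv, dGrad, inner_sum, inner_sub_left, inner_sub_right]
  rw [Summable.tsum_finsetSum fun j _ => (h3 j).sub (h2 j),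
    Summable.tsum_finsetSum fun j _ => (h1 j).sub (h2 j)]
  refine Finset.sum_congr rfl fun j _ => ?_
  rw [(h3 j).tsum_sub (h2 j), (h1 j).tsum_sub (h2 j), h4]

/-- The entries of a nonnegative symmetric matrix are controlled by its quadratic form. -/
lemma abs_entry_le {d : ℕ} {M : Matrix (Fin d) (Fin d) ℝ} {Lam : ℝ} (hM : M.IsSymm)
    (h0 : ∀ w : Fin d → ℝ, 0 ≤ w ⬝ᵥ M.mulVec w)
    (h1 : ∀ w : Fin d → ℝ, w ⬝ᵥ M.mulVec w ≤ Lam * (∑ j, w j ^ 2)) (j k : Fin d) :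
    |M j k| ≤ Lam := by
  have hjk : M k j = M j k := hM.apply j k
  have key : ∀ i, M i i ≤ Lam := fun i => by
    have := h1 (Pi.single i 1)
    simpa [Pi.single_apply] using this
  have hp := h0 (Pi.single j 1 + Pi.single k 1)
  have hm := h0 (Pi.single j 1 - Pi.single k 1)
  simp [Matrix.mulVec_add, Matrix.mulVec_sub, add_dotProduct, sub_dotProduct, hjk] at hp hm
  rw [abs_le]
  constructor <;> linarith [key j, key k]

lemma re_matMulC {d : ℕ} (M : Matrix (Fin d) (Fin d) ℝ) (w : Fin d → ℂ) (j : Fin d) :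
    (matMulC M w j).re = M.mulVec (fun k => (w k).re) j := by
  simp [matMulC, Matrix.mulVec, dotProduct]

lemma im_matMulC {d : ℕ} (M : Matrix (Fin d) (Fin d) ℝ) (w : Fin d → ℂ) (j : Fin d) :
    (matMulC M w j).im = M.mulVec (fun k => (w k).im) j := by
  simp [matMulC, Matrix.mulVec, dotProduct]

lemma le_sum_inner_matMulC {d : ℕ} {M : Matrix (Fin d) (Fin d) ℝ} {lam : ℝ}
    (h : ∀ w : Fin d → ℝ, lam * (∑ j, w j ^ 2) ≤ w ⬝ᵥ M.mulVec w) (w : Fin d → ℂ) :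
    lam * ∑ j, ‖w j‖ ^ 2 ≤ ∑ j, inner ℝ (w j) (matMulC M w j) := by
  have h1 := h fun k => (w k).re
  have h2 := h fun k => (w k).im
  have e1 : ∑ j, ‖w j‖ ^ 2 = ∑ j, (w j).re ^ 2 + ∑ j, (w j).im ^ 2 := by
    rw [← Finset.sum_add_distrib]
    refine Finset.sum_congr rfl fun j _ => ?_
    rw [Complex.sq_norm, Complex.normSq_apply]; ring
  have e2 : ∑ j, inner ℝ (w j) (matMulC M w j)
      = (fun k => (w k).re) ⬝ᵥ M.mulVec (fun k => (w k).re)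
        + (fun k => (w k).im) ⬝ᵥ M.mulVec (fun k => (w k).im) := by
    rw [dotProduct, dotProduct, ← Finset.sum_add_distrib]
    refine Finset.sum_congr rfl fun j _ => ?_
    rw [← re_matMulC, ← im_matMulC, Complex.inner]
    simp
    ring
  rw [e1, e2]
  linarith

lemma norm_matMulC_sq_le {d : ℕ} {M : Matrix (Fin d) (Fin d) ℝ} {Lam : ℝ}
    (h : ∀ j k, |M j k| ≤ Lam) (w : Fin d → ℂ) (j : Fin d) :
    ‖matMulC M w j‖ ^ 2 ≤ d * Lam ^ 2 * ∑ k, ‖w k‖ ^ 2 := by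
  have h1 : ‖matMulC M w j‖ ≤ ∑ k, Lam * ‖w k‖ := by
    refine (norm_sum_le _ _).trans (Finset.sum_le_sum fun k _ => ?_)
    rw [norm_mul, Complex.norm_real]
    exact mul_le_mul_of_nonneg_right (h j k) (norm_nonneg _)
  calc ‖matMulC M w j‖ ^ 2 ≤ (∑ k, Lam * ‖w k‖) ^ 2 := pow_le_pow_left₀ (norm_nonneg _) h1 2
    _ ≤ (Finset.univ : Finset (Fin d)).card * ∑ k, (Lam * ‖w k‖) ^ 2 :=
      sq_sum_le_card_mul_sum_sq
    _ = d * Lam ^ 2 * ∑ k, ‖w k‖ ^ 2 := by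
      simp [mul_pow, Finset.mul_sum, mul_assoc]

lemma summable_component_sq {d : ℕ} {F : (Fin d → ℤ) → Fin d → ℂ}
    (hF : Summable fun x => ∑ j, ‖F x j‖ ^ 2) (j : Fin d) : Summable fun x => ‖F x j‖ ^ 2 :=
  Summable.of_nonneg_of_le (fun _ => sq_nonneg _)
    (fun x => Finset.single_le_sum (f := fun j => ‖F x j‖ ^ 2) (fun _ _ => sq_nonneg _)
      (Finset.mem_univ j)) hF

/-- The energy estimate at a fixed time, with a weighted Young inequality on the right. -/
lemma energy_inequality {d : ℕ} {lam Lam η t : ℝ} (hlam : 0 < lam) (ht : 0 < t)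
    {A : (Fin d → ℤ) → Matrix (Fin d) (Fin d) ℝ} (hsymm : ∀ z, (A z).IsSymm)
    (hlb : ∀ z (w : Fin d → ℝ), lam * (∑ j, w j ^ 2) ≤ w ⬝ᵥ (A z).mulVec w)
    (hub : ∀ z (w : Fin d → ℝ), w ⬝ᵥ (A z).mulVec w ≤ Lam * (∑ j, w j ^ 2))
    {f : (Fin d → ℤ) → Fin d → ℂ} (hf : Summable fun z => ∑ j, ‖f z j‖ ^ 2)
    {v w : (Fin d → ℤ) → ℂ} (hv : Summable fun z => ‖v z‖ ^ 2)
    (hw : Summable fun z => ‖w z‖ ^ 2)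
    (h : ∀ z, (η : ℂ) * v z - w z + dDiv (fun x => matMulC (A x) (dGrad v x)) z
      = -dDiv f z) :
    η * (∑' z, ‖v z‖ ^ 2) + lam * (∑' z, ∑ j, ‖dGrad v z j‖ ^ 2)
      ≤ (∑' z, inner ℝ (v z) (w z))
        + (t * (∑' z, ∑ j, ‖f z j‖ ^ 2) + t⁻¹ * ∑' z, ∑ j, ‖dGrad v z j‖ ^ 2) / 2 := by
  have hgj := summable_dGrad_sq hv
  have hg : Summable fun z => ∑ j, ‖dGrad v z j‖ ^ 2 := summable_sum fun j _ => hgj j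
  have hfj := summable_component_sq hf
  have hAj : ∀ j, Summable fun z => ‖matMulC (A z) (dGrad v z) j‖ ^ 2 := fun j =>
    Summable.of_nonneg_of_le (fun _ => sq_nonneg _)
      (fun z => norm_matMulC_sq_le (abs_entry_le (hsymm z)
        (fun y => (by positivity : 0 ≤ lam * ∑ j, y j ^ 2).trans (hlb z y)) (hub z)) _ j)
      (hg.mul_left _)
  have i1 := tsum_inner_dDiv hv hfj
  have i2 := tsum_inner_dDiv hv hAj
  have s1 : Summable fun z => ∑ j, inner ℝ (dGrad v z j) (f z j) :=
    summable_sum fun j _ => summable_inner_of_summable_sq (hgj j) (hfj j)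
  have s2 : Summable fun z => ∑ j, inner ℝ (dGrad v z j) (matMulC (A z) (dGrad v z) j) :=
    summable_sum fun j _ => summable_inner_of_summable_sq (hgj j) (hAj j)
  have s3 := summable_inner_of_summable_sq hv hw
  have hdiv : ∀ z, dDiv (fun x j => matMulC (A x) (dGrad v x) j + f x j) z
      = w z - (η : ℂ) * v z := fun z => by
    have hz := h z
    have : dDiv (fun x j => matMulC (A x) (dGrad v x) j + f x j) z
        = dDiv (fun x => matMulC (A x) (dGrad v x)) z + dDiv f z := by
      simp only [dDiv, ← Finset.sum_add_distrib]
      exact Finset.sum_congr rfl fun j _ => by ring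
    rw [this]
    linear_combination hz
  have hsum : ∀ j, Summable fun z => ‖matMulC (A z) (dGrad v z) j + f z j‖ ^ 2 := fun j =>
    Summable.of_nonneg_of_le (fun _ => sq_nonneg _)
      (fun z => by
        simpa using norm_sub_sq_le_two_mul (matMulC (A z) (dGrad v z) j) (-f z j))
      (((hAj j).mul_left 2).add ((hfj j).mul_left 2))
  have i3 := tsum_inner_dDiv hv hsum
  simp only [hdiv, inner_sub_right, inner_add_right, Finset.sum_add_distrib] at i3
  have hη : ∀ z, inner ℝ (v z) ((η : ℂ) * v z) = η * ‖v z‖ ^ 2 := fun z => by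
    rw [← Complex.real_smul, real_inner_smul_right, real_inner_self_eq_norm_sq]
  simp only [hη] at i3
  rw [s3.tsum_sub (hv.mul_left η), s2.tsum_add s1, tsum_mul_left] at i3
  have b2 : lam * (∑' z, ∑ j, ‖dGrad v z j‖ ^ 2)
      ≤ ∑' z, ∑ j, inner ℝ (dGrad v z j) (matMulC (A z) (dGrad v z) j) := by
    rw [← tsum_mul_left]
    exact (hg.mul_left lam).tsum_le_tsum (fun z => le_sum_inner_matMulC (hlb z) _) s2
  have b1 : -(∑' z, ∑ j, inner ℝ (dGrad v z j) (f z j))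
      ≤ (t * (∑' z, ∑ j, ‖f z j‖ ^ 2) + t⁻¹ * ∑' z, ∑ j, ‖dGrad v z j‖ ^ 2) / 2 := by
    rw [← tsum_neg, ← tsum_mul_left, ← tsum_mul_left,
      ← (hf.mul_left t).tsum_add (hg.mul_left t⁻¹), ← tsum_div_const]
    refine s1.neg.tsum_le_tsum (fun z => ?_) (((hf.mul_left t).add (hg.mul_left t⁻¹)).div_const 2)
    rw [Finset.mul_sum, Finset.mul_sum, ← Finset.sum_add_distrib, Finset.sum_div,
      ← Finset.sum_neg_distrib]
    refine Finset.sum_le_sum fun j _ => ?_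
    have c1 := (neg_le_abs _).trans (abs_real_inner_le_norm (dGrad v z j) (f z j))
    have c2 : t * ‖f z j‖ ^ 2 + t⁻¹ * ‖dGrad v z j‖ ^ 2 - 2 * (‖dGrad v z j‖ * ‖f z j‖)
        = t⁻¹ * (t * ‖f z j‖ - ‖dGrad v z j‖) ^ 2 := by
      field_simp
      ring
    have c3 : 0 ≤ t⁻¹ * (t * ‖f z j‖ - ‖dGrad v z j‖) ^ 2 := by positivity
    linarith
  linarith

/-- Optimising the weight in Young's inequality. -/
lemma le_mul_of_forall_young {X G B : ℝ} (hG : 0 ≤ G) (hB : 0 ≤ B)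
    (h : ∀ t : ℝ, 0 < t → X ≤ (t * B ^ 2 + t⁻¹ * G ^ 2) / 2) : X ≤ G * B := by
  have key : ∀ δ : ℝ, 0 < δ → X ≤ G * B + δ * ((B + G) / 2) := fun δ hδ => by
    have h1 := h ((G + δ) / (B + δ)) (by positivity)
    have h2 : (G + δ) / (B + δ) * B ^ 2 ≤ (G + δ) * B := by
      rw [div_mul_eq_mul_div, div_le_iff₀ (by positivity)]
      nlinarith [mul_nonneg (mul_nonneg (add_nonneg hG hδ.le) hB) hδ.le]
    have h3 : ((G + δ) / (B + δ))⁻¹ * G ^ 2 ≤ (B + δ) * G := by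
      rw [inv_div, div_mul_eq_mul_div, div_le_iff₀ (by positivity)]
      nlinarith [mul_nonneg (mul_nonneg (add_nonneg hB hδ.le) hG) hδ.le]
    linarith
  have hc : Tendsto (fun δ : ℝ => G * B + δ * ((B + G) / 2)) (nhdsWithin 0 (Set.Ioi 0))
      (nhds (G * B)) := by
    have : Continuous fun δ : ℝ => G * B + δ * ((B + G) / 2) := by fun_prop
    simpa using (this.tendsto 0).mono_left nhdsWithin_le_nhds
  exact ge_of_tendsto hc (eventually_nhdsWithin_of_forall key)

/-- An integrable minorant of the derivative of a function vanishing at `±∞` has nonpositive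
integral. -/
lemma integral_nonpos_of_le_deriv {h φ φ' : ℝ → ℝ} (hh : Integrable h)
    (hφ : ∀ s, HasDerivAt φ (φ' s) s) (hφ' : Continuous φ')
    (htop : Tendsto φ atTop (nhds 0)) (hbot : Tendsto φ atBot (nhds 0))
    (hle : ∀ᵐ s, h s ≤ φ' s) : ∫ s, h s ≤ 0 := by
  have l1 := intervalIntegral_tendsto_integral hh tendsto_neg_atTop_atBot tendsto_id
  have l2 : Tendsto (fun R => φ R - φ (-R)) atTop (nhds 0) := by
    simpa using htop.sub (hbot.comp tendsto_neg_atTop_atBot)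
  refine le_of_tendsto_of_tendsto l1 l2 ?_
  filter_upwards [eventually_ge_atTop (0 : ℝ)] with R hR
  rw [← intervalIntegral.integral_eq_sub_of_hasDerivAt (fun s _ => hφ s)
    (hφ'.intervalIntegrable _ _)]
  exact intervalIntegral.integral_mono_ae (by simp only [id]; linarith) hh.intervalIntegrable
    (hφ'.intervalIntegrable _ _) hle

lemma lp_summable_sq {d : ℕ} (U : L2Z d) : Summable fun z => ‖U z‖ ^ 2 := by
  have := (memℓp_gen_iff (p := 2) (by simp)).mp (lp.memℓp U)
  simpa using this

theorem stmt7 (d : ℕ) (hd : 1 ≤ d) (lam Lam η : ℝ) (hlam : 0 < lam) (hll : lam ≤ Lam)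
    (hη : 0 < η)
    (a : (Fin d → ℤ) → ℝ → Matrix (Fin d) (Fin d) ℝ)
    (ha_meas : ∀ z j k, Measurable fun s => a z s j k)
    (ha_symm : ∀ z s, (a z s).IsSymm)
    (ha_lb : ∀ z s (w : Fin d → ℝ), lam * (∑ j, w j ^ 2) ≤ w ⬝ᵥ (a z s).mulVec w)
    (ha_ub : ∀ z s (w : Fin d → ℝ), w ⬝ᵥ (a z s).mulVec w ≤ Lam * (∑ j, w j ^ 2))
    (f : (Fin d → ℤ) → ℝ → Fin d → ℂ) (hf : VMemL2 f)
    (u : (Fin d → ℤ) → ℝ → ℂ) (hu : MemL2 u)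
    -- the `ℓ²(ℤ^d)`-valued map `s ↦ u(·,s)` and its derivative `s ↦ ∂u/∂s(·,s)`
    (U U' : ℝ → L2Z d)
    (hUu : ∀ s z, U s z = u z s)
    (hderiv : ∀ s, HasDerivAt U (U' s) s)
    (hU'cont : Continuous U')
    (hdecay_top : Tendsto (fun s => ‖U s‖) atTop (nhds 0))
    (hdecay_bot : Tendsto (fun s => ‖U s‖) atBot (nhds 0))
    -- `η u(z,s) − ∂u/∂s(z,s) + ∇*( a(·,s) ∇u(·,s) )(z) = −∇*f(z,s)`
    (hPDE : ∀ z s, (η : ℂ) * u z s - U' s z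
        + dDiv (fun x => matMulC (a x s) (dGrad (fun z' => u z' s) x)) z
      = -dDiv (fun x => f x s) z) :
    η * sqNorm u + lam * gradSqNorm u
        ≤ Real.sqrt (gradSqNorm u) * Real.sqrt (vSqNorm f) ∧
      Real.sqrt (gradSqNorm u) ≤ Real.sqrt (vSqNorm f) / lam := by
  have hU : Continuous U := continuous_iff_continuousAt.mpr fun s => (hderiv s).continuousAt
  have hcont : ∀ z, Continuous fun s => u z s := fun z => by
    have : Continuous fun s => U s z :=
      (lp.evalCLM ℝ (fun _ : Fin d → ℤ => ℂ) 2 z).continuous.comp hU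
    simpa only [hUu] using this
  have hvs : ∀ s, Summable fun z => ‖u z s‖ ^ 2 := fun s => by
    simpa only [hUu] using lp_summable_sq (U s)
  have hgj : ∀ z j, Integrable fun s => ‖dGrad (fun z' => u z' s) z j‖ ^ 2 := fun z j => by
    refine (((hu.1 (z + e d j)).const_mul 2).add ((hu.1 z).const_mul 2)).mono'
      (Continuous.aestronglyMeasurable ?_) (ae_of_all _ fun s => ?_)
    · exact (((hcont _).sub (hcont _)).norm).pow 2
    · rw [Real.norm_of_nonneg (sq_nonneg _)]
      exact norm_dGrad_sq_le (fun z' => u z' s) z j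
  have hgi : ∀ z, Integrable fun s => ∑ j, ‖dGrad (fun z' => u z' s) z j‖ ^ 2 :=
    fun z => integrable_finsetSum _ fun j _ => hgj z j
  have hgs : Summable fun z => ∫ s, ∑ j, ‖dGrad (fun z' => u z' s) z j‖ ^ 2 := by
    simp_rw [integral_finsetSum Finset.univ fun j _ => hgj _ j]
    refine summable_sum fun j _ => Summable.of_nonneg_of_le
      (fun z => integral_nonneg fun s => sq_nonneg _) (fun z => ?_)
      (((summable_shift hu.2 (e d j)).mul_left 2).add (hu.2.mul_left 2))
    rw [← integral_const_mul, ← integral_const_mul,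
      ← integral_add ((hu.1 _).const_mul 2) ((hu.1 _).const_mul 2)]
    exact integral_mono (hgj z j) (((hu.1 _).const_mul 2).add ((hu.1 _).const_mul 2))
      fun s => norm_dGrad_sq_le (fun z' => u z' s) z j
  have hu0 : ∀ z s, 0 ≤ ‖u z s‖ ^ 2 := fun _ _ => sq_nonneg _
  have hg0 : ∀ z s, 0 ≤ ∑ j, ‖dGrad (fun z' => u z' s) z j‖ ^ 2 := fun _ _ => by positivity
  have hf0 : ∀ z s, 0 ≤ ∑ j, ‖f z s j‖ ^ 2 := fun _ _ => by positivity
  have hG0 : 0 ≤ gradSqNorm u := tsum_nonneg fun z => integral_nonneg (hg0 z)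
  have hB0 : 0 ≤ vSqNorm f := tsum_nonneg fun z => integral_nonneg (hf0 z)
  have hX0 : 0 ≤ sqNorm u := tsum_nonneg fun z => integral_nonneg (hu0 z)
  have Iu := integrable_tsum_of_summable_integral hu0 hu.1 hu.2
  have Ig := integrable_tsum_of_summable_integral hg0 hgi hgs
  have If := integrable_tsum_of_summable_integral hf0 hf.1 hf.2
  have main : η * sqNorm u + lam * gradSqNorm u ≤ √(gradSqNorm u) * √(vSqNorm f) := by
    refine le_mul_of_forall_young (Real.sqrt_nonneg _) (Real.sqrt_nonneg _) fun t ht => ?_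
    rw [Real.sq_sqrt hG0, Real.sq_sqrt hB0]
    have hsq : ∀ s, HasDerivAt (fun s => ‖U s‖ ^ 2 / 2) (inner ℝ (U s) (U' s)) s := fun s => by
      simpa using (hderiv s).norm_sq.div_const 2
    have J1 := Iu.const_mul η
    have J2 := Ig.const_mul lam
    have J3 := If.const_mul t
    have J4 := Ig.const_mul t⁻¹
    have key := integral_nonpos_of_le_deriv ((J1.add J2).sub ((J3.add J4).div_const 2)) hsq
      (hU.inner hU'cont) (by simpa using (hdecay_top.pow 2).div_const 2)
      (by simpa using (hdecay_bot.pow 2).div_const 2) (by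
        filter_upwards [ae_summable_of_summable_integral hf0 hf.1 hf.2] with s hs
        have := energy_inequality hlam ht (fun z => ha_symm z s) (fun z => ha_lb z s)
          (fun z => ha_ub z s) hs (hvs s) (lp_summable_sq (U' s)) (fun z => hPDE z s)
        have hin : inner ℝ (U s) (U' s) = ∑' z, inner ℝ (u z s) (U' s z) := by
          rw [lp.inner_eq_tsum]
          simp only [hUu]
        simp only [Pi.sub_apply, Pi.add_apply]
        rw [hin]
        linarith)
    rw [integral_sub' (J1.add J2) ((J3.add J4).div_const 2), integral_add' J1 J2, integral_div,
      integral_add' J3 J4] at key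
    simp only [integral_const_mul] at key
    rw [← integral_tsum_of_nonneg hu0 hu.1 hu.2, ← integral_tsum_of_nonneg hg0 hgi hgs,
      ← integral_tsum_of_nonneg hf0 hf.1 hf.2] at key
    simp only [sqNorm, gradSqNorm, vSqNorm]
    linarith
  refine ⟨main, ?_⟩
  rw [le_div_iff₀ hlam]
  rcases (Real.sqrt_nonneg (gradSqNorm u)).eq_or_lt with h0 | hpos
  · rw [← h0, zero_mul]
    exact Real.sqrt_nonneg _
  · refine le_of_mul_le_mul_left ?_ hpos
    have := Real.mul_self_sqrt hG0
    nlinarith [mul_nonneg hη.le hX0]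

end Stmt7
end
end

section
/- Let d ≥ 1, 0 < λ ≤ Λ and t ∈ ℝ. Let a : ℤ^d × (−∞,t] → ℝ^{d×d} be measurable such that each a(y,s) is a diagonal matrix with diagonal entries a_{jj}(y,s) ∈ [λ, Λ]. Let u₀ ∈ ℓ²(ℤ^d) be real-valued with u₀(y) ≥ 0 for all y, and suppose u : ℤ^d × (−∞,t] → ℝ is such that the ℓ²(ℤ^d)-valued map s ↦ u(·,s) is continuously differentiable on (−∞,t] with derivative s ↦ ∂u/∂s(·,s), u(·,t) = u₀, and ∂u/∂s(y,s) = (1/2) ∇*( a(·,s) ∇u(·,s) )(y) for all y ∈ ℤ^d and s < t. Then u(y,s) ≥ 0 for all y ∈ ℤ^d and all s ≤ t. -/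
open MeasureTheory Real Filter Matrix
open scoped ENNReal BigOperators

noncomputable section

namespace Stmt10

/-- The `j`-th standard basis vector of `ℤ^d`. -/
def e (d : ℕ) (j : Fin d) : Fin d → ℤ := fun k => if k = j then 1 else 0

/-- Discrete gradient `∇u(x) j = u(x+e_j) - u(x)`. -/
def dGrad {d : ℕ} (u : (Fin d → ℤ) → ℝ) (x : Fin d → ℤ) : Fin d → ℝ :=
  fun j => u (x + e d j) - u x

/-- Discrete divergence `∇*F(x) = Σ_j [F_j(x-e_j) - F_j(x)]`. -/
def dDiv {d : ℕ} (F : (Fin d → ℤ) → Fin d → ℝ) (x : Fin d → ℤ) : ℝ :=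
  ∑ j, (F (x - e d j) j - F x j)

/-- `ℓ²(ℤ^d)` (real-valued). -/
abbrev L2Z (d : ℕ) := lp (fun _ : Fin d → ℤ => ℝ) 2

/-- A discrete divergence-form operator, shifted by `d * Lam`, is bounded above by `d * Lam * b` on
functions bounded below by `-b`. -/
lemma half_dDiv_sub_le {d : ℕ} {Lam b : ℝ} {A : (Fin d → ℤ) → Matrix (Fin d) (Fin d) ℝ}
    {v : (Fin d → ℤ) → ℝ} (hdiag : ∀ y j k, j ≠ k → A y j k = 0)
    (h0 : ∀ y j, 0 ≤ A y j j) (h1 : ∀ y j, A y j j ≤ Lam)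
    (hv : ∀ y, -b ≤ v y) (y : Fin d → ℤ) :
    (1 / 2 : ℝ) * dDiv (fun x j => ∑ k, A x j k * dGrad v x k) y - d * Lam * v y
      ≤ d * Lam * b := by
  have hsum : ∀ x j, ∑ k, A x j k * dGrad v x k = A x j j * dGrad v x j := fun x j =>
    Finset.sum_eq_single j (fun k _ hk => by rw [hdiag x j k hk.symm, zero_mul]) (by simp)
  have key : (1 / 2 : ℝ) * dDiv (fun x j => ∑ k, A x j k * dGrad v x k) y
      ≤ ∑ _j : Fin d, Lam * (v y + b) := by
    simp only [dDiv, hsum]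
    simp only [dGrad, sub_add_cancel]
    rw [Finset.mul_sum]
    refine Finset.sum_le_sum fun j _ => ?_
    have p1 := mul_nonneg (h0 (y - e d j) j) (neg_le_iff_add_nonneg.1 (hv (y - e d j)))
    have p2 := mul_nonneg (h0 y j) (neg_le_iff_add_nonneg.1 (hv (y + e d j)))
    have p3 := mul_nonneg (sub_nonneg.2 (h1 (y - e d j) j)) (neg_le_iff_add_nonneg.1 (hv y))
    have p4 := mul_nonneg (sub_nonneg.2 (h1 y j)) (neg_le_iff_add_nonneg.1 (hv y))
    linarith
  rw [Finset.sum_const, Finset.card_univ, Fintype.card_fin, nsmul_eq_mul] at key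
  linarith

/-- Evaluation at a point preserves derivatives of `ℓ²(ℤ^d)`-valued maps. -/
lemma hasDerivWithinAt_eval {d : ℕ} {U : ℝ → L2Z d} {V : L2Z d} {S : Set ℝ} {s : ℝ}
    (h : HasDerivWithinAt U V S s) (y : Fin d → ℤ) :
    HasDerivWithinAt (fun r => U r y) (V y) S s :=
  (lp.evalCLM ℝ (fun _ : Fin d → ℤ => ℝ) 2 y).hasFDerivAt.comp_hasDerivWithinAt s h

/-- Backward Picard iteration: if `w` is nonnegative at time `t`, and every lower bound `-b`
at a time `s` forces `∂w/∂s ≤ K b`, then a bounded `w` is nonnegative on `[r, t]`. -/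
lemma nonneg_of_deriv_le {ι : Type*} {w w' : ι → ℝ → ℝ} {r t K B : ℝ} (hB : 0 ≤ B) (hK : 0 ≤ K)
    (hcont : ∀ y, ContinuousOn (w y) (Set.Icc r t))
    (hderiv : ∀ y, ∀ s ∈ Set.Ioo r t, HasDerivAt (w y) (w' y s) s)
    (hle : ∀ s ∈ Set.Ioo r t, ∀ b, 0 ≤ b → (∀ y, -b ≤ w y s) → ∀ y, w' y s ≤ K * b)
    (hbdd : ∀ y, ∀ s ∈ Set.Icc r t, -B ≤ w y s) (hterm : ∀ y, 0 ≤ w y t) :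
    ∀ y, ∀ s ∈ Set.Icc r t, 0 ≤ w y s := by
  have main : ∀ n : ℕ, ∀ y, ∀ s ∈ Set.Icc r t,
      -(B * ((K * (t - s)) ^ n / n.factorial)) ≤ w y s := by
    intro n
    induction n with
    | zero => simpa using hbdd
    | succ n ih =>
      intro y s hs
      have hg : ∀ x, HasDerivAt (fun s => B * ((K * (t - s)) ^ (n + 1) / (n + 1).factorial))
          (-(K * (B * ((K * (t - x)) ^ n / n.factorial)))) x := by
        intro x
        have h := (((((hasDerivAt_id x).const_sub t).const_mul K).pow (n + 1)).div_const
          ((n + 1).factorial : ℝ)).const_mul B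
        refine h.congr_deriv ?_
        have : (n.factorial : ℝ) ≠ 0 := by positivity
        rw [Nat.factorial_succ]
        push_cast
        simp only [id]
        field_simp
      have hanti : AntitoneOn
          (fun s => w y s + B * ((K * (t - s)) ^ (n + 1) / (n + 1).factorial))
          (Set.Icc r t) := by
        refine antitoneOn_of_hasDerivWithinAt_nonpos (convex_Icc r t)
          (f' := fun x => w' y x + -(K * (B * ((K * (t - x)) ^ n / n.factorial))))
          ((hcont y).add fun x _ => (hg x).continuousAt.continuousWithinAt) ?_ ?_
        · intro x hx
          rw [interior_Icc] at hx
          exact ((hderiv y x hx).add (hg x)).hasDerivWithinAt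
        · intro x hx
          rw [interior_Icc] at hx
          have hx0 : 0 ≤ t - x := sub_nonneg.2 hx.2.le
          have := hle x hx _ (by positivity) (fun z => ih z x (Set.Ioo_subset_Icc_self hx)) y
          linarith
      have h := hanti hs (Set.right_mem_Icc.2 (hs.1.trans hs.2)) hs.2
      have ht := hterm y
      simp only [sub_self, mul_zero, ne_eq, Nat.add_eq_zero_iff, one_ne_zero, and_false,
        not_false_eq_true, zero_pow, zero_div, add_zero] at h
      linarith
  intro y s hs
  have hlim := ((FloorSemiring.tendsto_pow_div_factorial_atTop (K * (t - s))).const_mul B).neg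
  simp only [mul_zero, neg_zero] at hlim
  exact le_of_tendsto' hlim fun n => main n y s hs

theorem stmt10 (d : ℕ) (hd : 1 ≤ d) (lam Lam t : ℝ) (hlam : 0 < lam) (hll : lam ≤ Lam)
    (a : (Fin d → ℤ) → ℝ → Matrix (Fin d) (Fin d) ℝ)
    (ha_meas : ∀ y j k, Measurable fun s => a y s j k)
    -- each `a(y,s)` is diagonal …
    (ha_diag : ∀ y s, s ≤ t → ∀ j k, j ≠ k → a y s j k = 0)
    -- … with diagonal entries in `[λ, Λ]`
    (ha_icc : ∀ y s, s ≤ t → ∀ j, a y s j j ∈ Set.Icc lam Lam)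
    (u₀ : L2Z d) (hu₀ : ∀ y, 0 ≤ u₀ y)
    (u : (Fin d → ℤ) → ℝ → ℝ)
    -- the `ℓ²(ℤ^d)`-valued map `s ↦ u(·,s)`, continuously differentiable on `(−∞,t]`
    (U U' : ℝ → L2Z d)
    (hUu : ∀ s, s ≤ t → ∀ y, U s y = u y s)
    (hderiv : ∀ s ∈ Set.Iic t, HasDerivWithinAt U (U' s) (Set.Iic t) s)
    (hU'cont : ContinuousOn U' (Set.Iic t))
    -- terminal condition `u(·,t) = u₀`
    (hterm : ∀ y, u y t = u₀ y)
    -- `∂u/∂s(y,s) = (1/2) ∇*( a(·,s) ∇u(·,s) )(y)` for `s < t`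
    (hPDE : ∀ y s, s < t → U' s y
      = (1 / 2 : ℝ) * dDiv (fun x j => ∑ k, a x s j k * dGrad (fun z => u z s) x k) y) :
    ∀ y s, s ≤ t → 0 ≤ u y s := by
  intro y₀ r hr
  have hK : 0 ≤ d * Lam := mul_nonneg d.cast_nonneg (hlam.le.trans hll)
  set K : ℝ := d * Lam with hKdef
  have hUcont : ContinuousOn U (Set.Icc r t) := fun s hs =>
    ((hderiv s hs.2).continuousWithinAt).mono Set.Icc_subset_Iic_self
  obtain ⟨C, hC⟩ := isCompact_Icc.exists_bound_of_continuousOn hUcont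
  have hC0 : 0 ≤ C := (norm_nonneg _).trans (hC r (Set.left_mem_Icc.2 hr))
  have hexp : ∀ s, HasDerivAt (fun s => exp (K * (t - s))) (exp (K * (t - s)) * -K) s := by
    intro s
    have h := (((hasDerivAt_id s).const_sub t).const_mul K).exp
    simpa using h
  have h := nonneg_of_deriv_le (w := fun y s => exp (K * (t - s)) * U s y)
    (w' := fun y s => exp (K * (t - s)) * -K * U s y + exp (K * (t - s)) * U' s y)
    (r := r) (t := t) (K := K) (B := exp (K * (t - r)) * C) (by positivity) hK ?_ ?_ ?_ ?_ ?_
    y₀ r (Set.left_mem_Icc.2 hr)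
  · rw [← hUu r hr]
    exact nonneg_of_mul_nonneg_right h (exp_pos _)
  · intro y
    refine ContinuousOn.mul (fun s _ => (hexp s).continuousAt.continuousWithinAt) fun s hs => ?_
    exact (hasDerivWithinAt_eval (hderiv s hs.2) y).continuousWithinAt.mono
      Set.Icc_subset_Iic_self
  · intro y s hs
    exact (hexp s).mul
      ((hasDerivWithinAt_eval (hderiv s hs.2.le) y).hasDerivAt (Iic_mem_nhds hs.2))
  · intro s hs b hb hlow y
    have hst := hs.2.le
    have hE := exp_pos (K * (t - s))
    have hv : ∀ z, -(b / exp (K * (t - s))) ≤ u z s := by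
      intro z
      rw [← hUu s hst, ← neg_div, div_le_iff₀' hE]
      exact hlow z
    have key := half_dDiv_sub_le (A := fun x => a x s) (fun x => ha_diag x s hst)
      (fun x j => hlam.le.trans (ha_icc x s hst j).1) (fun x j => (ha_icc x s hst j).2) hv y
    rw [← hPDE y s hs.2, ← hUu s hst, ← hKdef] at key
    have h2 := mul_le_mul_of_nonneg_left key hE.le
    have h3 : exp (K * (t - s)) * (K * (b / exp (K * (t - s)))) = K * b := by
      field_simp
    linarith
  · intro y s hs
    have h1 : |U s y| ≤ C :=
      (lp.norm_apply_le_norm (by norm_num) (U s) y).trans (hC s hs)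
    have h2 : exp (K * (t - s)) ≤ exp (K * (t - r)) :=
      exp_le_exp.2 (mul_le_mul_of_nonneg_left (by linarith [hs.1]) hK)
    have h3 := mul_le_mul_of_nonneg_left (abs_le.1 h1).1 (exp_pos (K * (t - s))).le
    have h4 := mul_le_mul_of_nonneg_right h2 hC0
    linarith
  · intro y
    rw [hUu t le_rfl, hterm]
    exact mul_nonneg (exp_pos _).le (hu₀ y)

end Stmt10
end
end
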